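/- Let d = 4. Let q, r, q̄, r̄ ≥ 2 satisfy the strict inequalities 1/q < (3/2)(1/2 − 1/r) and 1/q̄ < (3/2)(1/2 − 1/r̄). Then there is a constant C = C(q,r,q̄,r̄) such that for all f, g ∈ ℓ²(ℤ⁴) and all F ∈ L^{q̄'}_t ℓ^{r̄'}_x, the function u(t) = cos(t√(1−Δ))f + (sin(t√(1−Δ))/√(1−Δ))g + ∫₀^t (sin((t−s)√(1−Δ))/√(1−Δ))F(s) ds satisfies ‖u‖_{L^q_t ℓ^r_x} ≤ C(‖f‖_{ℓ²} + ‖g‖_{ℓ²} + ‖F‖_{L^{q̄'}_t ℓ^{r̄'}_x}). -/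

import Mathlib

open MeasureTheory Real
open scoped ENNReal

noncomputable section

/-- Dispersion relation of the discrete Klein--Gordon equation on `ℤ^d`. -/
def omegaKG (d : ℕ) (ξ : Fin d → ℝ) : ℝ :=
  Real.sqrt (1 + ∑ j : Fin d, 2 * (1 - Real.cos (ξ j)))

/-- The fundamental domain `[0, 2π]^d` of the torus. -/
def cube (d : ℕ) : Set (Fin d → ℝ) := Set.Icc 0 (fun _ => 2 * Real.pi)

/-- The convolution kernel of the Fourier multiplier on `ℤ^d` with symbol `m(ξ)`. -/
def multKernel (d : ℕ) (m : (Fin d → ℝ) → ℝ) (x : Fin d → ℤ) : ℂ :=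
  ((((2 * Real.pi) ^ d)⁻¹ : ℝ) : ℂ) *
    ∫ ξ in cube d,
      Complex.exp (Complex.I * ((∑ j : Fin d, (x j : ℝ) * ξ j : ℝ) : ℂ)) * ((m ξ : ℝ) : ℂ)

/-- The propagator `cos(t√(1−Δ))`, realized as the Fourier multiplier with symbol
`cos(t ω(ξ))`. -/
def cosProp (d : ℕ) (t : ℝ) (f : (Fin d → ℤ) → ℂ) (x : Fin d → ℤ) : ℂ :=
  ∑' y : Fin d → ℤ, multKernel d (fun ξ => Real.cos (t * omegaKG d ξ)) (x - y) * f y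

/-- The propagator `sin(t√(1−Δ))/√(1−Δ)`, realized as the Fourier multiplier with symbol
`sin(t ω(ξ))/ω(ξ)`. -/
def sinProp (d : ℕ) (t : ℝ) (f : (Fin d → ℤ) → ℂ) (x : Fin d → ℤ) : ℂ :=
  ∑' y : Fin d → ℤ, multKernel d (fun ξ => Real.sin (t * omegaKG d ξ) / omegaKG d ξ) (x - y) * f y

/-- The operator `√(1−Δ)`, realized as the Fourier multiplier with symbol `ω(ξ)`. -/
def sqrtOneSubLap (d : ℕ) (f : (Fin d → ℤ) → ℂ) (x : Fin d → ℤ) : ℂ :=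
  ∑' y : Fin d → ℤ, multKernel d (omegaKG d) (x - y) * f y

/-- The solution of the inhomogeneous discrete Klein--Gordon equation with data `(f,g)`
and forcing term `F`, given by Duhamel's formula. -/
def duhamel (d : ℕ) (t : ℝ) (f g : (Fin d → ℤ) → ℂ) (F : ℝ → (Fin d → ℤ) → ℂ)
    (x : Fin d → ℤ) : ℂ :=
  cosProp d t f x + sinProp d t g x + ∫ s in (0:ℝ)..t, sinProp d (t - s) (F s) x

/-- The `L^q` norm in time of an `ℝ≥0∞`-valued function. -/
def lqNorm (q : ℝ≥0∞) (g : ℝ → ℝ≥0∞) : ℝ≥0∞ :=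
  if q = ∞ then essSup g volume else (∫⁻ t, g t ^ q.toReal) ^ (1 / q.toReal)

/-- The mixed space-time norm `‖F‖_{L^q_t ℓ^r_x}`. -/
def mixedNorm (d : ℕ) (q r : ℝ≥0∞) (F : ℝ → (Fin d → ℤ) → ℂ) : ℝ≥0∞ :=
  lqNorm q fun t => eLpNorm (F t) r Measure.count

/-- The first derivative test of van der Corput, convex phases. -/
lemma norm_integral_exp_le_of_le_abs_deriv_of_nonneg {φ φ' φ'' : ℝ → ℝ} {a b l : ℝ} (hab : a ≤ b)
    (hl : 0 < l) (h1 : ∀ x ∈ Set.Icc a b, HasDerivAt φ (φ' x) x)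
    (h2 : ∀ x ∈ Set.Icc a b, HasDerivAt φ' (φ'' x) x) (hc : ContinuousOn φ'' (Set.Icc a b))
    (hs : ∀ x ∈ Set.Icc a b, 0 ≤ φ'' x) (hlow : ∀ x ∈ Set.Icc a b, l ≤ |φ' x|) :
    ‖∫ x in a..b, Complex.exp (Complex.I * φ x)‖ ≤ 4 / l := by
  have hne : ∀ x ∈ Set.Icc a b, φ' x ≠ 0 := fun x hx h => by
    have := hlow x hx; rw [h, abs_zero] at this; linarith
  have hφc : ContinuousOn φ (Set.Icc a b) := fun x hx => (h1 x hx).continuousAt.continuousWithinAt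
  have hφ'c : ContinuousOn φ' (Set.Icc a b) :=
    fun x hx => (h2 x hx).continuousAt.continuousWithinAt
  have huI : Set.uIcc a b = Set.Icc a b := Set.uIcc_of_le hab
  have hdu : ∀ x ∈ Set.Icc a b,
      HasDerivAt (fun x => -Complex.I * (((φ' x)⁻¹ : ℝ) : ℂ))
        (-Complex.I * ((-φ'' x / φ' x ^ 2 : ℝ) : ℂ)) x := fun x hx =>
    (((h2 x hx).inv (hne x hx)).ofReal_comp).const_mul _
  have hdv : ∀ x ∈ Set.Icc a b,
      HasDerivAt (fun x => Complex.exp (Complex.I * φ x))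
        (Complex.exp (Complex.I * φ x) * (Complex.I * φ' x)) x := fun x hx =>
    (((h1 x hx).ofReal_comp).const_mul Complex.I).cexp
  have hcq : ContinuousOn (fun x => -φ'' x / φ' x ^ 2) (Set.Icc a b) :=
    hc.neg.div (hφ'c.pow 2) (fun x hx => pow_ne_zero 2 (hne x hx))
  have hparts := intervalIntegral.integral_mul_deriv_eq_deriv_mul
    (u := fun x => -Complex.I * (((φ' x)⁻¹ : ℝ) : ℂ))
    (v := fun x => Complex.exp (Complex.I * φ x)) (a := a) (b := b)
    (u' := fun x => -Complex.I * ((-φ'' x / φ' x ^ 2 : ℝ) : ℂ))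
    (v' := fun x => Complex.exp (Complex.I * φ x) * (Complex.I * φ' x))
    (fun x hx => hdu x (huI ▸ hx)) (fun x hx => hdv x (huI ▸ hx))
    (by
      apply ContinuousOn.intervalIntegrable
      rw [huI]
      exact continuousOn_const.mul (Complex.continuous_ofReal.comp_continuousOn hcq))
    (by
      apply ContinuousOn.intervalIntegrable
      rw [huI]
      have e1 : ContinuousOn (fun x => (φ x : ℂ)) (Set.Icc a b) :=
        Complex.continuous_ofReal.comp_continuousOn hφc
      have e2 : ContinuousOn (fun x => (φ' x : ℂ)) (Set.Icc a b) :=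
        Complex.continuous_ofReal.comp_continuousOn hφ'c
      fun_prop)
  have hL : ∫ x in a..b, Complex.exp (Complex.I * φ x)
      = ∫ x in a..b, (-Complex.I * (((φ' x)⁻¹ : ℝ) : ℂ)) *
        (Complex.exp (Complex.I * φ x) * (Complex.I * φ' x)) := by
    apply intervalIntegral.integral_congr
    intro x hx
    rw [huI] at hx
    have : (φ' x : ℂ) ≠ 0 := by exact_mod_cast hne x hx
    simp only [Complex.ofReal_inv]
    field_simp
    simp
  have hnexp : ∀ y : ℝ, ‖Complex.exp (Complex.I * y)‖ = 1 := fun y => by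
    rw [mul_comm]; exact Complex.norm_exp_ofReal_mul_I y
  have hinv : ∀ x ∈ Set.Icc a b, |(φ' x)⁻¹| ≤ 1 / l := fun x hx => by
    rw [abs_inv, ← one_div]; exact one_div_le_one_div_of_le hl (hlow x hx)
  have hi : ‖∫ x in a..b, (-Complex.I * ((-φ'' x / φ' x ^ 2 : ℝ) : ℂ)) *
      Complex.exp (Complex.I * φ x)‖ ≤ 2 / l := by
    calc _ ≤ ∫ x in a..b, φ'' x / φ' x ^ 2 := by
          apply intervalIntegral.norm_integral_le_of_norm_le hab
          · refine Filter.Eventually.of_forall fun x hx => ?_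
            have hx' : x ∈ Set.Icc a b := Set.Ioc_subset_Icc_self hx
            rw [norm_mul, norm_mul, hnexp, mul_one, norm_neg, Complex.norm_I, one_mul,
              Complex.norm_real, Real.norm_eq_abs, abs_div, abs_neg, abs_of_nonneg (hs x hx'),
              abs_of_nonneg (sq_nonneg _)]
          · apply ContinuousOn.intervalIntegrable
            rw [huI]
            exact hc.div (hφ'c.pow 2) (fun x hx => pow_ne_zero 2 (hne x hx))
      _ = -(φ' b)⁻¹ - -(φ' a)⁻¹ := by
          apply intervalIntegral.integral_eq_sub_of_hasDerivAt (f := fun x => -(φ' x)⁻¹)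
          · intro x hx
            rw [huI] at hx
            convert! ((h2 x hx).inv (hne x hx)).neg using 1
            ring
          · apply ContinuousOn.intervalIntegrable
            rw [huI]
            exact hc.div (hφ'c.pow 2) (fun x hx => pow_ne_zero 2 (hne x hx))
      _ ≤ 2 / l := by
          have A := abs_le.1 (hinv a (Set.left_mem_Icc.2 hab))
          have B := abs_le.1 (hinv b (Set.right_mem_Icc.2 hab))
          have : 2 / l = 1 / l + 1 / l := by ring
          linarith [A.1, A.2, B.1, B.2]
  have hbd : ∀ x ∈ Set.Icc a b, ‖(-Complex.I * (((φ' x)⁻¹ : ℝ) : ℂ)) *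
      Complex.exp (Complex.I * φ x)‖ ≤ 1 / l := fun x hx => by
    rw [norm_mul, norm_mul, hnexp, mul_one, norm_neg, Complex.norm_I, one_mul,
      Complex.norm_real, Real.norm_eq_abs]
    exact hinv x hx
  rw [hL, hparts]
  calc _ ≤ 1 / l + 1 / l + 2 / l :=
        (norm_sub_le _ _).trans (add_le_add ((norm_sub_le _ _).trans (add_le_add
          (hbd b (Set.right_mem_Icc.2 hab)) (hbd a (Set.left_mem_Icc.2 hab)))) hi)
    _ = 4 / l := by ring

lemma norm_integral_exp_neg (φ : ℝ → ℝ) (a b : ℝ) :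
    ‖∫ x in a..b, Complex.exp (Complex.I * ((-φ x : ℝ) : ℂ))‖ =
      ‖∫ x in a..b, Complex.exp (Complex.I * φ x)‖ := by
  have : (∫ x in a..b, Complex.exp (Complex.I * ((-φ x : ℝ) : ℂ))) =
      (starRingEnd ℂ) (∫ x in a..b, Complex.exp (Complex.I * φ x)) := by
    simp only [intervalIntegral, map_sub]
    rw [← integral_conj, ← integral_conj]
    simp [← Complex.exp_conj]
  rw [this, RCLike.norm_conj]

/-- The first derivative test of van der Corput, concave phases. -/
lemma norm_integral_exp_le_of_le_abs_deriv_of_nonpos {φ φ' φ'' : ℝ → ℝ} {a b l : ℝ} (hab : a ≤ b)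
    (hl : 0 < l) (h1 : ∀ x ∈ Set.Icc a b, HasDerivAt φ (φ' x) x)
    (h2 : ∀ x ∈ Set.Icc a b, HasDerivAt φ' (φ'' x) x) (hc : ContinuousOn φ'' (Set.Icc a b))
    (hs : ∀ x ∈ Set.Icc a b, φ'' x ≤ 0) (hlow : ∀ x ∈ Set.Icc a b, l ≤ |φ' x|) :
    ‖∫ x in a..b, Complex.exp (Complex.I * φ x)‖ ≤ 4 / l := by
  rw [← norm_integral_exp_neg]
  exact norm_integral_exp_le_of_le_abs_deriv_of_nonneg (φ := fun x => -φ x)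
    (φ' := fun x => -φ' x) (φ'' := fun x => -φ'' x) hab hl
    (fun x hx => (h1 x hx).neg) (fun x hx => (h2 x hx).neg) hc.neg
    (fun x hx => by linarith [hs x hx]) (fun x hx => by simpa using hlow x hx)

lemma norm_integral_exp_le_length (φ : ℝ → ℝ) {a b : ℝ} (hab : a ≤ b) :
    ‖∫ x in a..b, Complex.exp (Complex.I * φ x)‖ ≤ b - a := by
  have := intervalIntegral.norm_integral_le_of_norm_le_const (a := a) (b := b) (C := 1)
    (f := fun x => Complex.exp (Complex.I * φ x)) (fun x _ => by
      rw [mul_comm]; exact (Complex.norm_exp_ofReal_mul_I _).le)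
  rwa [one_mul, abs_of_nonneg (by linarith)] at this

/-- The second derivative test of van der Corput, convex phases. -/
lemma norm_integral_exp_le_of_le_deriv2 {φ φ' φ'' : ℝ → ℝ} {a b l : ℝ} (hab : a ≤ b)
    (hl : 0 < l) (h1 : ∀ x ∈ Set.Icc a b, HasDerivAt φ (φ' x) x)
    (h2 : ∀ x ∈ Set.Icc a b, HasDerivAt φ' (φ'' x) x) (hc : ContinuousOn φ'' (Set.Icc a b))
    (hlow : ∀ x ∈ Set.Icc a b, l ≤ φ'' x) :
    ‖∫ x in a..b, Complex.exp (Complex.I * φ x)‖ ≤ 10 / √l := by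
  have hφc : ContinuousOn φ (Set.Icc a b) := fun x hx => (h1 x hx).continuousAt.continuousWithinAt
  have hφ'c : ContinuousOn φ' (Set.Icc a b) :=
    fun x hx => (h2 x hx).continuousAt.continuousWithinAt
  have hmono : ∀ x ∈ Set.Icc a b, ∀ y ∈ Set.Icc a b, x ≤ y → l * (y - x) ≤ φ' y - φ' x := by
    intro x hx y hy hxy
    refine (convex_Icc a b).mul_sub_le_image_sub_of_le_deriv hφ'c ?_ ?_ x hx y hy hxy
    · intro z hz
      exact (h2 z (interior_subset hz)).differentiableAt.differentiableWithinAt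
    · intro z hz
      rw [(h2 z (interior_subset hz)).deriv]
      exact hlow z (interior_subset hz)
  have ha := Set.left_mem_Icc.2 hab
  have hb := Set.right_mem_Icc.2 hab
  obtain ⟨c, hcm, hcr, hcl⟩ : ∃ c ∈ Set.Icc a b, (∀ x ∈ Set.Icc a b, c < x → l * (x - c) ≤ φ' x) ∧
      (∀ x ∈ Set.Icc a b, x < c → φ' x ≤ - (l * (c - x))) := by
    rcases le_total 0 (φ' a) with h | h
    · exact ⟨a, ha, fun x hx hax => by linarith [hmono a ha x hx hax.le],
        fun x hx hxa => absurd hx.1 (not_le.2 hxa)⟩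
    rcases le_total (φ' b) 0 with h' | h'
    · exact ⟨b, hb, fun x hx hxb => absurd hx.2 (not_le.2 hxb),
        fun x hx hxb => by linarith [hmono x hx b hb hxb.le]⟩
    obtain ⟨c, hc, hc0⟩ := intermediate_value_Icc hab hφ'c ⟨h, h'⟩
    exact ⟨c, hc, fun x hx hcx => by linarith [hmono c hc x hx hcx.le],
      fun x hx hcx => by linarith [hmono x hx c hc hcx.le]⟩
  set δ := 1 / √l with hδ
  have hsl : 0 < √l := Real.sqrt_pos.2 hl
  have hδ0 : 0 < δ := by positivity
  have hlδ : l * δ = √l := by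
    rw [hδ]; field_simp; exact (Real.sq_sqrt hl.le).symm
  set c1 := max a (c - δ)
  set c2 := min b (c + δ)
  have hac1 : a ≤ c1 := le_max_left _ _
  have hc1c : c1 ≤ c := max_le hcm.1 (by linarith)
  have hcc2 : c ≤ c2 := le_min hcm.2 (by linarith)
  have hc2b : c2 ≤ b := min_le_left _ _
  have hcexp : ContinuousOn (fun x => Complex.exp (Complex.I * φ x)) (Set.Icc a b) := by
    have e1 : ContinuousOn (fun x => (φ x : ℂ)) (Set.Icc a b) :=
      Complex.continuous_ofReal.comp_continuousOn hφc
    fun_prop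
  have hii : ∀ u v, a ≤ u → u ≤ v → v ≤ b →
      IntervalIntegrable (fun x => Complex.exp (Complex.I * φ x)) volume u v := fun u v h h' h'' =>
    (hcexp.mono (by rw [Set.uIcc_of_le h']; exact Set.Icc_subset_Icc h h'')).intervalIntegrable
  have hsub : ∀ u v, a ≤ u → v ≤ b → ∀ x ∈ Set.Icc u v, x ∈ Set.Icc a b := fun u v h h' x hx =>
    ⟨h.trans hx.1, hx.2.trans h'⟩
  have I1 : ‖∫ x in a..c1, Complex.exp (Complex.I * φ x)‖ ≤ 4 / √l := by
    rcases le_total (c - δ) a with h | h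
    · have : c1 = a := max_eq_left h
      rw [this, intervalIntegral.integral_same, norm_zero]; positivity
    · have hc1 : c1 = c - δ := max_eq_right h
      have hS := hsub a c1 le_rfl (hc1c.trans hcm.2)
      refine norm_integral_exp_le_of_le_abs_deriv_of_nonneg hac1 hsl (fun x hx => h1 x (hS x hx))
        (fun x hx => h2 x (hS x hx)) (hc.mono hS) (fun x hx => hl.le.trans (hlow x (hS x hx)))
        (fun x hx => ?_)
      have := hcl x (hS x hx) (by linarith [hx.2])
      have h3 : l * δ ≤ l * (c - x) := by
        apply mul_le_mul_of_nonneg_left _ hl.le; linarith [hx.2]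
      rw [← hlδ]
      exact le_trans (by linarith) (neg_le_abs (φ' x))
  have I3 : ‖∫ x in c2..b, Complex.exp (Complex.I * φ x)‖ ≤ 4 / √l := by
    rcases le_total b (c + δ) with h | h
    · have : c2 = b := min_eq_left h
      rw [this, intervalIntegral.integral_same, norm_zero]; positivity
    · have hc2 : c2 = c + δ := min_eq_right h
      have hS := hsub c2 b (hcm.1.trans hcc2) le_rfl
      refine norm_integral_exp_le_of_le_abs_deriv_of_nonneg hc2b hsl (fun x hx => h1 x (hS x hx))
        (fun x hx => h2 x (hS x hx)) (hc.mono hS) (fun x hx => hl.le.trans (hlow x (hS x hx)))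
        (fun x hx => ?_)
      have := hcr x (hS x hx) (by linarith [hx.1])
      have h3 : l * δ ≤ l * (x - c) := by
        apply mul_le_mul_of_nonneg_left _ hl.le; linarith [hx.1]
      rw [← hlδ]
      exact le_trans (by linarith) (le_abs_self (φ' x))
  have I2 : ‖∫ x in c1..c2, Complex.exp (Complex.I * φ x)‖ ≤ 2 / √l := by
    refine (norm_integral_exp_le_length φ (hc1c.trans hcc2)).trans ?_
    have h1 : c2 ≤ c + δ := min_le_right _ _
    have h2 : c - δ ≤ c1 := le_max_right _ _
    have : 2 / √l = 2 * δ := by rw [hδ]; ring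
    linarith
  rw [← intervalIntegral.integral_add_adjacent_intervals
      (hii a c1 le_rfl hac1 (hc1c.trans hcm.2)) (hii c1 b hac1 (hc1c.trans hcm.2) le_rfl),
    ← intervalIntegral.integral_add_adjacent_intervals
      (hii c1 c2 hac1 (hc1c.trans hcc2) hc2b) (hii c2 b (hcm.1.trans hcc2) hc2b le_rfl)]
  calc _ ≤ 4 / √l + (2 / √l + 4 / √l) := (norm_add_le _ _).trans (add_le_add I1
        ((norm_add_le _ _).trans (add_le_add I2 I3)))
    _ = 10 / √l := by ring

/-- The second derivative test of van der Corput, concave phases. -/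
lemma norm_integral_exp_le_of_deriv2_le {φ φ' φ'' : ℝ → ℝ} {a b l : ℝ} (hab : a ≤ b)
    (hl : 0 < l) (h1 : ∀ x ∈ Set.Icc a b, HasDerivAt φ (φ' x) x)
    (h2 : ∀ x ∈ Set.Icc a b, HasDerivAt φ' (φ'' x) x) (hc : ContinuousOn φ'' (Set.Icc a b))
    (hlow : ∀ x ∈ Set.Icc a b, φ'' x ≤ -l) :
    ‖∫ x in a..b, Complex.exp (Complex.I * φ x)‖ ≤ 10 / √l := by
  rw [← norm_integral_exp_neg]
  exact norm_integral_exp_le_of_le_deriv2 (φ := fun x => -φ x)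
    (φ' := fun x => -φ' x) (φ'' := fun x => -φ'' x) hab hl
    (fun x hx => (h1 x hx).neg) (fun x hx => (h2 x hx).neg) hc.neg
    (fun x hx => by linarith [hlow x hx])

/-- The Bessel-type integral `∫₀^{2π} exp(i(nθ - z cos θ)) dθ`. -/
def besselInt (n z : ℝ) : ℂ :=
  ∫ θ in (0:ℝ)..(2 * π), Complex.exp (Complex.I * ((n * θ - z * Real.cos θ : ℝ) : ℂ))

lemma hasDerivAt_besselPhase (n z θ : ℝ) :
    HasDerivAt (fun θ => n * θ - z * Real.cos θ) (n + z * Real.sin θ) θ := by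
  have := ((hasDerivAt_id θ).const_mul n).sub ((Real.hasDerivAt_cos θ).const_mul z)
  convert! this using 1
  simp

lemma hasDerivAt_besselPhase_deriv (n z θ : ℝ) :
    HasDerivAt (fun θ => n + z * Real.sin θ) (z * Real.cos θ) θ :=
  ((Real.hasDerivAt_sin θ).const_mul z).const_add n

lemma norm_besselInt_le (n z : ℝ) : ‖besselInt n z‖ ≤ 2 * π := by
  have := norm_integral_exp_le_length (fun θ => n * θ - z * Real.cos θ)
    (a := 0) (b := 2 * π) (by positivity)
  simpa [besselInt] using this

lemma norm_besselInt_neg (n z : ℝ) : ‖besselInt (-n) (-z)‖ = ‖besselInt n z‖ := by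
  unfold besselInt
  rw [← norm_integral_exp_neg (fun θ => n * θ - z * Real.cos θ)]
  congr 1
  apply intervalIntegral.integral_congr
  intro θ _
  simp only
  congr 3
  ring

lemma half_le_sin {δ : ℝ} (h0 : 0 ≤ δ) (h1 : δ ≤ 1) : δ / 2 ≤ Real.sin δ := by
  have h3 := Real.pi_gt_three
  have := Real.mul_le_sin h0 (by linarith)
  have h4 := Real.pi_lt_four
  have : δ / 2 ≤ 2 / π * δ := by
    rw [div_mul_eq_mul_div, div_le_div_iff₀ (by norm_num) (by positivity)]
    nlinarith
  linarith

lemma norm_besselInt_le_add {n z δ R₁ R₂ : ℝ} (hz : 0 < z) (h0 : 0 < δ) (h1 : δ ≤ 1)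
    (hR₁ : ‖∫ θ in (π/2 - δ)..(π/2 + δ),
      Complex.exp (Complex.I * ((n * θ - z * Real.cos θ : ℝ) : ℂ))‖ ≤ R₁)
    (hR₂ : ‖∫ θ in (3*π/2 - δ)..(3*π/2 + δ),
      Complex.exp (Complex.I * ((n * θ - z * Real.cos θ : ℝ) : ℂ))‖ ≤ R₂) :
    ‖besselInt n z‖ ≤ 30 / √(z * (δ / 2)) + R₁ + R₂ := by
  have hpi := Real.pi_gt_three
  have hl : 0 < z * (δ / 2) := by positivity
  have hs := half_le_sin h0.le h1
  have hii : ∀ u v, IntervalIntegrable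
      (fun θ => Complex.exp (Complex.I * ((n * θ - z * Real.cos θ : ℝ) : ℂ))) volume u v :=
    fun u v => Continuous.intervalIntegrable (by fun_prop) _ _
  have hcos : ∀ S : Set ℝ, ContinuousOn (fun θ => z * Real.cos θ) S :=
    fun S => Continuous.continuousOn (by fun_prop)
  have J1 := norm_integral_exp_le_of_le_deriv2 (a := 0) (b := π/2 - δ) (by linarith) hl
    (fun x _ => hasDerivAt_besselPhase n z x) (fun x _ => hasDerivAt_besselPhase_deriv n z x)
    (hcos _) (fun x hx => by
      apply mul_le_mul_of_nonneg_left _ hz.le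
      refine hs.trans ?_
      rw [← Real.cos_pi_div_two_sub]
      exact Real.cos_le_cos_of_nonneg_of_le_pi hx.1 (by linarith) hx.2)
  have J2 := norm_integral_exp_le_of_deriv2_le (a := π/2 + δ) (b := 3*π/2 - δ) (by linarith) hl
    (fun x _ => hasDerivAt_besselPhase n z x) (fun x _ => hasDerivAt_besselPhase_deriv n z x)
    (hcos _) (fun x hx => by
      rw [← mul_neg]
      apply mul_le_mul_of_nonneg_left _ hz.le
      rw [le_neg]
      refine hs.trans ?_
      rw [← Real.cos_pi_div_two_sub, ← Real.cos_sub_pi, ← Real.cos_abs (x - π)]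
      apply Real.cos_le_cos_of_nonneg_of_le_pi (abs_nonneg _) (by linarith)
      rw [abs_le]
      constructor <;> linarith [hx.1, hx.2])
  have J3 := norm_integral_exp_le_of_le_deriv2 (a := 3*π/2 + δ) (b := 2 * π) (by linarith) hl
    (fun x _ => hasDerivAt_besselPhase n z x) (fun x _ => hasDerivAt_besselPhase_deriv n z x)
    (hcos _) (fun x hx => by
      apply mul_le_mul_of_nonneg_left _ hz.le
      refine hs.trans ?_
      rw [← Real.cos_pi_div_two_sub, ← Real.cos_two_pi_sub x]
      exact Real.cos_le_cos_of_nonneg_of_le_pi (by linarith [hx.2]) (by linarith)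
        (by linarith [hx.1]))
  unfold besselInt
  rw [← intervalIntegral.integral_add_adjacent_intervals (hii 0 (π/2 - δ)) (hii _ _),
    ← intervalIntegral.integral_add_adjacent_intervals (hii (π/2 - δ) (π/2 + δ)) (hii _ _),
    ← intervalIntegral.integral_add_adjacent_intervals (hii (π/2 + δ) (3*π/2 - δ)) (hii _ _),
    ← intervalIntegral.integral_add_adjacent_intervals (hii (3*π/2 - δ) (3*π/2 + δ)) (hii _ _)]
  have e : 30 / √(z * (δ / 2)) = 10 / √(z * (δ / 2)) + 10 / √(z * (δ / 2))
    + 10 / √(z * (δ / 2)) := by ring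
  rw [e]
  refine (norm_add_le _ _).trans ?_
  refine (add_le_add J1 ((norm_add_le _ _).trans (add_le_add hR₁ ((norm_add_le _ _).trans
    (add_le_add J2 ((norm_add_le _ _).trans (add_le_add hR₂ J3))))))).trans ?_
  linarith

lemma norm_besselInt_pow_three_le {n z : ℝ} (hz : 1 ≤ |z|) :
    ‖besselInt n z‖ ^ 3 ≤ 50 ^ 3 / |z| := by
  wlog hz0 : 0 ≤ z generalizing n z
  · rw [← norm_besselInt_neg, ← abs_neg]
    exact this (by rwa [abs_neg]) (by linarith)
  rw [abs_of_nonneg hz0] at hz ⊢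
  set c := z ^ (1/3 : ℝ) with hc
  have hc1 : 1 ≤ c := Real.one_le_rpow hz (by norm_num)
  have hc3 : c ^ 3 = z := by
    rw [hc, ← Real.rpow_natCast, ← Real.rpow_mul hz0]; norm_num
  have hc0 : 0 < c := by linarith
  have key := norm_besselInt_le_add (n := n) (z := z) (δ := 1 / c) (by linarith) (by positivity)
    (by rw [div_le_one hc0]; exact hc1)
    (norm_integral_exp_le_length (fun θ => n * θ - z * Real.cos θ)
      (by have : 0 < 1 / c := by positivity
          linarith))
    (norm_integral_exp_le_length (fun θ => n * θ - z * Real.cos θ)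
      (by have : 0 < 1 / c := by positivity
          linarith))
  have h2 : 30 / √(z * (1 / c / 2)) ≤ 45 / c := by
    have : z * (1 / c / 2) = c ^ 2 / 2 := by rw [← hc3]; field_simp
    rw [this, Real.sqrt_div (by positivity), Real.sqrt_sq hc0.le, div_div_eq_mul_div]
    apply div_le_div_of_nonneg_right _ hc0.le
    have : √2 ≤ 1.5 := by rw [Real.sqrt_le_left (by norm_num)]; norm_num
    linarith
  have h3 : ‖besselInt n z‖ ≤ 50 / c := by
    have : 50 / c = 45 / c + 4 * (1 / c) + 1 / c := by ring
    have : 0 < 1 / c := by positivity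
    linarith
  calc _ ≤ (50 / c) ^ 3 := pow_le_pow_left₀ (norm_nonneg _) h3 3
    _ = _ := by rw [div_pow, hc3]

lemma norm_integral_besselPhase_near_le {n z δ d θ₀ : ℝ} (hz : 0 < z) (h0 : 0 < δ) (h1 : δ ≤ 1)
    (hd : 0 < d) (hδ : z * δ ^ 2 ≤ d)
    (hθ : θ₀ = π / 2 ∧ d ≤ |n + z| ∨ θ₀ = 3 * π / 2 ∧ d ≤ |n - z|) :
    ‖∫ θ in (θ₀ - δ)..(θ₀ + δ),
      Complex.exp (Complex.I * ((n * θ - z * Real.cos θ : ℝ) : ℂ))‖ ≤ 16 / d := by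
  have hpi := Real.pi_gt_three
  have hii : ∀ u v, IntervalIntegrable
      (fun θ => Complex.exp (Complex.I * ((n * θ - z * Real.cos θ : ℝ) : ℂ))) volume u v :=
    fun u v => Continuous.intervalIntegrable (by fun_prop) _ _
  have hcos : ∀ S : Set ℝ, ContinuousOn (fun θ => z * Real.cos θ) S :=
    fun S => Continuous.continuousOn (by fun_prop)
  have hlow : ∀ x ∈ Set.Icc (θ₀ - δ) (θ₀ + δ), d / 2 ≤ |n + z * Real.sin x| := by
    intro x hx
    have hx2 : (x - θ₀) ^ 2 ≤ δ ^ 2 := sq_le_sq' (by linarith [hx.1]) (by linarith [hx.2])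
    have hc1 := Real.one_sub_sq_div_two_le_cos (x := x - θ₀)
    have hc2 : z * (1 - Real.cos (x - θ₀)) ≤ d / 2 := by nlinarith
    have hc3 : 0 ≤ z * (1 - Real.cos (x - θ₀)) :=
      mul_nonneg hz.le (by linarith [Real.cos_le_one (x - θ₀)])
    rcases hθ with ⟨rfl, h⟩ | ⟨rfl, h⟩
    · have e : n + z * Real.sin x = (n + z) - z * (1 - Real.cos (x - π / 2)) := by
        rw [Real.cos_sub_pi_div_two]; ring
      rw [e]
      have := abs_sub_abs_le_abs_sub (n + z) (z * (1 - Real.cos (x - π / 2)))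
      rw [abs_of_nonneg hc3] at this
      linarith
    · have e1 : Real.cos (x - 3 * π / 2) = - Real.sin x := by
        rw [show x - 3 * π / 2 = x + π / 2 - 2 * π by ring, Real.cos_sub_two_pi,
          Real.cos_add_pi_div_two]
      have e : n + z * Real.sin x = (n - z) + z * (1 - Real.cos (x - 3 * π / 2)) := by
        rw [e1]; ring
      rw [e]
      have := abs_sub_abs_le_abs_add (n - z) (z * (1 - Real.cos (x - 3 * π / 2)))
      rw [abs_of_nonneg hc3] at this
      linarith
  have L : ‖∫ θ in (θ₀ - δ)..θ₀,
      Complex.exp (Complex.I * ((n * θ - z * Real.cos θ : ℝ) : ℂ))‖ ≤ 4 / (d / 2) := by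
    rcases hθ with ⟨rfl, h⟩ | ⟨rfl, h⟩
    · exact norm_integral_exp_le_of_le_abs_deriv_of_nonneg (by linarith) (by positivity)
        (fun x _ => hasDerivAt_besselPhase n z x) (fun x _ => hasDerivAt_besselPhase_deriv n z x)
        (hcos _) (fun x hx => mul_nonneg hz.le
          (Real.cos_nonneg_of_neg_pi_div_two_le_of_le (by linarith [hx.1]) hx.2))
        (fun x hx => hlow x ⟨hx.1, by linarith [hx.2]⟩)
    · exact norm_integral_exp_le_of_le_abs_deriv_of_nonpos (by linarith) (by positivity)
        (fun x _ => hasDerivAt_besselPhase n z x) (fun x _ => hasDerivAt_besselPhase_deriv n z x)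
        (hcos _) (fun x hx => mul_nonpos_of_nonneg_of_nonpos hz.le
          (Real.cos_nonpos_of_pi_div_two_le_of_le (by linarith [hx.1]) (by linarith [hx.2])))
        (fun x hx => hlow x ⟨hx.1, by linarith [hx.2]⟩)
  have U : ‖∫ θ in θ₀..(θ₀ + δ),
      Complex.exp (Complex.I * ((n * θ - z * Real.cos θ : ℝ) : ℂ))‖ ≤ 4 / (d / 2) := by
    rcases hθ with ⟨rfl, h⟩ | ⟨rfl, h⟩
    · exact norm_integral_exp_le_of_le_abs_deriv_of_nonpos (by linarith) (by positivity)
        (fun x _ => hasDerivAt_besselPhase n z x) (fun x _ => hasDerivAt_besselPhase_deriv n z x)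
        (hcos _) (fun x hx => mul_nonpos_of_nonneg_of_nonpos hz.le
          (Real.cos_nonpos_of_pi_div_two_le_of_le hx.1 (by linarith [hx.2])))
        (fun x hx => hlow x ⟨by linarith [hx.1], hx.2⟩)
    · exact norm_integral_exp_le_of_le_abs_deriv_of_nonneg (by linarith) (by positivity)
        (fun x _ => hasDerivAt_besselPhase n z x) (fun x _ => hasDerivAt_besselPhase_deriv n z x)
        (hcos _) (fun x hx => mul_nonneg hz.le (by
          rw [← Real.cos_two_pi_sub]
          exact Real.cos_nonneg_of_neg_pi_div_two_le_of_le (by linarith [hx.2])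
            (by linarith [hx.1])))
        (fun x hx => hlow x ⟨by linarith [hx.1], hx.2⟩)
  rw [← intervalIntegral.integral_add_adjacent_intervals (hii (θ₀ - δ) θ₀) (hii _ _)]
  calc _ ≤ 4 / (d / 2) + 4 / (d / 2) := (norm_add_le _ _).trans (add_le_add L U)
    _ = 16 / d := by ring

lemma exists_norm_besselInt_pow_four_le : ∃ C : ℝ, 0 < C ∧ ∀ n z : ℝ, 1 ≤ |z| →
    ‖besselInt n z‖ ^ 4 ≤ C / (|z| * (1 + min |(|n| - |z|)| |z|)) := by
  refine ⟨10 ^ 9, by norm_num, fun n z hz => ?_⟩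
  wlog hz0 : 0 ≤ z generalizing n z
  · have := this (-n) (-z) (by rwa [abs_neg]) (by linarith)
    rwa [norm_besselInt_neg, abs_neg, abs_neg] at this
  rw [abs_of_nonneg hz0] at hz ⊢
  set d := min |(|n| - z)| z with hd
  have hdz : d ≤ z := min_le_right _ _
  have hd0 : 0 ≤ d := le_min (abs_nonneg _) hz0
  have hz' : 0 < z := by linarith
  rw [le_div_iff₀ (by positivity)]
  have b0 := norm_nonneg (besselInt n z)
  rcases lt_or_ge (d ^ 3) z with h | h
  · have b3 := norm_besselInt_pow_three_le (n := n) (z := z) (by rwa [abs_of_nonneg hz0])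
    rw [abs_of_nonneg hz0] at b3
    set b := ‖besselInt n z‖
    rw [le_div_iff₀ hz'] at b3
    have h1 : (b * (1 + d)) ^ 3 ≤ 100 ^ 3 := by
      have h2 : (1 + d) ^ 3 ≤ 8 * z := by
        rcases le_total d 1 with h3 | h3
        · have : (1 + d) ^ 3 ≤ 2 ^ 3 := pow_le_pow_left₀ (by linarith) (by linarith) 3
          linarith
        · have : (1 + d) ^ 3 ≤ (2 * d) ^ 3 := pow_le_pow_left₀ (by linarith) (by linarith) 3
          have e : (2 * d) ^ 3 = 8 * d ^ 3 := by ring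
          linarith
      calc (b * (1 + d)) ^ 3 = b ^ 3 * (1 + d) ^ 3 := by ring
        _ ≤ b ^ 3 * (8 * z) := by gcongr
        _ = 8 * (b ^ 3 * z) := by ring
        _ ≤ 8 * 50 ^ 3 := by linarith
        _ = 100 ^ 3 := by norm_num
    have h4 : b * (1 + d) ≤ 100 := le_of_pow_le_pow_left₀ (by norm_num) (by norm_num) h1
    calc b ^ 4 * (z * (1 + d)) = (b ^ 3 * z) * (b * (1 + d)) := by ring
      _ ≤ 50 ^ 3 * 100 := mul_le_mul b3 h4 (by positivity) (by norm_num)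
      _ ≤ 10 ^ 9 := by norm_num
  · have hd1 : 1 ≤ d := by
      by_contra hlt
      push Not at hlt
      have : d ^ 3 < 1 := pow_lt_one₀ hd0 hlt (by norm_num)
      linarith
    have hd' : 0 < d := by linarith
    set δ := √(d / z) with hδ
    have hδ0 : 0 < δ := Real.sqrt_pos.2 (by positivity)
    have hδ1 : δ ≤ 1 := by
      exact Real.sqrt_le_iff.2 ⟨zero_le_one, by rw [one_pow, div_le_one hz']; exact hdz⟩
    have hδ2 : δ ^ 2 = d / z := Real.sq_sqrt (by positivity)
    have hzδ : z * δ ^ 2 ≤ d := by rw [hδ2]; field_simp; exact le_rfl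
    have hdn : d ≤ |(|n| - z)| := min_le_left _ _
    have hp : d ≤ |n + z| := hdn.trans (by
      have := abs_abs_sub_abs_le_abs_sub n (-z)
      rwa [abs_neg, abs_of_nonneg hz0, sub_neg_eq_add] at this)
    have hm : d ≤ |n - z| := hdn.trans (by
      have := abs_abs_sub_abs_le_abs_sub n z
      rwa [abs_of_nonneg hz0] at this)
    have key := norm_besselInt_le_add hz' hδ0 hδ1
      (norm_integral_besselPhase_near_le hz' hδ0 hδ1 hd' hzδ (Or.inl ⟨rfl, hp⟩))
      (norm_integral_besselPhase_near_le hz' hδ0 hδ1 hd' hzδ (Or.inr ⟨rfl, hm⟩))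
    set A := 30 / √(z * (δ / 2))
    set B := 32 / d
    have hA : A ^ 4 * (z * d) = 30 ^ 4 * 4 := by
      have hs : √(z * (δ / 2)) ^ 4 = z * d / 4 := by
        rw [show √(z * (δ / 2)) ^ 4 = (√(z * (δ / 2)) ^ 2) ^ 2 by ring,
          Real.sq_sqrt (by positivity)]
        calc (z * (δ / 2)) ^ 2 = z ^ 2 * δ ^ 2 / 4 := by ring
          _ = z * d / 4 := by rw [hδ2]; field_simp
      rw [div_pow, hs]; field_simp
    have hB : B ^ 4 * (z * d) ≤ 32 ^ 4 := by
      calc B ^ 4 * (z * d) ≤ B ^ 4 * (d ^ 3 * d) := by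
            have : 0 ≤ B ^ 4 := by positivity
            gcongr
        _ = 32 ^ 4 := by simp only [B]; field_simp
    have hA0 : 0 ≤ A := by positivity
    have hB0 : 0 ≤ B := by positivity
    have hb : ‖besselInt n z‖ ≤ A + B := by
      refine key.trans (le_of_eq ?_)
      simp only [B]; ring
    have h4 : (A + B) ^ 4 ≤ 8 * (A ^ 4 + B ^ 4) := by
      have := add_pow_le hA0 hB0 4
      norm_num at this
      exact this
    calc ‖besselInt n z‖ ^ 4 * (z * (1 + d)) ≤ (8 * (A ^ 4 + B ^ 4)) * (z * (2 * d)) := by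
          apply mul_le_mul ((pow_le_pow_left₀ b0 hb 4).trans h4) _ (by positivity) (by positivity)
          gcongr; linarith
      _ = 16 * (A ^ 4 * (z * d) + B ^ 4 * (z * d)) := by ring
      _ ≤ 10 ^ 9 := by rw [hA]; linarith

lemma continuousOn_exp_I_mul {φ : ℝ → ℝ} {s : Set ℝ} (h : ContinuousOn φ s) :
    ContinuousOn (fun x => Complex.exp (Complex.I * (φ x : ℂ))) s := by
  refine Complex.continuous_exp.comp_continuousOn (continuousOn_const.mul ?_)
  exact Complex.continuous_ofReal.comp_continuousOn h

lemma norm_exp_I_mul_ofReal (x : ℝ) : ‖Complex.exp (Complex.I * (x : ℂ))‖ = 1 := by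
  rw [mul_comm]; exact Complex.norm_exp_ofReal_mul_I x

/-- Integration by parts against an oscillating exponential. -/
lemma norm_integral_mul_deriv_mul_exp {φ φ' b b' : ℝ → ℝ} {α β : ℝ} (hab : α ≤ β)
    (h1 : ∀ x ∈ Set.Icc α β, HasDerivAt φ (φ' x) x) (hφ' : ContinuousOn φ' (Set.Icc α β))
    (hb : ∀ x ∈ Set.Icc α β, HasDerivAt b (b' x) x) (hb' : ContinuousOn b' (Set.Icc α β))
    (hα : b α = 0) (hβ : b β = 0) :
    ‖∫ x in α..β, ((b x * φ' x : ℝ) : ℂ) * Complex.exp (Complex.I * φ x)‖ =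
      ‖∫ x in α..β, (b' x : ℂ) * Complex.exp (Complex.I * φ x)‖ := by
  have hu : Set.uIcc α β = Set.Icc α β := Set.uIcc_of_le hab
  have hφ : ContinuousOn φ (Set.Icc α β) := fun x hx => (h1 x hx).continuousAt.continuousWithinAt
  have key := intervalIntegral.integral_mul_deriv_eq_deriv_mul (a := α) (b := β)
    (u := fun x => (b x : ℂ)) (v := fun x => Complex.exp (Complex.I * φ x))
    (u' := fun x => (b' x : ℂ))
    (v' := fun x => Complex.exp (Complex.I * φ x) * (Complex.I * (φ' x : ℂ)))
    (fun x hx => (hb x (hu ▸ hx)).ofReal_comp)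
    (fun x hx => ((h1 x (hu ▸ hx)).ofReal_comp.const_mul Complex.I).cexp)
    (by
      apply ContinuousOn.intervalIntegrable
      rw [hu]; exact Complex.continuous_ofReal.comp_continuousOn hb')
    (by
      apply ContinuousOn.intervalIntegrable
      rw [hu]
      exact (continuousOn_exp_I_mul hφ).mul
        (continuousOn_const.mul (Complex.continuous_ofReal.comp_continuousOn hφ')))
  simp only [hα, hβ, Complex.ofReal_zero, zero_mul, sub_zero, zero_sub] at key
  rw [← norm_neg (∫ x in α..β, (b' x : ℂ) * Complex.exp (Complex.I * φ x)), ← key,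
    ← one_mul ‖∫ x in α..β, ((b x * φ' x : ℝ) : ℂ) * Complex.exp (Complex.I * φ x)‖,
    ← Complex.norm_I, ← norm_mul, ← intervalIntegral.integral_const_mul]
  congr 2
  ext x
  push_cast
  ring

/-- Second derivative test with an amplitude vanishing at the right endpoint. -/
lemma norm_integral_mul_exp_le_of_deriv2_le {φ φ' φ'' a a' : ℝ → ℝ} {α β l A : ℝ} (hab : α ≤ β)
    (hl : 0 < l) (h1 : ∀ x ∈ Set.Icc α β, HasDerivAt φ (φ' x) x)
    (h2 : ∀ x ∈ Set.Icc α β, HasDerivAt φ' (φ'' x) x) (hc : ContinuousOn φ'' (Set.Icc α β))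
    (hlow : ∀ x ∈ Set.Icc α β, φ'' x ≤ -l)
    (ha : ∀ x ∈ Set.Icc α β, HasDerivAt a (a' x) x) (ha' : ContinuousOn a' (Set.Icc α β))
    (hA : ∀ x ∈ Set.Icc α β, |a' x| ≤ A) (hβ : a β = 0) :
    ‖∫ x in α..β, (a x : ℂ) * Complex.exp (Complex.I * φ x)‖ ≤ A * (10 / √l) * (β - α) := by
  have hu : Set.uIcc α β = Set.Icc α β := Set.uIcc_of_le hab
  have hφ : ContinuousOn φ (Set.Icc α β) := fun x hx => (h1 x hx).continuousAt.continuousWithinAt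
  have hec := continuousOn_exp_I_mul hφ
  set E : ℝ → ℂ := fun x => ∫ y in α..x, Complex.exp (Complex.I * φ y) with hE
  have hEb : ∀ x ∈ Set.Icc α β, ‖E x‖ ≤ 10 / √l := fun x hx => by
    have hs : Set.Icc α x ⊆ Set.Icc α β := Set.Icc_subset_Icc_right hx.2
    exact norm_integral_exp_le_of_deriv2_le hx.1 hl (fun y hy => h1 y (hs hy))
      (fun y hy => h2 y (hs hy)) (hc.mono hs) (fun y hy => hlow y (hs hy))
  have hii : IntervalIntegrable (fun y => Complex.exp (Complex.I * φ y)) volume α β := by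
    apply ContinuousOn.intervalIntegrable; rwa [hu]
  have hEd : ∀ x ∈ Set.uIcc α β, HasDerivWithinAt E (Complex.exp (Complex.I * φ x))
      (Set.uIcc α β) x := by
    intro x hx
    rw [hu] at hx ⊢
    have : Fact (x ∈ Set.Icc α β) := ⟨hx⟩
    refine intervalIntegral.integral_hasDerivWithinAt_right
      (hii.mono_set (by
        rw [hu, Set.uIcc_of_le hx.1]; exact Set.Icc_subset_Icc_right hx.2))
      (hec.stronglyMeasurableAtFilter_nhdsWithin measurableSet_Icc x) (hec x hx)
  have key := intervalIntegral.integral_mul_deriv_eq_deriv_mul_of_hasDerivWithinAt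
    (a := α) (b := β)
    (u := fun x => (a x : ℂ)) (u' := fun x => (a' x : ℂ))
    (fun x hx => (ha x (hu ▸ hx)).ofReal_comp.hasDerivWithinAt) hEd
    (by
      apply ContinuousOn.intervalIntegrable
      rw [hu]; exact Complex.continuous_ofReal.comp_continuousOn ha') hii
  have hE0 : E α = 0 := by simp [hE]
  rw [key, hβ, hE0]
  simp only [Complex.ofReal_zero, zero_mul, mul_zero, sub_zero, zero_sub, norm_neg]
  refine (intervalIntegral.norm_integral_le_of_norm_le_const (C := A * (10 / √l)) ?_).trans ?_
  · intro x hx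
    rw [Set.uIoc_of_le hab] at hx
    have hx' : x ∈ Set.Icc α β := ⟨hx.1.le, hx.2⟩
    rw [norm_mul, Complex.norm_real, Real.norm_eq_abs]
    exact mul_le_mul (hA x hx') (hEb x hx') (norm_nonneg _) ((abs_nonneg _).trans (hA x hx'))
  · rw [abs_of_nonneg (by linarith)]

/-- Two integrations by parts. -/
lemma norm_integral_mul_exp_le_of_le_abs_deriv {φ φ' φ'' φ''' a a' a'' : ℝ → ℝ}
    {α β t K L A : ℝ} (hab : α ≤ β) (ht : 0 < t) (hK : 0 < K) (hL : 0 ≤ L) (hA0 : 0 ≤ A)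
    (h1 : ∀ x ∈ Set.Icc α β, HasDerivAt φ (φ' x) x)
    (h2 : ∀ x ∈ Set.Icc α β, HasDerivAt φ' (φ'' x) x)
    (h3 : ∀ x ∈ Set.Icc α β, HasDerivAt φ'' (φ''' x) x)
    (hc : ContinuousOn φ''' (Set.Icc α β))
    (hlow : ∀ x ∈ Set.Icc α β, t / K ≤ |φ' x|)
    (hb2 : ∀ x ∈ Set.Icc α β, |φ'' x| ≤ L * t)
    (hb3 : ∀ x ∈ Set.Icc α β, |φ''' x| ≤ L * t)
    (ha1 : ∀ x ∈ Set.Icc α β, HasDerivAt a (a' x) x)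
    (ha2 : ∀ x ∈ Set.Icc α β, HasDerivAt a' (a'' x) x)
    (hac : ContinuousOn a'' (Set.Icc α β))
    (hA : ∀ x ∈ Set.Icc α β, |a x| ≤ A) (hA' : ∀ x ∈ Set.Icc α β, |a' x| ≤ A)
    (hA'' : ∀ x ∈ Set.Icc α β, |a'' x| ≤ A)
    (hα : a α = 0) (hβ : a β = 0) (hα' : a' α = 0) (hβ' : a' β = 0) :
    ‖∫ x in α..β, (a x : ℂ) * Complex.exp (Complex.I * φ x)‖ ≤
      A * K ^ 2 * (1 + 4 * K * L + 3 * K ^ 2 * L ^ 2) / t ^ 2 * (β - α) := by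
  have hne : ∀ x ∈ Set.Icc α β, φ' x ≠ 0 := fun x hx h => by
    have := hlow x hx; rw [h, abs_zero] at this
    have : 0 < t / K := by positivity
    linarith
  set B : ℝ → ℝ := fun x => (φ' x)⁻¹ with hB
  set B' : ℝ → ℝ := fun x => - φ'' x * B x ^ 2 with hB'
  set B'' : ℝ → ℝ := fun x => - φ''' x * B x ^ 2 - 2 * φ'' x * B x * B' x with hB''
  have hBd : ∀ x ∈ Set.Icc α β, HasDerivAt B (B' x) x := fun x hx => by
    convert! (h2 x hx).inv (hne x hx) using 1
    simp only [hB', hB]; field_simp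
  have hB'd : ∀ x ∈ Set.Icc α β, HasDerivAt B' (B'' x) x := fun x hx => by
    convert! (h3 x hx).neg.mul ((hBd x hx).pow 2) using 1
    simp only [hB'']; simp; ring
  set b : ℝ → ℝ := fun x => a x * B x with hbdef
  set b' : ℝ → ℝ := fun x => a' x * B x + a x * B' x with hb'def
  set b'' : ℝ → ℝ := fun x => a'' x * B x + a' x * B' x + (a' x * B' x + a x * B'' x) with hb''def
  have hbd : ∀ x ∈ Set.Icc α β, HasDerivAt b (b' x) x := fun x hx => (ha1 x hx).mul (hBd x hx)
  have hb'd : ∀ x ∈ Set.Icc α β, HasDerivAt b' (b'' x) x := fun x hx =>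
    ((ha2 x hx).mul (hBd x hx)).add ((ha1 x hx).mul (hB'd x hx))
  set e : ℝ → ℝ := fun x => b' x * B x with hedef
  set e' : ℝ → ℝ := fun x => b'' x * B x + b' x * B' x with he'def
  have hed : ∀ x ∈ Set.Icc α β, HasDerivAt e (e' x) x := fun x hx => (hb'd x hx).mul (hBd x hx)
  have cont : ∀ {f f' : ℝ → ℝ}, (∀ x ∈ Set.Icc α β, HasDerivAt f (f' x) x) →
      ContinuousOn f (Set.Icc α β) := fun h x hx => (h x hx).continuousAt.continuousWithinAt
  have c1 := cont h1
  have c2 := cont h2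
  have c3 := cont h3
  have c4 := cont ha1
  have c5 := cont ha2
  have c6 := cont hBd
  have c7 := cont hB'd
  have c8 : ContinuousOn B'' (Set.Icc α β) := by simp only [hB'']; fun_prop
  have c9 := cont hbd
  have c10 := cont hb'd
  have c11 : ContinuousOn b'' (Set.Icc α β) := by simp only [hb''def]; fun_prop
  have c12 : ContinuousOn e' (Set.Icc α β) := by simp only [he'def]; fun_prop
  have hu : Set.uIcc α β = Set.Icc α β := Set.uIcc_of_le hab
  have s1 : (∫ x in α..β, (a x : ℂ) * Complex.exp (Complex.I * φ x)) =
      ∫ x in α..β, ((b x * φ' x : ℝ) : ℂ) * Complex.exp (Complex.I * φ x) := by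
    apply intervalIntegral.integral_congr
    intro x hx
    rw [hu] at hx
    have : b x * φ' x = a x := by simp only [hbdef, hB]; field_simp [hne x hx]
    simp only [this]
  have s2 : (∫ x in α..β, (b' x : ℂ) * Complex.exp (Complex.I * φ x)) =
      ∫ x in α..β, ((e x * φ' x : ℝ) : ℂ) * Complex.exp (Complex.I * φ x) := by
    apply intervalIntegral.integral_congr
    intro x hx
    rw [hu] at hx
    have : e x * φ' x = b' x := by
      simp only [hedef]
      rw [mul_assoc, show B x * φ' x = 1 from inv_mul_cancel₀ (hne x hx), mul_one]
    simp only [this]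
  rw [s1, norm_integral_mul_deriv_mul_exp hab h1 c2 hbd c10 (by simp [hbdef, hα])
    (by simp [hbdef, hβ]), s2, norm_integral_mul_deriv_mul_exp hab h1 c2 hed c12
    (by simp [hedef, hb'def, hα, hα']) (by simp [hedef, hb'def, hβ, hβ'])]
  refine (intervalIntegral.norm_integral_le_of_norm_le_const
    (C := A * K ^ 2 * (1 + 4 * K * L + 3 * K ^ 2 * L ^ 2) / t ^ 2) ?_).trans ?_
  swap
  · rw [abs_of_nonneg (by linarith)]
  intro x hx
  rw [Set.uIoc_of_le hab] at hx
  have hx' : x ∈ Set.Icc α β := ⟨hx.1.le, hx.2⟩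
  rw [norm_mul, norm_exp_I_mul_ofReal, mul_one, Complex.norm_real, Real.norm_eq_abs]
  have q1 : |B x| ≤ K / t := by
    simp only [hB]
    rw [abs_inv]
    have h := hlow x hx'
    have h0 : 0 < t / K := by positivity
    rw [← inv_div t K]
    exact inv_anti₀ h0 h
  have q2 : |B' x| ≤ L * K ^ 2 / t := by
    simp only [hB']
    rw [abs_mul, abs_neg, abs_pow]
    calc |φ'' x| * |B x| ^ 2 ≤ (L * t) * (K / t) ^ 2 := by
          have := hb2 x hx'
          gcongr
      _ = L * K ^ 2 / t := by field_simp
  have q3 : |B'' x| ≤ (L * K ^ 2 + 2 * L ^ 2 * K ^ 3) / t := by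
    simp only [hB'']
    refine (abs_sub _ _).trans ?_
    rw [abs_mul, abs_neg, abs_pow, abs_mul, abs_mul, abs_mul, abs_two]
    calc |φ''' x| * |B x| ^ 2 + 2 * |φ'' x| * |B x| * |B' x|
        ≤ (L * t) * (K / t) ^ 2 + 2 * (L * t) * (K / t) * (L * K ^ 2 / t) := by
          have := hb2 x hx'
          have := hb3 x hx'
          gcongr
      _ = (L * K ^ 2 + 2 * L ^ 2 * K ^ 3) / t := by field_simp
  clear_value B B' B''
  have e1 : e' x = a'' x * B x ^ 2 + 3 * a' x * B x * B' x + a x * (B x * B'' x + B' x ^ 2) := by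
    simp only [he'def, hb''def, hb'def]; ring
  rw [e1]
  refine (abs_add_le _ _).trans ((add_le_add (abs_add_le _ _) le_rfl).trans ?_)
  have e2 : |B x * B'' x + B' x ^ 2| ≤ |B x| * |B'' x| + |B' x| ^ 2 :=
    (abs_add_le _ _).trans (by rw [abs_mul, abs_pow])
  rw [abs_mul (a'' x), abs_mul (3 * a' x * B x), abs_mul (3 * a' x), abs_mul 3, abs_mul (a x), abs_pow, abs_of_pos (three_pos : (0:ℝ) < 3)]
  calc |a'' x| * |B x| ^ 2 + 3 * |a' x| * |B x| * |B' x| + |a x| * |B x * B'' x + B' x ^ 2|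
      ≤ A * (K / t) ^ 2 + 3 * A * (K / t) * (L * K ^ 2 / t) +
        A * ((K / t) * ((L * K ^ 2 + 2 * L ^ 2 * K ^ 3) / t) + (L * K ^ 2 / t) ^ 2) := by
        have h1 := hA x hx'
        have h2 := hA' x hx'
        have h3 := hA'' x hx'
        have h4 : |B x * B'' x + B' x ^ 2| ≤
            (K / t) * ((L * K ^ 2 + 2 * L ^ 2 * K ^ 3) / t) + (L * K ^ 2 / t) ^ 2 :=
          e2.trans (by gcongr)
        gcongr
    _ = A * K ^ 2 * (1 + 4 * K * L + 3 * K ^ 2 * L ^ 2) / t ^ 2 := by field_simp; ring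

section
open scoped ContDiff

/-- A smooth cutoff equal to one on `[1, 17]`, the range of `ω²` in dimension four. -/
def spectralBump : ContDiffBump (9 : ℝ) := ⟨8, 17 / 2, by norm_num, by norm_num⟩

lemma spectralBump_eq_one {x : ℝ} (h1 : 1 ≤ x) (h2 : x ≤ 17) : spectralBump x = 1 := by
  apply spectralBump.one_of_mem_closedBall
  rw [Metric.mem_closedBall, Real.dist_eq, abs_le]
  change -8 ≤ x - 9 ∧ x - 9 ≤ 8
  constructor <;> linarith

lemma spectralBump_eq_zero {x : ℝ} (h : x ≤ 1 / 2 ∨ 35 / 2 ≤ x) : spectralBump x = 0 := by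
  apply spectralBump.zero_of_le_dist
  change 17 / 2 ≤ dist x 9
  rw [Real.dist_eq, le_abs]
  rcases h with h | h
  · right; linarith
  · left; linarith

lemma contDiff_spectralBump_smul {E : Type*} [NormedAddCommGroup E] [NormedSpace ℝ E]
    {g : ℝ → E} (hg : ∀ x, 0 < x → ContDiffAt ℝ ∞ g x) :
    ContDiff ℝ ∞ fun x => spectralBump x • g x := by
  rw [contDiff_iff_contDiffAt]
  intro x
  rcases lt_or_ge 0 x with hx | hx
  · exact spectralBump.contDiffAt.smul (hg x hx)
  · have : (fun x => spectralBump x • g x) =ᶠ[nhds x] fun _ => 0 := by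
      filter_upwards [Iio_mem_nhds (show x < 1 / 2 by linarith)] with y hy
      rw [spectralBump_eq_zero (Or.inl (le_of_lt hy)), zero_smul]
    exact contDiffAt_const.congr_of_eventuallyEq this

lemma hasCompactSupport_spectralBump_smul {E : Type*} [NormedAddCommGroup E] [NormedSpace ℝ E]
    (g : ℝ → E) : HasCompactSupport fun x => spectralBump x • g x :=
  spectralBump.hasCompactSupport.smul_right

/-- The cut-off power `λ ^ (-κ)`. -/
def cutPow (κ x : ℝ) : ℝ := spectralBump x • x ^ (-κ)

/-- The symbol `e^{it√λ} λ^{-κ}` as a function of `λ = ω²`, cut off smoothly. -/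
def cutSymbol (κ t x : ℝ) : ℂ :=
  spectralBump x • (((x ^ (-κ) : ℝ) : ℂ) * Complex.exp (Complex.I * ((t * √x : ℝ) : ℂ)))

lemma cutSymbol_eq (κ t x : ℝ) :
    cutSymbol κ t x = (cutPow κ x : ℂ) * Complex.exp (Complex.I * ((t * √x : ℝ) : ℂ)) := by
  simp only [cutSymbol, cutPow, Complex.real_smul, smul_eq_mul]
  push_cast; ring

lemma contDiff_cutPow (κ : ℝ) : ContDiff ℝ ∞ (cutPow κ) :=
  contDiff_spectralBump_smul fun _ hx => Real.contDiffAt_rpow_const_of_ne hx.ne'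

lemma hasCompactSupport_cutPow (κ : ℝ) : HasCompactSupport (cutPow κ) :=
  hasCompactSupport_spectralBump_smul _

lemma contDiff_cutSymbol (κ t : ℝ) : ContDiff ℝ ∞ (cutSymbol κ t) := by
  refine contDiff_spectralBump_smul fun x hx => ?_
  refine ContDiffAt.mul ?_ ?_
  · exact Complex.ofRealCLM.contDiff.contDiffAt.comp x
      (Real.contDiffAt_rpow_const_of_ne hx.ne')
  · refine ContDiffAt.cexp (contDiffAt_const.mul ?_)
    exact Complex.ofRealCLM.contDiff.contDiffAt.comp x
      (contDiffAt_const.mul (contDiffAt_id.sqrt hx.ne'))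

lemma hasCompactSupport_cutSymbol (κ t : ℝ) : HasCompactSupport (cutSymbol κ t) :=
  hasCompactSupport_spectralBump_smul _

lemma exists_bound_cutPow (κ : ℝ) : ∃ A : ℝ, 0 < A ∧ ∀ x, |cutPow κ x| ≤ A ∧
    |deriv (cutPow κ) x| ≤ A ∧ |deriv (deriv (cutPow κ)) x| ≤ A := by
  have hc := contDiff_cutPow κ
  have hs := hasCompactSupport_cutPow κ
  have hd : ContDiff ℝ ∞ (deriv (cutPow κ)) := (contDiff_infty_iff_deriv.1 hc).2
  have hdd : ContDiff ℝ ∞ (deriv (deriv (cutPow κ))) := (contDiff_infty_iff_deriv.1 hd).2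
  obtain ⟨A, hA⟩ := hs.exists_bound_of_continuous hc.continuous
  obtain ⟨B, hB⟩ := hs.deriv.exists_bound_of_continuous hd.continuous
  obtain ⟨D, hD⟩ := hs.deriv.deriv.exists_bound_of_continuous hdd.continuous
  refine ⟨max (max A B) (max D 1), lt_max_of_lt_right (lt_max_of_lt_right one_pos),
    fun x => ⟨(hA x).trans ?_, (hB x).trans ?_, (hD x).trans ?_⟩⟩
  · exact (le_max_left _ _).trans (le_max_left _ _)
  · exact (le_max_right _ _).trans (le_max_left _ _)
  · exact (le_max_left _ _).trans (le_max_right _ _)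

/-- The Fourier transform of the cut-off symbol, up to the normalization of frequency. -/
def cutFourier (κ t s : ℝ) : ℂ :=
  ∫ x in (1/4:ℝ)..20, (cutPow κ x : ℂ) * Complex.exp (Complex.I * ((t * √x - 2 * π * s * x : ℝ) : ℂ))

open FourierTransform in
lemma fourier_cutSymbol (κ t s : ℝ) : 𝓕 (cutSymbol κ t) s = cutFourier κ t s := by
  rw [Real.fourier_real_eq_integral_exp_smul, cutFourier,
    intervalIntegral.integral_of_le (by norm_num), ← integral_indicator measurableSet_Ioc]
  congr 1
  ext x
  by_cases hx : x ∈ Set.Ioc (1/4 : ℝ) 20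
  · rw [Set.indicator_of_mem hx, cutSymbol_eq, smul_eq_mul, mul_left_comm, ← Complex.exp_add]
    congr 2
    push_cast; ring
  · rw [Set.indicator_of_notMem hx, cutSymbol, spectralBump_eq_zero, zero_smul, smul_zero]
    rw [Set.mem_Ioc, not_and_or] at hx
    rcases hx with hx | hx
    · left; linarith
    · right; linarith

open FourierTransform in
lemma integrable_cutFourier (κ t : ℝ) : Integrable (cutFourier κ t) := by
  have : Integrable (⇑(𝓕 ((hasCompactSupport_cutSymbol κ t).toSchwartzMap
    (contDiff_cutSymbol κ t)) : SchwartzMap ℝ ℂ)) volume := SchwartzMap.integrable _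
  rw [SchwartzMap.fourier_coe] at this
  convert! this using 1
  ext s
  rw [← fourier_cutSymbol]
  rfl

open FourierTransform in
lemma cutSymbol_eq_integral (κ t x : ℝ) :
    cutSymbol κ t x =
      ∫ s, Complex.exp (Complex.I * ((2 * π * s * x : ℝ) : ℂ)) * cutFourier κ t s := by
  have h0 : 𝓕 (cutSymbol κ t) = cutFourier κ t := funext (fourier_cutSymbol κ t)
  have h1 := (contDiff_cutSymbol κ t).continuous.fourierInv_fourier_eq
    ((contDiff_cutSymbol κ t).continuous.integrable_of_hasCompactSupport
      (hasCompactSupport_cutSymbol κ t)) (h0 ▸ integrable_cutFourier κ t)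
  rw [h0] at h1
  conv_lhs => rw [← h1]
  rw [Real.fourierInv_eq']
  congr 1
  ext s
  simp only [smul_eq_mul, RCLike.inner_apply, conj_trivial]
  congr 2
  push_cast; ring

lemma norm_cutFourier_neg (κ t s : ℝ) : ‖cutFourier κ (-t) (-s)‖ = ‖cutFourier κ t s‖ := by
  rw [← Complex.norm_conj (cutFourier κ t s)]
  congr 1
  unfold cutFourier
  rw [intervalIntegral.integral_of_le (by norm_num), intervalIntegral.integral_of_le (by norm_num),
    ← integral_conj]
  congr 1
  ext x
  rw [map_mul, ← Complex.exp_conj, map_mul, Complex.conj_I, Complex.conj_ofReal,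
    Complex.conj_ofReal]
  congr 2
  push_cast; ring

lemma exists_norm_cutFourier_le (κ : ℝ) : ∃ C : ℝ, 0 < C ∧ ∀ t s : ℝ, 0 < |t| →
    ‖cutFourier κ t s‖ ≤ C / √|t| ∧
      (¬ (|t| / 20 ≤ 2 * π * |s| ∧ 2 * π * |s| ≤ 2 * |t|) → ‖cutFourier κ t s‖ ≤ C / |t| ^ 2) := by
  obtain ⟨A, hA0, hA⟩ := exists_bound_cutPow κ
  have hc := contDiff_cutPow κ
  have hd : ContDiff ℝ ∞ (deriv (cutPow κ)) := (contDiff_infty_iff_deriv.1 hc).2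
  have hdd : ContDiff ℝ ∞ (deriv (deriv (cutPow κ))) := (contDiff_infty_iff_deriv.1 hd).2
  have hz : ∀ x, x < 1/2 ∨ 35/2 < x → cutPow κ x = 0 := fun x hx => by
    rw [cutPow, spectralBump_eq_zero (hx.imp le_of_lt le_of_lt), zero_smul]
  have hz' : ∀ x, x < 1/2 ∨ 35/2 < x → deriv (cutPow κ) x = 0 := fun x hx => by
    have : cutPow κ =ᶠ[nhds x] fun _ => 0 := by
      rcases hx with hx | hx
      · filter_upwards [Iio_mem_nhds hx] with y hy using hz y (Or.inl hy)
      · filter_upwards [Ioi_mem_nhds hx] with y hy using hz y (Or.inr hy)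
    rw [this.deriv_eq, deriv_const]
  refine ⟨A * 10 ^ 10, by positivity, fun t s ht => ?_⟩
  wlog htp : 0 < t generalizing t s
  · have := this (-t) (-s) (by rwa [abs_neg])
      (by rcases lt_or_gt_of_ne (abs_pos.1 ht) with h | h <;> linarith)
    rwa [norm_cutFourier_neg, abs_neg, abs_neg] at this
  rw [abs_of_pos htp]
  set φ : ℝ → ℝ := fun x => t * √x - 2 * π * s * x with hφ
  set D : ℝ → ℝ := fun x => (√x)⁻¹ with hD
  have hDd : ∀ x ∈ Set.Icc (1/4:ℝ) 20, HasDerivAt D (-(1/2) * D x ^ 3) x := fun x hx => by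
    have hx0 : 0 < x := by linarith [hx.1]
    have := (Real.hasDerivAt_sqrt hx0.ne').inv (Real.sqrt_pos.2 hx0).ne'
    convert! this using 1
    have := (Real.sqrt_pos.2 hx0).ne'
    simp only [hD]; field_simp
  have hDl : ∀ x ∈ Set.Icc (1/4:ℝ) 20, 1/5 ≤ D x := fun x hx => by
    have hx0 : 0 < x := by linarith [hx.1]
    simp only [hD]
    rw [one_div]
    refine inv_anti₀ (Real.sqrt_pos.2 hx0) ?_
    rw [Real.sqrt_le_left (by norm_num)]; linarith [hx.2]
  have hDu : ∀ x ∈ Set.Icc (1/4:ℝ) 20, D x ≤ 2 := fun x hx => by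
    simp only [hD]
    refine inv_le_of_inv_le₀ (by norm_num) ?_
    apply Real.le_sqrt_of_sq_le; linarith [hx.1]
  have h1 : ∀ x ∈ Set.Icc (1/4:ℝ) 20, HasDerivAt φ (t / 2 * D x - 2 * π * s) x := fun x hx => by
    have hx0 : 0 < x := by linarith [hx.1]
    convert! ((Real.hasDerivAt_sqrt hx0.ne').const_mul t).sub
      ((hasDerivAt_id x).const_mul (2 * π * s)) using 1
    simp only [hD]; field_simp
  have h2 : ∀ x ∈ Set.Icc (1/4:ℝ) 20,
      HasDerivAt (fun x => t / 2 * D x - 2 * π * s) (-(t / 4) * D x ^ 3) x := fun x hx => by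
    convert! ((hDd x hx).const_mul (t/2)).sub_const (2 * π * s) using 1
    ring
  have h3 : ∀ x ∈ Set.Icc (1/4:ℝ) 20,
      HasDerivAt (fun x => -(t / 4) * D x ^ 3) (3 * t / 8 * D x ^ 5) x := fun x hx => by
    convert! ((hDd x hx).pow 3).const_mul (-(t / 4)) using 1
    simp; ring
  have hDc : ContinuousOn D (Set.Icc (1/4:ℝ) 20) :=
    fun x hx => (hDd x hx).continuousAt.continuousWithinAt
  have ha1 : ∀ x, HasDerivAt (cutPow κ) (deriv (cutPow κ) x) x := fun x =>
    (hc.differentiable (by simp) x).hasDerivAt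
  have ha2 : ∀ x, HasDerivAt (deriv (cutPow κ)) (deriv (deriv (cutPow κ)) x) x := fun x =>
    (hd.differentiable (by simp) x).hasDerivAt
  constructor
  · have := norm_integral_mul_exp_le_of_deriv2_le (α := 1/4) (β := 20) (l := t / 500) (A := A)
      (by norm_num) (by positivity) h1 h2 (by fun_prop) (fun x hx => by
        have h := hDl x hx
        have : (1/5 : ℝ) ^ 3 ≤ D x ^ 3 := by gcongr
        nlinarith)
      (fun x _ => ha1 x) hd.continuous.continuousOn (fun x _ => (hA x).2.1)
      (hz _ (Or.inr (by norm_num)))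
    refine this.trans ?_
    have h5 : √(t/500) = √t / √500 := Real.sqrt_div htp.le _
    have h6 : √500 ≤ 25 := by rw [Real.sqrt_le_left (by norm_num)]; norm_num
    have h7 : 0 < √t := Real.sqrt_pos.2 htp
    calc A * (10 / √(t / 500)) * (20 - 1 / 4) = A * (197.5 * √500) / √t := by
          rw [h5]; field_simp; norm_num
      _ ≤ A * 10 ^ 10 / √t := by gcongr; linarith
  · intro hts
    have hlow : ∀ x ∈ Set.Icc (1/4:ℝ) 20, t / 20 ≤ |t / 2 * D x - 2 * π * s| := fun x hx => by
      have hl := hDl x hx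
      have hu := hDu x hx
      have hs1 := le_abs_self s
      have hs2 := neg_abs_le s
      have hpi := Real.pi_pos
      rw [not_and_or, not_le, not_le] at hts
      rw [le_abs]
      rcases hts with h | h
      · left
        have : 2 * π * s ≤ 2 * π * |s| := by gcongr
        nlinarith
      · rcases le_total 0 s with h0 | h0
        · rw [abs_of_nonneg h0] at h
          right; nlinarith
        · left; nlinarith
    have := norm_integral_mul_exp_le_of_le_abs_deriv (α := 1/4) (β := 20) (t := t) (K := 20)
      (L := 12) (A := A) (by norm_num) htp (by norm_num) (by norm_num) hA0.le h1 h2 h3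
      (by fun_prop) hlow (fun x hx => by
        have h := hDl x hx
        have h' := hDu x hx
        have h0 : 0 ≤ D x := by linarith
        have : D x ^ 3 ≤ 2 ^ 3 := by gcongr
        rw [abs_mul, abs_neg, abs_of_pos (by positivity), abs_of_nonneg (by positivity)]
        nlinarith)
      (fun x hx => by
        have h := hDl x hx
        have h' := hDu x hx
        have h0 : 0 ≤ D x := by linarith
        have : D x ^ 5 ≤ 2 ^ 5 := by gcongr
        rw [abs_of_nonneg (by positivity)]
        nlinarith)
      (fun x _ => ha1 x) (fun x _ => ha2 x) hdd.continuous.continuousOn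
      (fun x _ => (hA x).1) (fun x _ => (hA x).2.1) (fun x _ => (hA x).2.2)
      (hz _ (Or.inl (by norm_num))) (hz _ (Or.inr (by norm_num)))
      (hz' _ (Or.inl (by norm_num))) (hz' _ (Or.inr (by norm_num)))
    refine this.trans ?_
    rw [div_mul_eq_mul_div]
    refine div_le_div_of_nonneg_right ?_ (by positivity)
    norm_num
    linarith

end

lemma integrable_one_add_abs_rpow {r : ℝ} (hr : 1 < r) :
    Integrable fun x : ℝ => (1 + |x|) ^ (-r) := by
  have := integrable_one_add_norm (E := ℝ) (μ := volume) (r := r) (by simpa using hr)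
  simpa only [Real.norm_eq_abs] using this

lemma inv_one_add_le {ε T y : ℝ} (hε : 0 < ε) (hT : 1 ≤ T) (hy : 0 ≤ y) :
    1 / (1 + y) ≤ T ^ ε * (1 + y) ^ (-(1 + ε)) + 1 / T := by
  have h1 : 0 < 1 + y := by linarith
  rcases le_total (1 + y) T with h | h
  · have h2 : 1 / (1 + y) = (1 + y) ^ ε * (1 + y) ^ (-(1 + ε)) := by
      rw [← Real.rpow_add h1, show ε + -(1 + ε) = -1 by ring, Real.rpow_neg_one, one_div]
    have h3 : (1 + y) ^ ε * (1 + y) ^ (-(1 + ε)) ≤ T ^ ε * (1 + y) ^ (-(1 + ε)) := by gcongr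
    have : 0 ≤ 1 / T := by positivity
    linarith
  · have h3 : 1 / (1 + y) ≤ 1 / T := one_div_le_one_div_of_le (by linarith) h
    have : 0 ≤ T ^ ε * (1 + y) ^ (-(1 + ε)) := by positivity
    linarith

lemma inv_one_add_min_le {ε T n z : ℝ} (hε : 0 < ε) (hT : 1 ≤ T) :
    1 / (1 + min |(|n| - |z|)| |z|) ≤ T ^ ε * ((1 + |z - n|) ^ (-(1 + ε)) +
      (1 + |z + n|) ^ (-(1 + ε)) + (1 + |z|) ^ (-(1 + ε))) + 1 / T := by
  have hcase : min |(|n| - |z|)| |z| = |z - n| ∨ min |(|n| - |z|)| |z| = |z + n| ∨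
      min |(|n| - |z|)| |z| = |z| := by
    have : |(|n| - |z|)| = |z - n| ∨ |(|n| - |z|)| = |z + n| := by
      rcases abs_cases n with ⟨h, _⟩ | ⟨h, _⟩ <;> rcases abs_cases z with ⟨h', _⟩ | ⟨h', _⟩ <;>
        rw [h, h']
      · left; rw [abs_sub_comm]
      · right; congr 1; ring
      · right; rw [← abs_neg]; congr 1; ring
      · left; congr 1; ring
    rcases min_choice |(|n| - |z|)| |z| with h | h <;> rw [h]
    · rcases this with h | h <;> simp [h]
    · simp
  have p1 : 0 ≤ T ^ ε * (1 + |z - n|) ^ (-(1 + ε)) := by positivity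
  have p2 : 0 ≤ T ^ ε * (1 + |z + n|) ^ (-(1 + ε)) := by positivity
  have p3 : 0 ≤ T ^ ε * (1 + |z|) ^ (-(1 + ε)) := by positivity
  rcases hcase with h | h | h <;> rw [h]
  · have := inv_one_add_le hε hT (abs_nonneg (z - n)); linarith
  · have := inv_one_add_le hε hT (abs_nonneg (z + n)); linarith
  · have := inv_one_add_le hε hT (abs_nonneg z); linarith

lemma exists_norm_besselInt_pow_four_le_rpow : ∃ C : ℝ, 0 < C ∧ ∀ n s : ℝ,
    ‖besselInt n (4 * π * s)‖ ^ 4 ≤ C * (1 + |s|) ^ (-(4/3) : ℝ) := by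
  refine ⟨(2 * 50 ^ 3 : ℝ) ^ (4/3 : ℝ), by positivity, fun n s => ?_⟩
  have hpi := Real.pi_gt_three
  have hpi4 := Real.pi_lt_four
  have h3 : ‖besselInt n (4 * π * s)‖ ^ 3 ≤ 2 * 50 ^ 3 / (1 + |s|) := by
    have habs : |4 * π * s| = 4 * π * |s| := by
      rw [abs_mul, abs_of_pos (by positivity)]
    have hs0 := abs_nonneg s
    rcases le_or_gt 1 |4 * π * s| with h | h
    · refine (norm_besselInt_pow_three_le h).trans ?_
      rw [habs] at h ⊢
      rw [div_le_div_iff₀ (by linarith) (by linarith)]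
      nlinarith
    · rw [habs] at h
      have h1 := norm_besselInt_le n (4 * π * s)
      have h2 : ‖besselInt n (4 * π * s)‖ ^ 3 ≤ 8 ^ 3 := by gcongr; linarith
      rw [le_div_iff₀ (by linarith)]
      have : |s| ≤ 1 := by nlinarith
      nlinarith [norm_nonneg (besselInt n (4 * π * s))]
  have h4 : ‖besselInt n (4 * π * s)‖ ^ 4 = (‖besselInt n (4 * π * s)‖ ^ 3) ^ (4/3 : ℝ) := by
    rw [← Real.rpow_natCast, ← Real.rpow_natCast, ← Real.rpow_mul (norm_nonneg _)]
    norm_num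
  rw [h4]
  calc (‖besselInt n (4 * π * s)‖ ^ 3) ^ (4/3 : ℝ) ≤ (2 * 50 ^ 3 / (1 + |s|)) ^ (4/3 : ℝ) := by
        gcongr
    _ = _ := by
        rw [Real.div_rpow (by norm_num) (by positivity), Real.rpow_neg (by positivity), div_eq_mul_inv]

lemma exists_integral_bound_cutFourier_mul (κ : ℝ) {ε : ℝ} (hε : 0 < ε) (hε' : ε ≤ 1 / 2) :
    ∃ C : ℝ, 0 < C ∧ ∀ t n : ℝ, 10 ≤ |t| → ∃ Ψ : ℝ → ℝ, Integrable Ψ ∧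
      (∀ s, ‖cutFourier κ t s‖ * ‖besselInt n (4 * π * s)‖ ^ 4 ≤ Ψ s) ∧
      ∫ s, Ψ s ≤ C * |t| ^ (-(3/2) + ε) := by
  obtain ⟨A, hA0, hA⟩ := exists_norm_cutFourier_le κ
  obtain ⟨B, hB0, hB⟩ := exists_norm_besselInt_pow_four_le
  obtain ⟨D, hD0, hD⟩ := exists_norm_besselInt_pow_four_le_rpow
  have hpi := Real.pi_gt_three
  set g : ℝ → ℝ := fun y => (1 + |y|) ^ (-(1 + ε)) with hg
  set h : ℝ → ℝ := fun y => (1 + |y|) ^ (-(4/3) : ℝ) with hh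
  have hgi : Integrable g := integrable_one_add_abs_rpow (by linarith)
  have hhi : Integrable h := integrable_one_add_abs_rpow (by norm_num)
  have hg0 : ∀ y, 0 ≤ g y := fun y => by positivity
  have hh0 : ∀ y, 0 ≤ h y := fun y => by positivity
  have hG0 : 0 ≤ ∫ y, g y := integral_nonneg hg0
  have hH0 : 0 ≤ ∫ y, h y := integral_nonneg hh0
  have h4pi : (4 * π) ≠ 0 := by positivity
  have hi1 : ∀ n : ℝ, Integrable fun s => g (4 * π * s - n) := fun n =>
    (hgi.comp_sub_right n).comp_mul_left' h4pi
  have hi2 : ∀ n : ℝ, ∫ s, g (4 * π * s - n) ≤ ∫ y, g y := fun n => by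
    rw [Measure.integral_comp_mul_left (fun y => g (y - n)) (4 * π), integral_sub_right_eq_self g n,
      smul_eq_mul, abs_of_pos (by positivity)]
    refine mul_le_of_le_one_left hG0 (inv_le_one_of_one_le₀ (by linarith))
  refine ⟨A * B * 10 * (12 * (∫ y, g y) + 2) + A * D * (∫ y, h y) + 1, by positivity,
    fun t n ht => ?_⟩
  have ht0 : 0 < |t| := by linarith
  set T := 4 * |t| with hT
  set Ψ : ℝ → ℝ := fun s => A / √|t| * (B * 10 / |t|) * (T ^ ε * (g (4 * π * s - n) +
    g (4 * π * s - -n) + g (4 * π * s - 0)) + (Set.Icc (-|t|) |t|).indicator (fun _ => 1 / T) s) +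
    A / |t| ^ 2 * D * h s with hΨ
  have hindi : Integrable ((Set.Icc (-|t|) |t|).indicator (fun _ => 1 / T)) :=
    (integrable_indicator_iff measurableSet_Icc).2 (integrableOn_const (by simp) (by simp))
  have hind0 : ∀ s, 0 ≤ (Set.Icc (-|t|) |t|).indicator (fun _ => 1 / T) s := fun s =>
    Set.indicator_nonneg (fun _ _ => by positivity) s
  have hi3 : Integrable fun s => g (4 * π * s - n) + g (4 * π * s - -n) + g (4 * π * s - 0) :=
    ((hi1 n).add (hi1 (-n))).add (hi1 0)
  have hi12 : Integrable fun s => g (4 * π * s - n) + g (4 * π * s - -n) :=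
    (hi1 n).add (hi1 (-n))
  have hi0 : Integrable fun s => g (4 * π * s - 0) := hi1 0
  have hi4 : Integrable fun s => A / √|t| * (B * 10 / |t|) * (T ^ ε * (g (4 * π * s - n) +
      g (4 * π * s - -n) + g (4 * π * s - 0)) + (Set.Icc (-|t|) |t|).indicator (fun _ => 1 / T) s) :=
    ((hi3.const_mul _).add hindi).const_mul _
  refine ⟨Ψ, ?_, fun s => ?_, ?_⟩
  · exact hi4.add (hhi.const_mul _)
  · by_cases hs : |t| / 20 ≤ 2 * π * |s| ∧ 2 * π * |s| ≤ 2 * |t|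
    · have habs : |4 * π * s| = 4 * π * |s| := by rw [abs_mul, abs_of_pos (by positivity)]
      have hz : 1 ≤ |4 * π * s| := by rw [habs]; linarith
      have e1 := (hA t s ht0).1
      have e2 : ‖besselInt n (4 * π * s)‖ ^ 4 ≤ B * 10 / |t| *
          (T ^ ε * (g (4 * π * s - n) + g (4 * π * s - -n) + g (4 * π * s - 0)) + 1 / T) := by
        refine (hB n (4 * π * s) hz).trans ?_
        have hmin := inv_one_add_min_le (ε := ε) (T := T) (n := n) (z := 4 * π * s) hε
          (by rw [hT]; linarith)
        simp only [hg, sub_neg_eq_add, sub_zero]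
        calc B / (|4 * π * s| * (1 + min |(|n| - |4 * π * s|)| |4 * π * s|))
            = B / |4 * π * s| * (1 / (1 + min |(|n| - |4 * π * s|)| |4 * π * s|)) := by
              rw [div_mul_div_comm, mul_one]
          _ ≤ B * 10 / |t| * _ := by
              refine mul_le_mul ?_ hmin (by positivity) (by positivity)
              rw [div_le_div_iff₀ (by linarith) ht0, habs]
              nlinarith
      have hsmem : s ∈ Set.Icc (-|t|) |t| := by
        rw [Set.mem_Icc, ← abs_le]; nlinarith [abs_nonneg s]
      have e3 : (Set.Icc (-|t|) |t|).indicator (fun _ => 1 / T) s = 1 / T :=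
        Set.indicator_of_mem hsmem _
      simp only [hΨ]
      rw [e3, mul_assoc (A / √|t|)]
      have : 0 ≤ A / |t| ^ 2 * D * h s := by positivity
      have := mul_le_mul e1 e2 (by positivity) (by positivity)
      linarith
    · have e1 := (hA t s ht0).2 hs
      have e2 := hD n s
      have := mul_le_mul e1 e2 (by positivity) (by positivity)
      simp only [hΨ]
      have h5 := hind0 s
      have h6 := hg0 (4 * π * s - n)
      have h7 := hg0 (4 * π * s - -n)
      have h8 := hg0 (4 * π * s - 0)
      rw [mul_assoc (A / |t| ^ 2)]
      refine this.trans (le_add_of_nonneg_left ?_)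
      positivity
  · have hii : ∫ s, Ψ s = A / √|t| * (B * 10 / |t|) * (T ^ ε * ((∫ s, g (4 * π * s - n)) +
      (∫ s, g (4 * π * s - -n)) + ∫ s, g (4 * π * s - 0)) + 2 * |t| * (1 / T)) +
      A / |t| ^ 2 * D * ∫ s, h s := by
      simp only [hΨ]
      rw [integral_add hi4 (hhi.const_mul _),
        integral_const_mul, integral_const_mul, integral_add (hi3.const_mul _) hindi,
        integral_const_mul, integral_add hi12 hi0,
        integral_add (hi1 n) (hi1 (-n)), integral_indicator measurableSet_Icc]
      simp
      left; left
      ring_nf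
    rw [hii]
    have hTε : T ^ ε ≤ 4 * |t| ^ ε := by
      rw [hT, Real.mul_rpow (by norm_num) ht0.le]
      gcongr
      calc (4:ℝ) ^ ε ≤ 4 ^ (1:ℝ) := Real.rpow_le_rpow_of_exponent_le (by norm_num) (by linarith)
        _ = 4 := by norm_num
    have hone : 1 ≤ |t| ^ ε := Real.one_le_rpow (by linarith) hε.le
    have hpow : |t| ^ (-(3/2) + ε) = 1 / √|t| * (1 / |t|) * |t| ^ ε := by
      have : |t| ^ (-(3/2) : ℝ) = |t| ^ (-(1/2) : ℝ) * |t| ^ (-1 : ℝ) := by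
        rw [← Real.rpow_add ht0]; norm_num
      rw [Real.rpow_add ht0, this, Real.rpow_neg ht0.le, ← Real.sqrt_eq_rpow, Real.rpow_neg_one]
      ring
    have hpow2 : 1 / |t| ^ 2 ≤ |t| ^ (-(3/2) + ε) := by
      rw [one_div, ← Real.rpow_natCast, ← Real.rpow_neg ht0.le]
      exact Real.rpow_le_rpow_of_exponent_le (by linarith) (by push_cast; linarith)
    have i1 := hi2 n
    have i2 := hi2 (-n)
    have i3 := hi2 0
    have hP0 : 0 ≤ |t| ^ (-(3/2) + ε) := by positivity
    have m1 : A / √|t| * (B * 10 / |t|) * (T ^ ε * ((∫ s, g (4 * π * s - n)) +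
      (∫ s, g (4 * π * s - -n)) + ∫ s, g (4 * π * s - 0)) + 2 * |t| * (1 / T)) ≤
      A * B * 10 * (12 * (∫ y, g y) + 2) * |t| ^ (-(3/2) + ε) := by
      have hb : T ^ ε * ((∫ s, g (4 * π * s - n)) +
        (∫ s, g (4 * π * s - -n)) + ∫ s, g (4 * π * s - 0)) + 2 * |t| * (1 / T) ≤
        (12 * (∫ y, g y) + 2) * |t| ^ ε := by
        have e : 2 * |t| * (1 / T) = 1 / 2 := by rw [hT]; field_simp; norm_num
        rw [e]
        calc _ ≤ (4 * |t| ^ ε) * ((∫ y, g y) + (∫ y, g y) + ∫ y, g y) + 2 * |t| ^ ε := by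
              have : 0 ≤ (∫ s, g (4 * π * s - n)) := integral_nonneg fun s => hg0 _
              have : 0 ≤ (∫ s, g (4 * π * s - -n)) := integral_nonneg fun s => hg0 _
              have : 0 ≤ (∫ s, g (4 * π * s - 0)) := integral_nonneg fun s => hg0 _
              refine add_le_add ?_ (by linarith)
              gcongr
          _ = _ := by ring
      calc _ ≤ A / √|t| * (B * 10 / |t|) * ((12 * (∫ y, g y) + 2) * |t| ^ ε) := by gcongr
        _ = _ := by rw [hpow]; ring
    have m2 : A / |t| ^ 2 * D * ∫ s, h s ≤ A * D * (∫ y, h y) * |t| ^ (-(3/2) + ε) := by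
      calc A / |t| ^ 2 * D * ∫ s, h s = A * D * (∫ y, h y) * (1 / |t| ^ 2) := by ring
        _ ≤ _ := by gcongr
    linarith

lemma volume_restrict_cube (d : ℕ) : (volume : Measure (Fin d → ℝ)).restrict (cube d) =
    Measure.pi fun _ : Fin d => (volume : Measure ℝ).restrict (Set.Icc 0 (2 * π)) := by
  rw [cube, ← Set.pi_univ_Icc, volume_pi, Measure.restrict_pi_pi]
  rfl

instance isFiniteMeasure_restrict_cube (d : ℕ) :
    IsFiniteMeasure ((volume : Measure (Fin d → ℝ)).restrict (cube d)) := by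
  rw [volume_restrict_cube]; infer_instance

lemma omegaKG_sq (d : ℕ) (ξ : Fin d → ℝ) :
    omegaKG d ξ ^ 2 = 1 + ∑ j : Fin d, 2 * (1 - Real.cos (ξ j)) := by
  rw [omegaKG, Real.sq_sqrt]
  have : 0 ≤ ∑ j : Fin d, 2 * (1 - Real.cos (ξ j)) :=
    Finset.sum_nonneg fun j _ => by linarith [Real.cos_le_one (ξ j)]
  linarith

lemma one_le_omegaKG (d : ℕ) (ξ : Fin d → ℝ) : 1 ≤ omegaKG d ξ := by
  rw [omegaKG, Real.one_le_sqrt]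
  have : 0 ≤ ∑ j : Fin d, 2 * (1 - Real.cos (ξ j)) :=
    Finset.sum_nonneg fun j _ => by linarith [Real.cos_le_one (ξ j)]
  linarith

lemma omegaKG_sq_le (ξ : Fin 4 → ℝ) : omegaKG 4 ξ ^ 2 ≤ 17 := by
  rw [omegaKG_sq]
  have : ∑ j : Fin 4, 2 * (1 - Real.cos (ξ j)) ≤ ∑ j : Fin 4, (4 : ℝ) :=
    Finset.sum_le_sum fun j _ => by linarith [Real.neg_one_le_cos (ξ j)]
  simp at this
  linarith

@[fun_prop]
lemma continuous_omegaKG (d : ℕ) : Continuous (omegaKG d) := by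
  unfold omegaKG; fun_prop

lemma integral_cube_exp_mul_exp (x : Fin 4 → ℤ) (s : ℝ) :
    ∫ ξ in cube 4, Complex.exp (Complex.I * ((∑ j, (x j : ℝ) * ξ j : ℝ) : ℂ)) *
      Complex.exp (Complex.I * ((2 * π * s * omegaKG 4 ξ ^ 2 : ℝ) : ℂ)) =
    Complex.exp (Complex.I * ((18 * π * s : ℝ) : ℂ)) * ∏ j, besselInt (x j) (4 * π * s) := by
  have h1 : ∀ j : Fin 4, besselInt (x j) (4 * π * s) = ∫ θ in Set.Icc 0 (2 * π),
      Complex.exp (Complex.I * (((x j : ℝ) * θ - 4 * π * s * Real.cos θ : ℝ) : ℂ)) := fun j => by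
    rw [besselInt, intervalIntegral.integral_of_le (by positivity), integral_Icc_eq_integral_Ioc]
  simp_rw [h1]
  rw [volume_restrict_cube, ← integral_fintype_prod_eq_prod, ← integral_const_mul]
  congr 1
  ext ξ
  rw [← Complex.exp_sum, ← Complex.exp_add, ← Complex.exp_add, omegaKG_sq]
  congr 1
  simp only [Fin.sum_univ_four]
  push_cast
  ring

lemma norm_integral_cube_cutSymbol_le (κ t : ℝ) (x : Fin 4 → ℤ) {Ψ : Fin 4 → ℝ → ℝ}
    (hi : ∀ j, Integrable (Ψ j))
    (hΨ : ∀ j s, ‖cutFourier κ t s‖ * ‖besselInt (x j) (4 * π * s)‖ ^ 4 ≤ Ψ j s) :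
    ‖∫ ξ in cube 4, Complex.exp (Complex.I * ((∑ j, (x j : ℝ) * ξ j : ℝ) : ℂ)) *
      cutSymbol κ t (omegaKG 4 ξ ^ 2)‖ ≤ 1 / 4 * ∑ j, ∫ s, Ψ j s := by
  have h1 : ∫ ξ in cube 4, Complex.exp (Complex.I * ((∑ j, (x j : ℝ) * ξ j : ℝ) : ℂ)) *
      cutSymbol κ t (omegaKG 4 ξ ^ 2) =
      ∫ s, Complex.exp (Complex.I * ((18 * π * s : ℝ) : ℂ)) *
        (∏ j, besselInt (x j) (4 * π * s)) * cutFourier κ t s := by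
    simp_rw [cutSymbol_eq_integral, ← integral_const_mul]
    rw [integral_integral_swap]
    · congr 1
      ext s
      rw [← integral_cube_exp_mul_exp, ← integral_mul_const]
      simp_rw [mul_assoc]
    · have hb : Integrable (fun p : (Fin 4 → ℝ) × ℝ => (1 : ℂ) * cutFourier κ t p.2)
          ((volume.restrict (cube 4)).prod volume) :=
        (integrable_const (1 : ℂ)).mul_prod (integrable_cutFourier κ t)
      have := hb.bdd_mul (c := 1) (f := fun p : (Fin 4 → ℝ) × ℝ =>
        Complex.exp (Complex.I * ((∑ j, (x j : ℝ) * p.1 j : ℝ) : ℂ)) *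
          Complex.exp (Complex.I * ((2 * π * p.2 * omegaKG 4 p.1 ^ 2 : ℝ) : ℂ)))
        (by
          apply Continuous.aestronglyMeasurable
          have := continuous_omegaKG 4
          fun_prop)
        (Filter.Eventually.of_forall fun p => by
          rw [norm_mul, norm_exp_I_mul_ofReal, norm_exp_I_mul_ofReal, one_mul])
      convert! this using 1
      ext p
      simp [Function.uncurry, mul_assoc]
  have h2 : ∀ s, ‖Complex.exp (Complex.I * ((18 * π * s : ℝ) : ℂ)) *
        (∏ j, besselInt (x j) (4 * π * s)) * cutFourier κ t s‖ ≤ 1 / 4 * ∑ j, Ψ j s := by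
    intro s
    rw [norm_mul, norm_mul, norm_exp_I_mul_ofReal, one_mul, norm_prod, Fin.prod_univ_four,
      Fin.sum_univ_four]
    set a := ‖besselInt (x 0) (4 * π * s)‖ with ha
    set b := ‖besselInt (x 1) (4 * π * s)‖ with hb
    set c := ‖besselInt (x 2) (4 * π * s)‖ with hc
    set d := ‖besselInt (x 3) (4 * π * s)‖ with hd
    have key : a * b * c * d ≤ 1 / 4 * (a ^ 4 + b ^ 4 + c ^ 4 + d ^ 4) := by
      nlinarith [sq_nonneg (a * b - c * d), sq_nonneg (a ^ 2 - b ^ 2), sq_nonneg (c ^ 2 - d ^ 2)]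
    have h0 := mul_le_mul_of_nonneg_right key (norm_nonneg (cutFourier κ t s))
    have := hΨ 0 s
    have := hΨ 1 s
    have := hΨ 2 s
    have := hΨ 3 s
    linarith
  rw [h1]
  refine (norm_integral_le_of_norm_le ((integrable_finsetSum _ fun j _ => hi j).const_mul _)
    (Filter.Eventually.of_forall h2)).trans ?_
  rw [integral_const_mul, integral_finsetSum _ fun j _ => hi j]

lemma cutSymbol_sq {κ t μ : ℝ} (h1 : 1 ≤ μ) (h2 : μ ^ 2 ≤ 17) :
    cutSymbol κ t (μ ^ 2) =
      ((μ ^ (-(2 * κ)) : ℝ) : ℂ) * Complex.exp (Complex.I * ((t * μ : ℝ) : ℂ)) := by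
  rw [cutSymbol, spectralBump_eq_one (by nlinarith) h2, one_smul, Real.sqrt_sq (by linarith),
    ← Real.rpow_natCast, ← Real.rpow_mul (by linarith)]
  congr 4
  push_cast; ring

lemma exists_norm_integral_cube_le (κ : ℝ) {ε : ℝ} (hε : 0 < ε) (hε' : ε ≤ 1 / 2) :
    ∃ C : ℝ, 0 < C ∧ ∀ (t : ℝ) (x : Fin 4 → ℤ), 10 ≤ |t| →
      ‖∫ ξ in cube 4, Complex.exp (Complex.I * ((∑ j, (x j : ℝ) * ξ j : ℝ) : ℂ)) *
        (((omegaKG 4 ξ ^ (-(2 * κ)) : ℝ) : ℂ) *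
          Complex.exp (Complex.I * ((t * omegaKG 4 ξ : ℝ) : ℂ)))‖ ≤ C * |t| ^ (-(3/2) + ε) := by
  obtain ⟨C, hC0, hC⟩ := exists_integral_bound_cutFourier_mul κ hε hε'
  refine ⟨C, hC0, fun t x ht => ?_⟩
  choose Ψ hi hΨ hle using fun j => hC t (x j) ht
  have := norm_integral_cube_cutSymbol_le κ t x hi hΨ
  simp_rw [cutSymbol_sq (one_le_omegaKG 4 _) (omegaKG_sq_le _)] at this
  refine this.trans ?_
  have h2 : ∑ j, ∫ s, Ψ j s ≤ ∑ _j : Fin 4, C * |t| ^ (-(3/2) + ε) :=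
    Finset.sum_le_sum fun j _ => hle j
  simp at h2
  linarith

lemma volume_real_cube (d : ℕ) :
    (((volume : Measure (Fin d → ℝ)).restrict (cube d)) Set.univ).toReal = (2 * π) ^ d := by
  rw [volume_restrict_cube, Measure.pi_univ]
  simp only [Measure.restrict_apply MeasurableSet.univ, Set.univ_inter, Real.volume_Icc, sub_zero,
    Finset.prod_const, Finset.card_univ, Fintype.card_fin, ENNReal.toReal_pow]
  rw [ENNReal.toReal_ofReal (by positivity)]

lemma norm_multKernel_le {d : ℕ} {m : (Fin d → ℝ) → ℝ} {M : ℝ} (hm : ∀ ξ, |m ξ| ≤ M)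
    (x : Fin d → ℤ) : ‖multKernel d m x‖ ≤ M := by
  rw [multKernel, norm_mul, Complex.norm_real, norm_inv, norm_pow, Real.norm_of_nonneg (by positivity)]
  have h := norm_integral_le_of_norm_le_const (μ := volume.restrict (cube d)) (C := M)
    (f := fun ξ => Complex.exp (Complex.I * ((∑ j : Fin d, (x j : ℝ) * ξ j : ℝ) : ℂ)) *
      ((m ξ : ℝ) : ℂ)) (Filter.Eventually.of_forall fun ξ => by
        rw [norm_mul, norm_exp_I_mul_ofReal, one_mul, Complex.norm_real]; exact hm ξ)
  rw [measureReal_def, volume_real_cube] at h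
  rw [inv_mul_le_iff₀ (by positivity), mul_comm]
  exact h

lemma integrable_cube_of_continuous {d : ℕ} {f : (Fin d → ℝ) → ℂ} (hf : Continuous f) :
    Integrable f (volume.restrict (cube d)) :=
  hf.continuousOn.integrableOn_compact isCompact_Icc

lemma continuous_omegaKG_rpow (d : ℕ) (κ : ℝ) : Continuous fun ξ => omegaKG d ξ ^ κ :=
  (continuous_omegaKG d).rpow_const fun ξ => Or.inl (by linarith [one_le_omegaKG d ξ])

/-- Dispersive estimate: the half-wave kernels decay like `(1 + |t|) ^ (-3/2 + ε)`. -/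
lemma exists_norm_multKernel_le {κ : ℝ} (hκ : 0 ≤ κ) {ε : ℝ} (hε : 0 < ε) (hε' : ε ≤ 1 / 2) :
    ∃ C : ℝ, 0 < C ∧ ∀ (t : ℝ) (x : Fin 4 → ℤ),
      ‖multKernel 4 (fun ξ => omegaKG 4 ξ ^ (-(2 * κ)) * Real.cos (t * omegaKG 4 ξ)) x‖ ≤
        C * (1 + |t|) ^ (-(3/2) + ε) ∧
      ‖multKernel 4 (fun ξ => omegaKG 4 ξ ^ (-(2 * κ)) * Real.sin (t * omegaKG 4 ξ)) x‖ ≤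
        C * (1 + |t|) ^ (-(3/2) + ε) := by
  obtain ⟨C, hC0, hC⟩ := exists_norm_integral_cube_le κ hε hε'
  have hsmall : ∀ t : ℝ, |t| < 10 → 1 ≤ (4 * C + 121) * (1 + |t|) ^ (-(3/2) + ε) := by
    intro t ht
    have h0 : (1:ℝ) ≤ 1 + |t| := by linarith [abs_nonneg t]
    have h1 : (1 + |t|) ^ (-2 : ℝ) ≤ (1 + |t|) ^ (-(3/2) + ε) :=
      Real.rpow_le_rpow_of_exponent_le h0 (by linarith)
    have h2 : 1 / 121 ≤ (1 + |t|) ^ (-2 : ℝ) := by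
      rw [Real.rpow_neg (by linarith), one_div]
      refine inv_anti₀ (by positivity) ?_
      norm_num
      nlinarith
    have h3 : 0 ≤ 4 * C * (1 + |t|) ^ (-(3/2) + ε) := by positivity
    linarith
  have hpow : ∀ ξ, |omegaKG 4 ξ ^ (-(2 * κ))| ≤ 1 := fun ξ => by
    have h1 := one_le_omegaKG 4 ξ
    rw [abs_of_nonneg (by positivity)]
    exact Real.rpow_le_one_of_one_le_of_nonpos h1 (by linarith)
  have hlarge : ∀ t : ℝ, 10 ≤ |t| →
      C * |t| ^ (-(3/2) + ε) ≤ (4 * C + 121) * (1 + |t|) ^ (-(3/2) + ε) := by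
    intro t ht
    have h1 : |t| ^ (-(3/2) + ε) ≤ ((1 + |t|) / 2) ^ (-(3/2) + ε) :=
      Real.rpow_le_rpow_of_nonpos (by linarith) (by linarith) (by linarith)
    rw [Real.div_rpow (by linarith) (by norm_num)] at h1
    have h2 : (1/4 : ℝ) ≤ 2 ^ (-(3/2) + ε) := by
      calc (1/4 : ℝ) = 2 ^ (-2 : ℝ) := by
            rw [Real.rpow_neg (by norm_num)]; norm_num
        _ ≤ 2 ^ (-(3/2) + ε) := Real.rpow_le_rpow_of_exponent_le (by norm_num) (by linarith)
    have h0 : 0 ≤ (1 + |t|) ^ (-(3/2) + ε) := by positivity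
    have h3 : (1 + |t|) ^ (-(3/2) + ε) / 2 ^ (-(3/2) + ε) ≤ 4 * (1 + |t|) ^ (-(3/2) + ε) := by
      rw [div_le_iff₀ (by positivity)]
      nlinarith
    calc C * |t| ^ (-(3/2) + ε) ≤ C * (4 * (1 + |t|) ^ (-(3/2) + ε)) := by
          gcongr; exact h1.trans h3
      _ ≤ _ := by nlinarith
  have hcpow := continuous_omegaKG_rpow 4 (-(2 * κ))
  have hcω := continuous_omegaKG 4
  set E : (Fin 4 → ℤ) → ℝ → (Fin 4 → ℝ) → ℂ := fun x t ξ =>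
    Complex.exp (Complex.I * ((∑ j, (x j : ℝ) * ξ j : ℝ) : ℂ)) *
        (((omegaKG 4 ξ ^ (-(2 * κ)) : ℝ) : ℂ) *
          Complex.exp (Complex.I * ((t * omegaKG 4 ξ : ℝ) : ℂ))) with hE
  have hEi : ∀ x t, Integrable (E x t) (volume.restrict (cube 4)) := fun x t =>
    integrable_cube_of_continuous (by simp only [hE]; fun_prop)
  have hpi := Real.pi_gt_three
  have hfac : ∀ z : ℂ, ‖((((2 * Real.pi) ^ 4)⁻¹ : ℝ) : ℂ) * z‖ ≤ ‖z‖ := fun z => by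
    rw [norm_mul, Complex.norm_real, norm_inv, norm_pow, Real.norm_of_nonneg (by positivity)]
    refine mul_le_of_le_one_left (norm_nonneg _) (inv_le_one_of_one_le₀ ?_)
    exact one_le_pow₀ (by linarith)
  refine ⟨4 * C + 121, by positivity, fun t x => ⟨?_, ?_⟩⟩
  · rcases lt_or_ge |t| 10 with ht | ht
    · refine (norm_multKernel_le (M := 1) (fun ξ => ?_) x).trans (hsmall t ht)
      rw [abs_mul]
      exact mul_le_one₀ (hpow ξ) (abs_nonneg _) (Real.abs_cos_le_one _)
    · refine le_trans ?_ (hlarge t ht)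
      have h1 := hC t x ht
      have h2 := hC (-t) x (by rwa [abs_neg])
      rw [abs_neg] at h2
      refine (hfac _).trans ?_
      have : (∫ ξ in cube 4, Complex.exp (Complex.I * ((∑ j, (x j : ℝ) * ξ j : ℝ) : ℂ)) *
          ((omegaKG 4 ξ ^ (-(2 * κ)) * Real.cos (t * omegaKG 4 ξ) : ℝ) : ℂ)) =
          (1 / 2 : ℂ) * ((∫ ξ in cube 4, E x t ξ) + ∫ ξ in cube 4, E x (-t) ξ) := by
        rw [← integral_add (hEi x t) (hEi x (-t)), ← integral_const_mul]
        congr 1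
        ext ξ
        simp only [hE]
        push_cast
        rw [Complex.cos]
        ring_nf
      rw [this, norm_mul]
      refine (mul_le_mul_of_nonneg_left ((norm_add_le _ _).trans (add_le_add h1 h2))
        (norm_nonneg _)).trans ?_
      norm_num
      linarith
  · rcases lt_or_ge |t| 10 with ht | ht
    · refine (norm_multKernel_le (M := 1) (fun ξ => ?_) x).trans (hsmall t ht)
      rw [abs_mul]
      exact mul_le_one₀ (hpow ξ) (abs_nonneg _) (Real.abs_sin_le_one _)
    · refine le_trans ?_ (hlarge t ht)
      have h1 := hC t x ht
      have h2 := hC (-t) x (by rwa [abs_neg])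
      rw [abs_neg] at h2
      refine (hfac _).trans ?_
      have : (∫ ξ in cube 4, Complex.exp (Complex.I * ((∑ j, (x j : ℝ) * ξ j : ℝ) : ℂ)) *
          ((omegaKG 4 ξ ^ (-(2 * κ)) * Real.sin (t * omegaKG 4 ξ) : ℝ) : ℂ)) =
          (Complex.I / 2 : ℂ) * ((∫ ξ in cube 4, E x (-t) ξ) - ∫ ξ in cube 4, E x t ξ) := by
        rw [← integral_sub (hEi x (-t)) (hEi x t), ← integral_const_mul]
        congr 1
        ext ξ
        simp only [hE]
        push_cast
        rw [Complex.sin]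
        ring_nf
      rw [this, norm_mul]
      refine (mul_le_mul_of_nonneg_left ((norm_sub_le _ _).trans (add_le_add h2 h1))
        (norm_nonneg _)).trans ?_
      norm_num
      linarith

/-- The finite sections of the kernel `k` define bilinear forms on `ℓ^p × ℓ^p` bounded by `B`. -/
def FormBound {α : Type*} (k : α → α → ℂ) (p B : ℝ) : Prop :=
  ∀ (S : Finset α) (f g : α → ℂ), ‖∑ x ∈ S, ∑ y ∈ S, k x y * f y * g x‖ ≤
    B * (∑ x ∈ S, ‖f x‖ ^ p) ^ (1 / p) * (∑ x ∈ S, ‖g x‖ ^ p) ^ (1 / p)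

/-- The analytic family through `w` of modulus `‖w‖ ^ (p * (1 - z / 2))`. -/
def powFamily (p : ℝ) (w z : ℂ) : ℂ :=
  w / (‖w‖ : ℂ) * Complex.exp (((p : ℂ) * (1 - z / 2)) * ((Real.log ‖w‖ : ℝ) : ℂ))

lemma differentiable_powFamily (p : ℝ) (w : ℂ) : Differentiable ℂ (powFamily p w) := by
  unfold powFamily; fun_prop

lemma norm_powFamily {p : ℝ} (hp : 0 < p) (w : ℂ) {z : ℂ} (hz : z.re ≤ 1) :
    ‖powFamily p w z‖ = ‖w‖ ^ (p * (1 - z.re / 2)) := by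
  rcases eq_or_ne w 0 with rfl | hw
  · rw [norm_zero, Real.zero_rpow (by nlinarith)]; simp [powFamily]
  · have : 0 < ‖w‖ := norm_pos_iff.2 hw
    rw [powFamily, norm_mul, norm_div, Complex.norm_exp, Complex.norm_real, norm_norm,
      div_self this.ne', one_mul, Real.rpow_def_of_pos this]
    congr 1
    simp [Complex.mul_re, Complex.sub_re]
    ring

lemma powFamily_self {p : ℝ} (hp : 0 < p) (w : ℂ) : powFamily p w ((2 - 2 / p : ℝ) : ℂ) = w := by
  rcases eq_or_ne w 0 with rfl | hw
  · simp [powFamily]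
  · have : 0 < ‖w‖ := norm_pos_iff.2 hw
    have h : ((p : ℂ) * (1 - ((2 - 2 / p : ℝ) : ℂ) / 2)) = 1 := by
      have : (p : ℂ) ≠ 0 := by exact_mod_cast hp.ne'
      push_cast; field_simp; ring
    rw [powFamily, h, one_mul, ← Complex.ofReal_exp, Real.exp_log this, div_mul_cancel₀]
    exact_mod_cast this.ne'

lemma norm_powFamily_le {p : ℝ} (hp : 0 < p) (w : ℂ) {z : ℂ} (h0 : 0 ≤ z.re) (h1 : z.re ≤ 1) :
    ‖powFamily p w z‖ ≤ (1 + ‖w‖) ^ p := by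
  rw [norm_powFamily hp w h1]
  have := norm_nonneg w
  calc ‖w‖ ^ (p * (1 - z.re / 2)) ≤ (1 + ‖w‖) ^ (p * (1 - z.re / 2)) :=
        Real.rpow_le_rpow this (by linarith) (by nlinarith)
    _ ≤ (1 + ‖w‖) ^ p := Real.rpow_le_rpow_of_exponent_le (by linarith) (by nlinarith)

/-- Interpolation between `ℓ^1` and `ℓ^2` for bilinear forms. -/
lemma formBound_interp {α : Type*} {k : α → α → ℂ} {D M p : ℝ} (hD : ∀ x y, ‖k x y‖ ≤ D)
    (hD0 : 0 ≤ D) (hM0 : 0 ≤ M)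
    (hM : FormBound k 2 M) (hp1 : 1 ≤ p) (hp2 : p ≤ 2) :
    FormBound k p (D ^ (2 / p - 1) * M ^ (2 - 2 / p)) := by
  intro S f g
  have hp : 0 < p := by linarith
  set Φ := ∑ x ∈ S, ‖f x‖ ^ p with hΦ
  set Γ := ∑ x ∈ S, ‖g x‖ ^ p with hΓ
  have hΦ0 : 0 ≤ Φ := Finset.sum_nonneg fun _ _ => by positivity
  have hΓ0 : 0 ≤ Γ := Finset.sum_nonneg fun _ _ => by positivity
  set H : ℂ → ℂ := fun z => ∑ x ∈ S, ∑ y ∈ S, k x y * powFamily p (f y) z * powFamily p (g x) z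
    with hH
  have hdiff : Differentiable ℂ H := by
    have := differentiable_powFamily p
    rw [hH]; fun_prop
  have hθ0 : 0 ≤ 2 - 2 / p := by
    have : 2 / p ≤ 2 := by rw [div_le_iff₀ hp]; linarith
    linarith
  have hθ1 : 2 - 2 / p ≤ 1 := by
    have : 1 ≤ 2 / p := by rw [le_div_iff₀ hp]; linarith
    linarith
  have key := Complex.HadamardThreeLines.norm_le_interp_of_mem_verticalClosedStrip₀₁' H
    (z := ((2 - 2 / p : ℝ) : ℂ)) (a := D * Φ * Γ) (b := M * Φ ^ (1 / 2 : ℝ) * Γ ^ (1 / 2 : ℝ))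
    (by exact ⟨by simpa using hθ0, by simpa using hθ1⟩)
    hdiff.diffContOnCl ?_ ?_ ?_
  · simp only [hH, powFamily_self hp, Complex.ofReal_re] at key
    refine key.trans (le_of_eq ?_)
    rw [Real.mul_rpow (by positivity) hΓ0, Real.mul_rpow hD0 hΦ0,
      Real.mul_rpow (by positivity) (by positivity), Real.mul_rpow hM0 (by positivity),
      ← Real.rpow_mul hΦ0, ← Real.rpow_mul hΓ0]
    have e : ∀ X : ℝ, 0 ≤ X → X ^ (1 / p) = X ^ (1 - (2 - 2 / p)) * X ^ (1 / 2 * (2 - 2 / p)) := by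
      intro X hX
      rw [← Real.rpow_add_of_nonneg hX (by linarith) (by linarith)]
      congr 1; ring
    rw [e Φ hΦ0, e Γ hΓ0, show 1 - (2 - 2 / p) = 2 / p - 1 by ring]
    ring
  · refine ⟨∑ x ∈ S, ∑ y ∈ S, D * (1 + ‖f y‖) ^ p * (1 + ‖g x‖) ^ p, ?_⟩
    rintro _ ⟨z, ⟨hz0, hz1⟩, rfl⟩
    refine (norm_sum_le _ _).trans (Finset.sum_le_sum fun x _ => (norm_sum_le _ _).trans
      (Finset.sum_le_sum fun y _ => ?_))
    rw [norm_mul, norm_mul]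
    gcongr
    · exact hD x y
    · exact norm_powFamily_le hp _ hz0 hz1
    · exact norm_powFamily_le hp _ hz0 hz1
  · intro z hz
    have hz : z.re = 0 := hz
    have e : ∀ w, ‖powFamily p w z‖ = ‖w‖ ^ p := fun w => by
      rw [norm_powFamily hp w (by linarith), hz]; simp
    calc ‖H z‖ ≤ ∑ x ∈ S, ∑ y ∈ S, D * ‖f y‖ ^ p * ‖g x‖ ^ p := by
          refine (norm_sum_le _ _).trans (Finset.sum_le_sum fun x _ => (norm_sum_le _ _).trans
            (Finset.sum_le_sum fun y _ => ?_))
          rw [norm_mul, norm_mul, e, e]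
          gcongr
          exact hD x y
      _ = D * Φ * Γ := by
          simp_rw [hΦ, hΓ, Finset.mul_sum, Finset.sum_mul]
  · intro z hz
    have hz : z.re = 1 := hz
    have e : ∀ w, ‖powFamily p w z‖ ^ (2 : ℝ) = ‖w‖ ^ p := fun w => by
      rw [norm_powFamily hp w hz.le, hz, ← Real.rpow_mul (norm_nonneg _)]
      congr 1; ring
    have := hM S (fun x => powFamily p (f x) z) (fun x => powFamily p (g x) z)
    simp only [e] at this
    exact this

/-- The `ℓ^p` norm of an `ℝ≥0∞`-valued function, for a real exponent `p`. -/
def lpN {α : Type*} (p : ℝ) (f : α → ℝ≥0∞) : ℝ≥0∞ := (∑' x, f x ^ p) ^ (1 / p)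

section lpN
variable {α : Type*} {p r : ℝ} {f g : α → ℝ≥0∞}

lemma lpN_rpow (hp : 0 < p) (f : α → ℝ≥0∞) : lpN p f ^ p = ∑' x, f x ^ p := by
  rw [lpN, ← ENNReal.rpow_mul, one_div_mul_cancel hp.ne', ENNReal.rpow_one]

lemma lpN_mono (hp : 0 < p) (h : ∀ x, f x ≤ g x) : lpN p f ≤ lpN p g := by
  refine ENNReal.rpow_le_rpow (ENNReal.tsum_le_tsum fun x => ?_) (by positivity)
  exact ENNReal.rpow_le_rpow (h x) hp.le

lemma le_lpN (hp : 0 < p) (f : α → ℝ≥0∞) (x : α) : f x ≤ lpN p f := by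
  rw [← ENNReal.rpow_le_rpow_iff hp, lpN_rpow hp]
  exact ENNReal.le_tsum x

lemma lpN_le_iff (hp : 0 < p) {B : ℝ≥0∞} :
    lpN p f ≤ B ↔ ∀ S : Finset α, ∑ x ∈ S, f x ^ p ≤ B ^ p := by
  rw [← ENNReal.rpow_le_rpow_iff hp, lpN_rpow hp, ENNReal.tsum_eq_iSup_sum, iSup_le_iff]

lemma lpN_anti (hp : 0 < p) (hpr : p ≤ r) (f : α → ℝ≥0∞) : lpN r f ≤ lpN p f := by
  rcases eq_or_ne (lpN p f) ∞ with h | h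
  · simp [h]
  have hr : 0 < r := hp.trans_le hpr
  rw [← ENNReal.rpow_le_rpow_iff hr, lpN_rpow hr]
  have e : ∀ u : ℝ≥0∞, u ^ r = u ^ p * u ^ (r - p) := fun u => by
    rw [← ENNReal.rpow_add_of_nonneg _ _ hp.le (by linarith)]; congr 1; ring
  calc ∑' x, f x ^ r = ∑' x, f x ^ p * f x ^ (r - p) := by simp_rw [← e]
    _ ≤ ∑' x, f x ^ p * lpN p f ^ (r - p) := by
        gcongr with x
        · exact le_lpN hp f x
    _ = lpN p f ^ r := by rw [ENNReal.tsum_mul_right, ← lpN_rpow hp, ← e]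

lemma tsum_mul_le_lpN (h : p.HolderConjugate r) (f g : α → ℝ≥0∞) :
    ∑' x, f x * g x ≤ lpN p f * lpN r g := by
  let _ : MeasurableSpace α := ⊤
  have := ENNReal.lintegral_mul_le_Lp_mul_Lq (μ := Measure.count) h (f := f) (g := g)
    (Measurable.of_discrete).aemeasurable (Measurable.of_discrete).aemeasurable
  simpa [lintegral_count, lpN] using this

lemma lpN_const_mul (hp : 0 < p) (a : ℝ≥0∞) (f : α → ℝ≥0∞) :
    lpN p (fun x => a * f x) = a * lpN p f := by
  simp_rw [lpN, ENNReal.mul_rpow_of_nonneg _ _ hp.le]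
  rw [ENNReal.tsum_mul_left, ENNReal.mul_rpow_of_nonneg _ _ (by positivity), ← ENNReal.rpow_mul,
    mul_one_div_cancel hp.ne', ENNReal.rpow_one]

lemma measurable_lpN [Countable α] {β : Type*} [MeasurableSpace β] {F : β → α → ℝ≥0∞}
    (hF : ∀ x, Measurable fun s => F s x) (p : ℝ) : Measurable fun s => lpN p (F s) := by
  unfold lpN
  have : Measurable fun s => ∑' x, F s x ^ p :=
    Measurable.tsum fun x => (hF x).pow_const p
  exact this.pow_const _

lemma lpN_add_le (hp : 1 ≤ p) (f g : α → ℝ≥0∞) :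
    lpN p (fun x => f x + g x) ≤ lpN p f + lpN p g := by
  let _ : MeasurableSpace α := ⊤
  have := ENNReal.lintegral_Lp_add_le (μ := Measure.count) (f := f) (g := g) (p := p)
    (Measurable.of_discrete).aemeasurable (Measurable.of_discrete).aemeasurable hp
  simpa [lintegral_count, lpN] using this

lemma eLpNorm_count_eq_lpN {α : Type*} [MeasurableSpace α] [MeasurableSingletonClass α]
    (hp : 0 < p) (f : α → ℂ) :
    eLpNorm f (ENNReal.ofReal p) Measure.count = lpN p fun x => ‖f x‖ₑ := by
  rw [eLpNorm_eq_lintegral_rpow_enorm_toReal (by simpa using hp) ENNReal.ofReal_ne_top,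
    lintegral_count, ENNReal.toReal_ofReal hp.le, lpN]

lemma sum_norm_rpow_le (hp : 0 < p) {f : α → ℂ} (hf : lpN p (fun x => ‖f x‖ₑ) ≠ ∞)
    (S : Finset α) : (∑ x ∈ S, ‖f x‖ ^ p) ^ (1 / p) ≤ (lpN p fun x => ‖f x‖ₑ).toReal := by
  have h1 := (lpN_le_iff (f := fun x => ‖f x‖ₑ) hp).1 le_rfl S
  have h0 : 0 ≤ ∑ x ∈ S, ‖f x‖ ^ p := Finset.sum_nonneg fun _ _ => by positivity
  rw [one_div, Real.rpow_inv_le_iff_of_pos h0 ENNReal.toReal_nonneg hp]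
  rw [ENNReal.toReal_rpow, ← ENNReal.ofReal_le_iff_le_toReal
    (ENNReal.rpow_ne_top_of_nonneg hp.le hf), ENNReal.ofReal_sum_of_nonneg
    (fun _ _ => by positivity)]
  refine le_trans (le_of_eq (Finset.sum_congr rfl fun x _ => ?_)) h1
  rw [← ENNReal.ofReal_rpow_of_nonneg (norm_nonneg _) hp.le, ofReal_norm]

lemma summable_norm_rpow (hp : 0 < p) {f : α → ℂ} (hf : lpN p (fun x => ‖f x‖ₑ) ≠ ∞) :
    Summable fun x => ‖f x‖ ^ p := by
  refine summable_of_sum_le (c := (lpN p fun x => ‖f x‖ₑ).toReal ^ p) (fun _ => by positivity)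
    fun S => ?_
  have h0 : 0 ≤ ∑ x ∈ S, ‖f x‖ ^ p := Finset.sum_nonneg fun _ _ => by positivity
  have := sum_norm_rpow_le hp hf S
  rwa [one_div, Real.rpow_inv_le_iff_of_pos h0 ENNReal.toReal_nonneg hp] at this

lemma lpN_le_of_sum_norm_rpow_le (hp : 0 < p) {f : α → ℂ} {B : ℝ} (hB : 0 ≤ B)
    (h : ∀ S : Finset α, (∑ x ∈ S, ‖f x‖ ^ p) ^ (1 / p) ≤ B) :
    lpN p (fun x => ‖f x‖ₑ) ≤ ENNReal.ofReal B := by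
  rw [lpN_le_iff hp]
  intro S
  have h0 : 0 ≤ ∑ x ∈ S, ‖f x‖ ^ p := Finset.sum_nonneg fun _ _ => by positivity
  have := h S
  rw [one_div, Real.rpow_inv_le_iff_of_pos h0 hB hp] at this
  rw [ENNReal.ofReal_rpow_of_nonneg hB hp.le]
  refine le_trans (le_of_eq ?_) (ENNReal.ofReal_le_ofReal this)
  rw [ENNReal.ofReal_sum_of_nonneg (fun _ _ => by positivity)]
  refine Finset.sum_congr rfl fun x _ => ?_
  rw [← ENNReal.ofReal_rpow_of_nonneg (norm_nonneg _) hp.le, ofReal_norm]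

lemma summable_mul_of_lpN (h : p.HolderConjugate r) {f g : α → ℂ}
    (hf : lpN p (fun x => ‖f x‖ₑ) ≠ ∞) (hg : lpN r (fun x => ‖g x‖ₑ) ≠ ∞) :
    Summable fun x => f x * g x := by
  refine Summable.of_norm ?_
  simp_rw [norm_mul]
  exact (Real.summable_and_inner_le_Lp_mul_Lq_tsum_of_nonneg h (fun _ => norm_nonneg _)
    (fun _ => norm_nonneg _) (summable_norm_rpow h.pos hf)
    (summable_norm_rpow h.symm.pos hg)).1

end lpN

/-- The action of an infinite matrix. -/
def matAct {α : Type*} (k : α → α → ℂ) (f : α → ℂ) (x : α) : ℂ := ∑' y, k x y * f y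

/-- The dual weight: `dualW r v * v = ‖v‖ ^ r`. -/
def dualW (r : ℝ) (v : ℂ) : ℂ := (starRingEnd ℂ) v * ((‖v‖ ^ (r - 2) : ℝ) : ℂ)

lemma dualW_mul_self {r : ℝ} (hr : 1 < r) (v : ℂ) : dualW r v * v = ((‖v‖ ^ r : ℝ) : ℂ) := by
  rcases eq_or_ne v 0 with rfl | hv
  · simp [dualW, Real.zero_rpow (by linarith : r ≠ 0)]
  have h : ‖v‖ ^ r = ‖v‖ ^ 2 * ‖v‖ ^ (r - 2) := by
    rw [← Real.rpow_natCast, ← Real.rpow_add (norm_pos_iff.2 hv)]; congr 1; push_cast; ring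
  rw [dualW, h, mul_right_comm, mul_comm _ v, Complex.mul_conj, Complex.normSq_eq_norm_sq]
  push_cast; ring

lemma norm_dualW {r : ℝ} (hr : 1 < r) (v : ℂ) : ‖dualW r v‖ = ‖v‖ ^ (r - 1) := by
  rcases eq_or_ne v 0 with rfl | hv
  · simp [dualW, Real.zero_rpow (by linarith : r - 1 ≠ 0)]
  rw [dualW, norm_mul, RCLike.norm_conj, Complex.norm_real, Real.norm_of_nonneg (by positivity)]
  nth_rw 1 [← Real.rpow_one ‖v‖]
  rw [← Real.rpow_add (norm_pos_iff.2 hv)]; congr 1; ring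

lemma norm_dualW_rpow {p r : ℝ} (h : p.HolderConjugate r) (v : ℂ) : ‖dualW r v‖ ^ p = ‖v‖ ^ r := by
  rw [norm_dualW h.symm.lt, ← Real.rpow_mul (norm_nonneg _), h.symm.sub_one_mul_conj]

lemma FormBound.mono {α : Type*} {k : α → α → ℂ} {p B B' : ℝ} (h : FormBound k p B)
    (hB : B ≤ B') : FormBound k p B' := fun S f g => (h S f g).trans <| by
  have h0 : ∀ f : α → ℂ, 0 ≤ (∑ x ∈ S, ‖f x‖ ^ p) ^ (1 / p) := fun f =>
    Real.rpow_nonneg (Finset.sum_nonneg fun _ _ => by positivity) _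
  gcongr

lemma FormBound.lpN_row_le {α : Type*} {k : α → α → ℂ} {B : ℝ} (h : FormBound k 2 B) (hB : 0 ≤ B)
    (x : α) : lpN 2 (fun y => ‖k x y‖ₑ) ≤ ENNReal.ofReal B := by
  classical
  refine lpN_le_of_sum_norm_rpow_le two_pos hB fun S => ?_
  set Q := ∑ y ∈ insert x S, ‖k x y‖ ^ (2 : ℝ) with hQ
  have hQ0 : 0 ≤ Q := Finset.sum_nonneg fun _ _ => by positivity
  have h1 := h (insert x S) (fun y => (starRingEnd ℂ) (k x y)) (Pi.single x 1)
  have e1 : ∑ x_1 ∈ insert x S, ∑ y ∈ insert x S, k x_1 y * (starRingEnd ℂ) (k x y) *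
      (Pi.single x 1 : α → ℂ) x_1 = ((Q : ℝ) : ℂ) := by
    rw [Finset.sum_eq_single_of_mem x (Finset.mem_insert_self _ _)
      (fun b _ hb => by simp [hb])]
    simp only [Pi.single_eq_same, mul_one, Complex.mul_conj, Complex.normSq_eq_norm_sq, hQ]
    push_cast
    simp
  have e2 : ∑ x_1 ∈ insert x S, ‖(Pi.single x 1 : α → ℂ) x_1‖ ^ (2 : ℝ) = 1 := by
    rw [Finset.sum_eq_single_of_mem x (Finset.mem_insert_self _ _)
      (fun b _ hb => by simp [hb])]
    simp
  rw [e1, e2, Complex.norm_real, Real.norm_of_nonneg hQ0] at h1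
  simp only [RCLike.norm_conj, ← hQ, Real.one_rpow, mul_one] at h1
  have h2 : Q ^ (1 / 2 : ℝ) ≤ B := by
    rcases hQ0.eq_or_lt with h0 | h0
    · rw [← h0, Real.zero_rpow (by norm_num)]; exact hB
    · have : Q = Q ^ (1 / 2 : ℝ) * Q ^ (1 / 2 : ℝ) := by
        rw [← Real.rpow_add h0]; norm_num
      nth_rw 1 [this] at h1
      exact le_of_mul_le_mul_right h1 (by positivity)
  refine le_trans ?_ h2
  refine Real.rpow_le_rpow (Finset.sum_nonneg fun _ _ => by positivity) ?_ (by norm_num)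
  exact Finset.sum_le_sum_of_subset_of_nonneg (Finset.subset_insert _ _)
    fun _ _ _ => by positivity

lemma FormBound.lpN_matAct_le {α : Type*} {k : α → α → ℂ} {p r A B : ℝ} (hk : FormBound k 2 A)
    (hA : 0 ≤ A) (h : FormBound k p B) (hB : 0 ≤ B) (hpr : p.HolderConjugate r) (hp2 : p ≤ 2)
    {f : α → ℂ} (hf : lpN p (fun x => ‖f x‖ₑ) ≠ ∞) :
    lpN r (fun x => ‖matAct k f x‖ₑ) ≤ ENNReal.ofReal B * lpN p (fun x => ‖f x‖ₑ) := by
  classical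
  set N := (lpN p fun x => ‖f x‖ₑ).toReal with hN
  have hf2 : lpN 2 (fun x => ‖f x‖ₑ) ≠ ∞ := ne_top_of_le_ne_top hf (lpN_anti hpr.pos hp2 _)
  have hsum : ∀ x, Summable fun y => k x y * f y := fun x =>
    summable_mul_of_lpN Real.HolderConjugate.two_two
      (ne_top_of_le_ne_top ENNReal.ofReal_ne_top (hk.lpN_row_le hA x)) hf2
  rw [← ENNReal.ofReal_toReal hf, ← ENNReal.ofReal_mul hB, ← hN]
  refine lpN_le_of_sum_norm_rpow_le hpr.symm.pos (by positivity) fun T => ?_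
  set V := matAct k f with hV
  set Q := ∑ x ∈ T, ‖V x‖ ^ r with hQ
  have hQ0 : 0 ≤ Q := Finset.sum_nonneg fun _ _ => by positivity
  set c : α → ℂ := fun x => if x ∈ T then dualW r (V x) else 0 with hc
  have hlim : Filter.Tendsto (fun S : Finset α => ∑ x ∈ T, (∑ y ∈ S, k x y * f y) * c x)
      Filter.atTop (nhds (∑ x ∈ T, V x * c x)) :=
    tendsto_finsetSum _ fun x _ => ((hsum x).hasSum).mul_const _
  have hval : ∑ x ∈ T, V x * c x = ((Q : ℝ) : ℂ) := by
    rw [hQ]; push_cast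
    refine Finset.sum_congr rfl fun x hx => ?_
    simp only [hc, hx, if_true]
    rw [mul_comm, dualW_mul_self hpr.symm.lt]
  have hbd : ∀ S : Finset α, T ⊆ S → ‖∑ x ∈ T, (∑ y ∈ S, k x y * f y) * c x‖ ≤
      B * N * Q ^ (1 / p) := by
    intro S hTS
    have e1 : ∑ x ∈ T, (∑ y ∈ S, k x y * f y) * c x =
        ∑ x ∈ S, ∑ y ∈ S, k x y * f y * c x := by
      simp_rw [← Finset.sum_mul]
      exact Finset.sum_subset hTS fun x _ hx => by simp [hc, hx]
    have e2 : ∑ x ∈ S, ‖c x‖ ^ p = Q := by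
      rw [hQ, ← Finset.sum_subset hTS fun x _ hx => by
        simp [hc, hx, Real.zero_rpow hpr.ne_zero]]
      refine Finset.sum_congr rfl fun x hx => ?_
      simp only [hc, hx, if_true]
      exact norm_dualW_rpow hpr _
    rw [e1]
    refine (h S f c).trans ?_
    rw [e2]
    gcongr
    exact sum_norm_rpow_le hpr.pos hf S
  have h1 : Q ≤ B * N * Q ^ (1 / p) := by
    have := le_of_tendsto hlim.norm (Filter.eventually_atTop.2 ⟨T, hbd⟩)
    rwa [hval, Complex.norm_real, Real.norm_of_nonneg hQ0] at this
  rcases hQ0.eq_or_lt with h0 | h0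
  · rw [← h0, Real.zero_rpow hpr.symm.one_div_ne_zero]; positivity
  · have : Q = Q ^ (1 / r) * Q ^ (1 / p) := by
      rw [← Real.rpow_add h0, one_div, one_div, add_comm, hpr.inv_add_inv_eq_one, Real.rpow_one]
    nth_rw 1 [this] at h1
    exact le_of_mul_le_mul_right h1 (by positivity)

/-- The normalised Lebesgue measure on the torus. -/
def torusM : Measure (Fin 4 → ℝ) :=
  ENNReal.ofReal ((2 * π) ^ 4)⁻¹ • (volume : Measure (Fin 4 → ℝ)).restrict (cube 4)

/-- The characters of the torus. -/
def chr (x : Fin 4 → ℤ) (ξ : Fin 4 → ℝ) : ℂ :=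
  Complex.exp (Complex.I * ((∑ j, (x j : ℝ) * ξ j : ℝ) : ℂ))

/-- The matrix of the Fourier multiplier with symbol `m`. -/
def mKer (m : (Fin 4 → ℝ) → ℝ) (x y : Fin 4 → ℤ) : ℂ := multKernel 4 m (x - y)

instance isProbabilityMeasure_torusM : IsProbabilityMeasure torusM := by
  constructor
  have h := volume_real_cube 4
  have h1 : ((volume : Measure (Fin 4 → ℝ)).restrict (cube 4)) Set.univ =
      ENNReal.ofReal ((2 * π) ^ 4) := by
    rw [← h, ENNReal.ofReal_toReal (measure_ne_top _ _)]
  rw [torusM, Measure.smul_apply, h1, smul_eq_mul, ← ENNReal.ofReal_mul (by positivity),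
    inv_mul_cancel₀ (by positivity), ENNReal.ofReal_one]

lemma multKernel_eq_integral (m : (Fin 4 → ℝ) → ℝ) (x : Fin 4 → ℤ) :
    multKernel 4 m x = ∫ ξ, chr x ξ * (m ξ : ℂ) ∂torusM := by
  rw [torusM, integral_smul_measure, multKernel, ENNReal.toReal_ofReal (by positivity),
    Complex.real_smul]
  rfl

@[fun_prop]
lemma continuous_chr (x : Fin 4 → ℤ) : Continuous (chr x) := by unfold chr; fun_prop

lemma norm_chr (x : Fin 4 → ℤ) (ξ : Fin 4 → ℝ) : ‖chr x ξ‖ = 1 := norm_exp_I_mul_ofReal _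

lemma chr_sub (x y : Fin 4 → ℤ) (ξ : Fin 4 → ℝ) :
    chr (x - y) ξ = chr x ξ * (starRingEnd ℂ) (chr y ξ) := by
  rw [chr, chr, chr, ← Complex.exp_conj, ← Complex.exp_add, map_mul, Complex.conj_I,
    Complex.conj_ofReal]
  congr 1
  simp [sub_mul, Finset.sum_sub_distrib]
  ring

lemma integral_exp_int_Icc (n : ℤ) : ∫ θ in Set.Icc 0 (2 * π),
    Complex.exp (Complex.I * (((n : ℝ) * θ : ℝ) : ℂ)) = if n = 0 then ((2 * π : ℝ) : ℂ) else 0 := by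
  rw [integral_Icc_eq_integral_Ioc, ← intervalIntegral.integral_of_le (by positivity)]
  split_ifs with h
  · simp [h]
  · have hn : Complex.I * (n : ℂ) ≠ 0 := mul_ne_zero Complex.I_ne_zero (by exact_mod_cast h)
    have : ∀ θ : ℝ, Complex.exp (Complex.I * (((n : ℝ) * θ : ℝ) : ℂ)) =
        Complex.exp (Complex.I * (n : ℂ) * (θ : ℂ)) := fun θ => by push_cast; ring_nf
    simp_rw [this]
    rw [integral_exp_mul_complex hn]
    have e : Complex.I * (n : ℂ) * ((2 * π : ℝ) : ℂ) = (n : ℂ) * (2 * π * Complex.I) := by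
      push_cast; ring
    rw [e, Complex.exp_int_mul_two_pi_mul_I]
    simp

lemma integral_chr (x : Fin 4 → ℤ) : ∫ ξ, chr x ξ ∂torusM = if x = 0 then 1 else 0 := by
  have h : ∀ ξ, chr x ξ = ∏ j, Complex.exp (Complex.I * (((x j : ℝ) * ξ j : ℝ) : ℂ)) := fun ξ => by
    rw [chr, ← Complex.exp_sum, ← Finset.mul_sum]; push_cast; rfl
  rw [torusM, integral_smul_measure, ENNReal.toReal_ofReal (by positivity), Complex.real_smul,
    volume_restrict_cube]
  simp_rw [h]
  rw [integral_fintype_prod_eq_prod (f := fun j (θ : ℝ) =>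
    Complex.exp (Complex.I * (((x j : ℝ) * θ : ℝ) : ℂ)))]
  simp_rw [integral_exp_int_Icc]
  split_ifs with h0
  · subst h0
    simp
  · obtain ⟨j, hj⟩ := Function.ne_iff.1 h0
    rw [Finset.prod_eq_zero (Finset.mem_univ j) (by simpa using hj), mul_zero]

/-- Trigonometric polynomials. -/
def trigP (S : Finset (Fin 4 → ℤ)) (f : (Fin 4 → ℤ) → ℂ) (ξ : Fin 4 → ℝ) : ℂ :=
  ∑ x ∈ S, f x * chr x ξ

@[fun_prop]
lemma continuous_trigP (S : Finset (Fin 4 → ℤ)) (f : (Fin 4 → ℤ) → ℂ) :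
    Continuous (trigP S f) := by unfold trigP; fun_prop

lemma norm_trigP_le (S : Finset (Fin 4 → ℤ)) (f : (Fin 4 → ℤ) → ℂ) (ξ : Fin 4 → ℝ) :
    ‖trigP S f ξ‖ ≤ ∑ x ∈ S, ‖f x‖ :=
  (norm_sum_le _ _).trans (Finset.sum_le_sum fun x _ => by rw [norm_mul, norm_chr, mul_one])

lemma integrable_torusM_of_continuous {f : (Fin 4 → ℝ) → ℂ} (hf : Continuous f) :
    Integrable f torusM :=
  (integrable_cube_of_continuous hf).smul_measure ENNReal.ofReal_ne_top

lemma integral_trigP_mul (S : Finset (Fin 4 → ℤ)) (f g : (Fin 4 → ℤ) → ℂ) {m : (Fin 4 → ℝ) → ℝ}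
    (hm : Continuous m) :
    ∫ ξ, (m ξ : ℂ) * (trigP S g ξ * (starRingEnd ℂ) (trigP S f ξ)) ∂torusM =
      ∑ x ∈ S, ∑ y ∈ S, mKer m x y * (starRingEnd ℂ) (f y) * g x := by
  have h : ∀ ξ, (m ξ : ℂ) * (trigP S g ξ * (starRingEnd ℂ) (trigP S f ξ)) =
      ∑ x ∈ S, ∑ y ∈ S, (chr (x - y) ξ * (m ξ : ℂ)) * ((starRingEnd ℂ) (f y) * g x) := fun ξ => by
    rw [trigP, trigP, map_sum, Finset.sum_mul_sum, Finset.mul_sum]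
    refine Finset.sum_congr rfl fun x _ => ?_
    rw [Finset.mul_sum]
    refine Finset.sum_congr rfl fun y _ => ?_
    rw [chr_sub, map_mul]; ring
  have hi : ∀ x y : Fin 4 → ℤ, Integrable (fun ξ => (chr (x - y) ξ * (m ξ : ℂ)) *
      ((starRingEnd ℂ) (f y) * g x)) torusM := fun x y =>
    integrable_torusM_of_continuous (by fun_prop)
  simp_rw [h]
  rw [integral_finsetSum _ fun x _ => integrable_finsetSum _ fun y _ => hi x y]
  refine Finset.sum_congr rfl fun x _ => ?_
  rw [integral_finsetSum _ fun y _ => hi x y]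
  refine Finset.sum_congr rfl fun y _ => ?_
  rw [integral_mul_const, mKer, multKernel_eq_integral]
  ring

lemma integral_norm_trigP_sq (S : Finset (Fin 4 → ℤ)) (f : (Fin 4 → ℤ) → ℂ) :
    ∫ ξ, ‖trigP S f ξ‖ ^ 2 ∂torusM = ∑ x ∈ S, ‖f x‖ ^ 2 := by
  have h := integral_trigP_mul S f f (m := fun _ => 1) continuous_const
  have hK : ∀ x y, mKer (fun _ => 1) x y = if x = y then 1 else 0 := fun x y => by
    rw [mKer, multKernel_eq_integral]
    simp [integral_chr, sub_eq_zero]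
  simp only [hK, Complex.ofReal_one, one_mul, Complex.mul_conj, Complex.normSq_eq_norm_sq] at h
  rw [integral_complex_ofReal] at h
  have e : ∑ x ∈ S, ∑ y ∈ S, (if x = y then 1 else 0) * (starRingEnd ℂ) (f y) * f x =
      ((∑ x ∈ S, ‖f x‖ ^ 2 : ℝ) : ℂ) := by
    push_cast
    refine Finset.sum_congr rfl fun x hx => ?_
    rw [Finset.sum_eq_single_of_mem x hx fun y _ hy => by simp [hy.symm]]
    simp [mul_comm _ (f x), Complex.mul_conj, Complex.normSq_eq_norm_sq]
  rw [e] at h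
  exact_mod_cast h

lemma integral_mul_le_sqrt_mul_sqrt {Ω : Type*} [MeasurableSpace Ω] {μ : Measure Ω}
    [IsFiniteMeasure μ] {a b : Ω → ℝ} {A B : ℝ} (ha : AEStronglyMeasurable a μ)
    (hb : AEStronglyMeasurable b μ) (ha0 : ∀ ω, 0 ≤ a ω) (hb0 : ∀ ω, 0 ≤ b ω)
    (hA : ∀ ω, a ω ≤ A) (hB : ∀ ω, b ω ≤ B) :
    ∫ ω, a ω * b ω ∂μ ≤ √(∫ ω, a ω ^ 2 ∂μ) * √(∫ ω, b ω ^ 2 ∂μ) := by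
  have := integral_mul_le_Lp_mul_Lq_of_nonneg (μ := μ) Real.HolderConjugate.two_two
    (Filter.Eventually.of_forall ha0) (Filter.Eventually.of_forall hb0)
    (MemLp.of_bound ha A (Filter.Eventually.of_forall fun ω => by
      rw [Real.norm_of_nonneg (ha0 ω)]; exact hA ω))
    (MemLp.of_bound hb B (Filter.Eventually.of_forall fun ω => by
      rw [Real.norm_of_nonneg (hb0 ω)]; exact hB ω))
  simpa [Real.sqrt_eq_rpow] using this

lemma formBound_two {m : (Fin 4 → ℝ) → ℝ} (hm : Continuous m) {M : ℝ}
    (hM : ∀ ξ, |m ξ| ≤ M) : FormBound (mKer m) 2 M := by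
  intro S f g
  have hM0 : 0 ≤ M := (abs_nonneg _).trans (hM 0)
  set f' : (Fin 4 → ℤ) → ℂ := fun y => (starRingEnd ℂ) (f y) with hf'
  have h := integral_trigP_mul S f' g hm
  simp only [hf', Complex.conj_conj] at h
  rw [← h]
  have hn : ∀ f : (Fin 4 → ℤ) → ℂ, (∑ x ∈ S, ‖f x‖ ^ (2 : ℝ)) ^ (1 / 2 : ℝ) =
      √(∫ ξ, ‖trigP S f ξ‖ ^ 2 ∂torusM) := fun f => by
    rw [integral_norm_trigP_sq, Real.sqrt_eq_rpow]; simp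
  have hff : (∑ x ∈ S, ‖f x‖ ^ (2 : ℝ)) = ∑ x ∈ S, ‖f' x‖ ^ (2 : ℝ) := by simp [hf']
  rw [hff, hn, hn, mul_assoc, mul_comm (√ _)]
  calc _ ≤ ∫ ξ, M * (‖trigP S g ξ‖ * ‖trigP S f' ξ‖) ∂torusM := by
        refine norm_integral_le_of_norm_le ?_ (Filter.Eventually.of_forall fun ξ => ?_)
        · have := (integrable_torusM_of_continuous (f := fun ξ =>
            ((M * (‖trigP S g ξ‖ * ‖trigP S f' ξ‖) : ℝ) : ℂ)) (by fun_prop)).re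
          simpa using this
        · rw [norm_mul, norm_mul, RCLike.norm_conj, Complex.norm_real]
          gcongr
          exact hM ξ
    _ ≤ _ := by
        rw [integral_const_mul]
        gcongr
        exact integral_mul_le_sqrt_mul_sqrt (by fun_prop) (by fun_prop)
          (fun _ => norm_nonneg _) (fun _ => norm_nonneg _) (norm_trigP_le S g)
          (norm_trigP_le S f')

lemma continuous_mKer {m : ℝ → (Fin 4 → ℝ) → ℝ} (hm : Continuous (Function.uncurry m))
    (hm1 : ∀ t ξ, |m t ξ| ≤ 1) (x y : Fin 4 → ℤ) : Continuous fun t => mKer (m t) x y := by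
  simp_rw [mKer, multKernel_eq_integral]
  refine continuous_of_dominated (bound := fun _ => 1) (fun t => ?_) (fun t => ?_)
    (integrable_const _) ?_
  · have : Continuous (m t) := hm.comp (by fun_prop : Continuous fun ξ => (t, ξ))
    exact Continuous.aestronglyMeasurable (by fun_prop)
  · refine Filter.Eventually.of_forall fun ξ => ?_
    rw [norm_mul, norm_chr, one_mul, Complex.norm_real]
    exact hm1 t ξ
  · refine Filter.Eventually.of_forall fun ξ => ?_
    have : Continuous fun t => m t ξ := hm.comp (by fun_prop : Continuous fun t => (t, ξ))
    fun_prop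

@[fun_prop]
lemma measurable_dualW (r : ℝ) : Measurable (dualW r) := by
  unfold dualW
  have : Measurable fun v : ℂ => ((‖v‖ ^ (r - 2) : ℝ) : ℂ) := by fun_prop
  exact (Complex.continuous_conj.measurable).mul this

/-- The extremal function for the duality between `ℓ^p` and `ℓ^r`, normalised to have the same
norm as `V`. -/
def dualF {α : Type*} (r : ℝ) (S : Finset α) (V : α → ℂ) (x : α) : ℂ :=
  dualW r (V x) * ((((∑ x ∈ S, ‖V x‖ ^ r) ^ (1 / r)) ^ (2 - r) : ℝ) : ℂ)

lemma sum_dualF_mul {α : Type*} {r : ℝ} (hr : 1 < r) (S : Finset α) (V : α → ℂ) :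
    ∑ x ∈ S, dualF r S V x * V x = (((∑ x ∈ S, ‖V x‖ ^ r) ^ (2 / r) : ℝ) : ℂ) := by
  set Q := ∑ x ∈ S, ‖V x‖ ^ r with hQ
  have hQ0 : 0 ≤ Q := Finset.sum_nonneg fun _ _ => by positivity
  have h : ∀ x, dualF r S V x * V x = ((‖V x‖ ^ r * (Q ^ (1 / r)) ^ (2 - r) : ℝ) : ℂ) := fun x => by
    rw [dualF, mul_right_comm, dualW_mul_self hr]; push_cast; rfl
  simp_rw [h]
  rw [← Complex.ofReal_sum, ← Finset.sum_mul, ← hQ]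
  congr 1
  rcases hQ0.eq_or_lt with h0 | h0
  · rw [← h0, zero_mul, Real.zero_rpow (by positivity)]
  · rw [← Real.rpow_mul hQ0]
    nth_rw 1 [← Real.rpow_one Q]
    rw [← Real.rpow_add h0]
    congr 1
    field_simp; ring

lemma sum_norm_dualF {α : Type*} {p r : ℝ} (h : p.HolderConjugate r) (S : Finset α) (V : α → ℂ) :
    (∑ x ∈ S, ‖dualF r S V x‖ ^ p) ^ (1 / p) = (∑ x ∈ S, ‖V x‖ ^ r) ^ (1 / r) := by
  set Q := ∑ x ∈ S, ‖V x‖ ^ r with hQ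
  have hQ0 : 0 ≤ Q := Finset.sum_nonneg fun _ _ => by positivity
  have hp := h.pos
  have hr := h.symm.pos
  have e : ∀ x, ‖dualF r S V x‖ ^ p = ‖V x‖ ^ r * ((Q ^ (1 / r)) ^ (2 - r)) ^ p := fun x => by
    rw [dualF, norm_mul, Complex.norm_real, Real.norm_of_nonneg (by positivity),
      Real.mul_rpow (norm_nonneg _) (by positivity), norm_dualW_rpow h]
  simp_rw [e]
  rw [← Finset.sum_mul, ← hQ]
  rcases hQ0.eq_or_lt with h0 | h0
  · rw [← h0, zero_mul, Real.zero_rpow (by positivity), Real.zero_rpow (by positivity)]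
  · rw [← Real.rpow_mul hQ0, ← Real.rpow_mul hQ0]
    nth_rw 1 [← Real.rpow_one Q]
    rw [← Real.rpow_add h0, ← Real.rpow_mul hQ0]
    congr 1
    have := h.mul_eq_add
    field_simp
    linear_combination -this

lemma integral_integral_kernel_le {ν : Measure ℝ} [IsFiniteMeasure ν] {κ : ℝ → ℝ → ℝ}
    (hκc : Continuous (Function.uncurry κ)) (hκ0 : ∀ t s, 0 ≤ κ t s) {K : ℝ}
    (hκK : ∀ t s, κ t s ≤ K) (hκs : ∀ t s, κ t s = κ s t) {C : ℝ}
    (hκi : ∀ t, ∫ s, κ t s ∂ν ≤ C) {W : ℝ → ℝ} (hW : Measurable W) {A : ℝ}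
    (hW0 : ∀ t, 0 ≤ W t) (hWA : ∀ t, W t ≤ A) :
    Integrable (fun z : ℝ × ℝ => κ z.1 z.2 * (W z.1 * W z.2)) (ν.prod ν) ∧
    ∫ z : ℝ × ℝ, κ z.1 z.2 * (W z.1 * W z.2) ∂(ν.prod ν) ≤ C * ∫ t, W t ^ 2 ∂ν := by
  have hA0 : 0 ≤ A := (hW0 0).trans (hWA 0)
  have hK0 : 0 ≤ K := (hκ0 0 0).trans (hκK 0 0)
  have hκm : Measurable fun z : ℝ × ℝ => κ z.1 z.2 := hκc.measurable
  have hi : ∀ {g : ℝ × ℝ → ℝ}, Measurable g → (∀ z, 0 ≤ g z) → (∀ z, g z ≤ A ^ 2) →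
      Integrable (fun z : ℝ × ℝ => κ z.1 z.2 * g z) (ν.prod ν) := fun {g} hg hg0 hgA => by
    refine Integrable.of_bound (hκm.mul hg).aestronglyMeasurable (K * A ^ 2)
      (Filter.Eventually.of_forall fun z => ?_)
    rw [Real.norm_of_nonneg (mul_nonneg (hκ0 _ _) (hg0 z))]
    exact mul_le_mul (hκK _ _) (hgA z) (hg0 z) hK0
  have hi1 := hi (g := fun z => W z.1 ^ 2) (by fun_prop) (fun z => by positivity)
    (fun z => pow_le_pow_left₀ (hW0 _) (hWA _) 2)
  have hi2 := hi (g := fun z => W z.2 ^ 2) (by fun_prop) (fun z => by positivity)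
    (fun z => pow_le_pow_left₀ (hW0 _) (hWA _) 2)
  have hi3 := hi (g := fun z => W z.1 * W z.2) (by fun_prop)
    (fun z => mul_nonneg (hW0 _) (hW0 _))
    (fun z => by rw [sq]; exact mul_le_mul (hWA _) (hWA _) (hW0 _) hA0)
  refine ⟨hi3, ?_⟩
  have h1 : ∫ z : ℝ × ℝ, κ z.1 z.2 * W z.1 ^ 2 ∂(ν.prod ν) ≤ C * ∫ t, W t ^ 2 ∂ν := by
    rw [integral_prod _ hi1, ← integral_const_mul]
    simp_rw [integral_mul_const]
    refine integral_mono_of_nonneg (Filter.Eventually.of_forall fun t => ?_) ?_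
      (Filter.Eventually.of_forall fun t => ?_)
    · exact mul_nonneg (integral_nonneg fun s => hκ0 t s) (sq_nonneg _)
    · refine Integrable.const_mul (Integrable.of_bound (by fun_prop) (A ^ 2)
        (Filter.Eventually.of_forall fun t => ?_)) _
      rw [Real.norm_of_nonneg (by positivity)]
      exact pow_le_pow_left₀ (hW0 _) (hWA _) 2
    · exact mul_le_mul_of_nonneg_right (hκi t) (sq_nonneg _)
  have h2 : ∫ z : ℝ × ℝ, κ z.1 z.2 * W z.2 ^ 2 ∂(ν.prod ν) =
      ∫ z : ℝ × ℝ, κ z.1 z.2 * W z.1 ^ 2 ∂(ν.prod ν) := by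
    rw [← integral_prod_swap]
    simp only [Prod.fst_swap, Prod.snd_swap]
    simp_rw [hκs]
  have h3 : ∫ z : ℝ × ℝ, κ z.1 z.2 * (W z.1 * W z.2) ∂(ν.prod ν) ≤
      ∫ z : ℝ × ℝ, (1 / 2 : ℝ) * (κ z.1 z.2 * W z.1 ^ 2 + κ z.1 z.2 * W z.2 ^ 2) ∂(ν.prod ν) := by
    refine integral_mono hi3 ((hi1.add hi2).const_mul _) fun z => ?_
    have := mul_le_mul_of_nonneg_left (two_mul_le_add_sq (W z.1) (W z.2)) (hκ0 z.1 z.2)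
    dsimp only
    linarith
  rw [integral_const_mul, integral_add hi1 hi2, h2] at h3
  linarith

lemma le_mul_of_le_sqrt_mul_sqrt {Q C N : ℝ} (hQ : 0 ≤ Q) (hC : 0 ≤ C) (hN : 0 ≤ N)
    (h : Q ≤ √(C * Q) * √N) : Q ≤ C * N := by
  rcases hQ.eq_or_lt with h0 | h0
  · rw [← h0]; positivity
  · rw [← Real.sqrt_mul (by positivity)] at h
    have h1 : Q ^ 2 ≤ C * Q * N := by
      rw [← Real.sq_sqrt (show 0 ≤ C * Q * N by positivity)]
      exact pow_le_pow_left₀ hQ h 2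
    nlinarith

lemma tt_star_finite {m : ℝ → (Fin 4 → ℝ) → ℝ} (hm : Continuous (Function.uncurry m))
    (hm1 : ∀ t ξ, |m t ξ| ≤ 1) {κ : ℝ → ℝ → ℝ}
    (hκc : Continuous (Function.uncurry κ)) (hκ0 : ∀ t s, 0 ≤ κ t s) {K : ℝ}
    (hκK : ∀ t s, κ t s ≤ K) (hκs : ∀ t s, κ t s = κ s t) {C : ℝ} {R : ℝ}
    (hκi : ∀ t, ∫ s in Set.Icc (-R) R, κ t s ≤ C) {p r : ℝ} (hpr : p.HolderConjugate r)
    (hform : ∀ t s, FormBound (mKer fun ξ => m t ξ * m s ξ) p (κ t s))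
    (S : Finset (Fin 4 → ℤ)) (f : (Fin 4 → ℤ) → ℂ) :
    ∫ t in Set.Icc (-R) R, ((∑ x ∈ S, ‖∑ y ∈ S, mKer (m t) x y * f y‖ ^ r) ^ (1 / r)) ^ 2 ≤
      C * ∑ x ∈ S, ‖f x‖ ^ 2 := by
  set ν := (volume : Measure ℝ).restrict (Set.Icc (-R) R) with hν
  set V : ℝ → (Fin 4 → ℤ) → ℂ := fun t x => ∑ y ∈ S, mKer (m t) x y * f y with hV
  set W : ℝ → ℝ := fun t => (∑ x ∈ S, ‖V t x‖ ^ r) ^ (1 / r) with hW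
  set φ : ℝ → (Fin 4 → ℤ) → ℂ := fun t => dualF r S (V t) with hφ
  have hp := hpr.pos
  have hr := hpr.symm.pos
  have hr1 := hpr.symm.lt
  have hmt : ∀ t, Continuous (m t) := fun t => hm.comp (by fun_prop : Continuous fun ξ => (t, ξ))
  have hVm : ∀ x, Measurable fun t => V t x := fun x => by
    have := continuous_mKer hm hm1
    have : Continuous fun t => V t x := by simp only [hV]; fun_prop
    exact this.measurable
  have hWm : Measurable W := by
    have := fun x => (hVm x).norm.pow_const r
    exact (Finset.measurable_fun_sum S fun x _ => this x).pow_const _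
  have hφm : ∀ x, Measurable fun t => φ t x := fun x => by
    have h1 : Measurable fun t => dualW r (V t x) := (measurable_dualW r).comp (hVm x)
    have h2 : Measurable fun t => (((W t) ^ (2 - r) : ℝ) : ℂ) := by
      have := hWm.pow_const (2 - r)
      fun_prop
    exact h1.mul h2
  have hsum0 : ∀ t, 0 ≤ ∑ x ∈ S, ‖V t x‖ ^ r := fun t =>
    Finset.sum_nonneg fun _ _ => by positivity
  have hW0 : ∀ t, 0 ≤ W t := fun t => Real.rpow_nonneg (hsum0 t) _
  set A : ℝ := (∑ x ∈ S, (∑ y ∈ S, ‖f y‖) ^ r) ^ (1 / r) with hA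
  have hK1 : ∀ t x y, ‖mKer (m t) x y‖ ≤ 1 := fun t x y => norm_multKernel_le (hm1 t) _
  have hWA : ∀ t, W t ≤ A := fun t => by
    refine Real.rpow_le_rpow (hsum0 t) (Finset.sum_le_sum fun x _ => ?_) (by positivity)
    refine Real.rpow_le_rpow (norm_nonneg _) ?_ hr.le
    refine (norm_sum_le _ _).trans (Finset.sum_le_sum fun y _ => ?_)
    rw [norm_mul]
    exact mul_le_of_le_one_left (norm_nonneg _) (hK1 t x y)
  have hφp : ∀ t, (∑ x ∈ S, ‖φ t x‖ ^ p) ^ (1 / p) = W t := fun t => sum_norm_dualF hpr S (V t)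
  have hφV : ∀ t, ∑ x ∈ S, φ t x * V t x = ((W t ^ 2 : ℝ) : ℂ) := fun t => by
    rw [hφ, sum_dualF_mul hr1]
    congr 1
    rw [hW, ← Real.rpow_natCast, ← Real.rpow_mul (hsum0 t)]
    congr 1
    push_cast; ring
  have hφA : ∀ t, ∀ x ∈ S, ‖φ t x‖ ≤ A := fun t x hx => by
    refine le_trans ?_ (hWA t)
    rw [← hφp t, one_div, Real.le_rpow_inv_iff_of_pos (norm_nonneg _)
      (Finset.sum_nonneg fun _ _ => by positivity) hp]
    exact Finset.single_le_sum (f := fun x => ‖φ t x‖ ^ p) (fun _ _ => by positivity) hx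
  have hA0 : 0 ≤ A := (hW0 0).trans (hWA 0)
  set H : ℝ → (Fin 4 → ℝ) → ℂ := fun t ξ => (m t ξ : ℂ) * trigP S (φ t) ξ with hH
  set A' : ℝ := ∑ x ∈ S, A with hA'
  have hA'0 : 0 ≤ A' := Finset.sum_nonneg fun _ _ => hA0
  have hHA : ∀ t ξ, ‖H t ξ‖ ≤ A' := fun t ξ => by
    rw [hH, norm_mul, Complex.norm_real]
    refine (mul_le_of_le_one_left (norm_nonneg _) (hm1 t ξ)).trans ?_
    exact (norm_trigP_le S (φ t) ξ).trans (Finset.sum_le_sum fun x hx => hφA t x hx)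
  have hHm : Measurable (Function.uncurry H) := by
    have h1 : Measurable fun z : ℝ × (Fin 4 → ℝ) => ((m z.1 z.2 : ℝ) : ℂ) := by
      have := hm.measurable
      exact Complex.measurable_ofReal.comp this
    refine h1.mul (Finset.measurable_fun_sum S fun x _ => ?_)
    exact ((hφm x).comp measurable_fst).mul ((continuous_chr x).measurable.comp measurable_snd)
  set G : (Fin 4 → ℝ) → ℂ := fun ξ => ∫ t, H t ξ ∂ν with hG
  set N := ∑ x ∈ S, ‖f x‖ ^ 2 with hN
  have hN0 : 0 ≤ N := Finset.sum_nonneg fun _ _ => by positivity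
  set f' : (Fin 4 → ℤ) → ℂ := fun y => (starRingEnd ℂ) (f y) with hf'
  have hGm : AEStronglyMeasurable G torusM :=
    (hHm.stronglyMeasurable.integral_prod_left').aestronglyMeasurable
  have hGb : ∀ ξ, ‖G ξ‖ ≤ A' * ν.real Set.univ := fun ξ =>
    norm_integral_le_of_norm_le_const (Filter.Eventually.of_forall fun t => hHA t ξ)
  have hC0 : 0 ≤ C := (integral_nonneg fun s => hκ0 0 s).trans (hκi 0)
  -- the quadratic expression equals a pairing on the torus
  have hQ : ((∫ t, W t ^ 2 ∂ν : ℝ) : ℂ) = ∫ ξ, G ξ * (starRingEnd ℂ) (trigP S f' ξ) ∂torusM := by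
    have h1 : ∀ t, ((W t ^ 2 : ℝ) : ℂ) =
        ∫ ξ, H t ξ * (starRingEnd ℂ) (trigP S f' ξ) ∂torusM := fun t => by
      have := integral_trigP_mul S f' (φ t) (hmt t)
      simp only [hf', Complex.conj_conj] at this
      simp only [hH, mul_assoc]
      rw [this, ← hφV]
      refine Finset.sum_congr rfl fun x _ => ?_
      rw [hV, Finset.mul_sum]
      exact Finset.sum_congr rfl fun y _ => by ring
    rw [← integral_complex_ofReal]
    simp_rw [h1]
    rw [integral_integral_swap]
    · simp_rw [hG, integral_mul_const]
    · refine Integrable.of_bound (C := A' * ∑ y ∈ S, ‖f' y‖) ?_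
        (Filter.Eventually.of_forall fun z => ?_)
      · refine Measurable.aestronglyMeasurable (hHm.mul ?_)
        have : Continuous fun z : ℝ × (Fin 4 → ℝ) => (starRingEnd ℂ) (trigP S f' z.2) := by fun_prop
        exact this.measurable
      · simp only [Function.uncurry]
        rw [norm_mul, RCLike.norm_conj]
        exact mul_le_mul (hHA _ _) (norm_trigP_le _ _ _) (norm_nonneg _) hA'0
  have hGG : ((∫ ξ, ‖G ξ‖ ^ 2 ∂torusM : ℝ) : ℂ) =
      ∫ z : ℝ × ℝ, ∫ ξ, H z.1 ξ * (starRingEnd ℂ) (H z.2 ξ) ∂torusM ∂(ν.prod ν) := by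
    rw [integral_integral_swap]
    · rw [← integral_complex_ofReal]
      refine integral_congr_ae (Filter.Eventually.of_forall fun ξ => ?_)
      dsimp only
      rw [integral_prod_mul (fun t => H t ξ) (fun t => (starRingEnd ℂ) (H t ξ)), integral_conj,
        Complex.mul_conj, Complex.normSq_eq_norm_sq]
    · refine Integrable.of_bound (C := A' * A') ?_
        (Filter.Eventually.of_forall fun z => ?_)
      · refine Measurable.aestronglyMeasurable ?_
        have h1 : Measurable fun z : (ℝ × ℝ) × (Fin 4 → ℝ) => H z.1.1 z.2 :=
          hHm.comp (by fun_prop : Measurable fun z : (ℝ × ℝ) × (Fin 4 → ℝ) => (z.1.1, z.2))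
        have h2 : Measurable fun z : (ℝ × ℝ) × (Fin 4 → ℝ) => H z.1.2 z.2 :=
          hHm.comp (by fun_prop : Measurable fun z : (ℝ × ℝ) × (Fin 4 → ℝ) => (z.1.2, z.2))
        exact h1.mul (Complex.continuous_conj.measurable.comp h2)
      · simp only [Function.uncurry]
        rw [norm_mul, RCLike.norm_conj]
        exact mul_le_mul (hHA _ _) (hHA _ _) (norm_nonneg _) hA'0
  have hinner : ∀ z : ℝ × ℝ, ‖∫ ξ, H z.1 ξ * (starRingEnd ℂ) (H z.2 ξ) ∂torusM‖ ≤
      κ z.1 z.2 * (W z.1 * W z.2) := fun z => by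
    have h := integral_trigP_mul S (φ z.2) (φ z.1) (m := fun ξ => m z.1 ξ * m z.2 ξ)
      ((hmt z.1).mul (hmt z.2))
    have e : ∀ ξ, H z.1 ξ * (starRingEnd ℂ) (H z.2 ξ) = ((m z.1 ξ * m z.2 ξ : ℝ) : ℂ) *
        (trigP S (φ z.1) ξ * (starRingEnd ℂ) (trigP S (φ z.2) ξ)) := fun ξ => by
      simp only [hH, map_mul, Complex.conj_ofReal]
      push_cast; ring
    simp_rw [e]
    rw [h]
    refine (hform z.1 z.2 S _ _).trans (le_of_eq ?_)
    simp only [RCLike.norm_conj]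
    rw [hφp, hφp]
    ring
  obtain ⟨hii, hker⟩ := integral_integral_kernel_le hκc hκ0 hκK hκs hκi hWm hW0 hWA
  have hGle : ∫ ξ, ‖G ξ‖ ^ 2 ∂torusM ≤ C * ∫ t, W t ^ 2 ∂ν := by
    have h0 : 0 ≤ ∫ ξ, ‖G ξ‖ ^ 2 ∂torusM := integral_nonneg fun ξ => by positivity
    have := norm_integral_le_of_norm_le hii (Filter.Eventually.of_forall hinner)
    rw [← hGG, Complex.norm_real, Real.norm_of_nonneg h0] at this
    exact this.trans hker
  have hQ0 : 0 ≤ ∫ t, W t ^ 2 ∂ν := integral_nonneg fun t => by positivity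
  refine le_mul_of_le_sqrt_mul_sqrt hQ0 hC0 hN0 ?_
  calc ∫ t, W t ^ 2 ∂ν = ‖((∫ t, W t ^ 2 ∂ν : ℝ) : ℂ)‖ := by
        rw [Complex.norm_real, Real.norm_of_nonneg hQ0]
    _ ≤ ∫ ξ, ‖G ξ‖ * ‖trigP S f' ξ‖ ∂torusM := by
        rw [hQ]
        refine (norm_integral_le_integral_norm _).trans (le_of_eq ?_)
        simp_rw [norm_mul, RCLike.norm_conj]
    _ ≤ √(∫ ξ, ‖G ξ‖ ^ 2 ∂torusM) * √(∫ ξ, ‖trigP S f' ξ‖ ^ 2 ∂torusM) :=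
        integral_mul_le_sqrt_mul_sqrt hGm.norm (by fun_prop) (fun _ => norm_nonneg _)
          (fun _ => norm_nonneg _) hGb (norm_trigP_le S f')
    _ ≤ √(C * ∫ t, W t ^ 2 ∂ν) * √N := by
        rw [integral_norm_trigP_sq]
        simp only [hf', RCLike.norm_conj, ← hN]
        gcongr

lemma ofReal_sum_norm_rpow {α : Type*} {r : ℝ} (hr : 0 < r) (S : Finset α) (v : α → ℂ) :
    ENNReal.ofReal ((∑ x ∈ S, ‖v x‖ ^ r) ^ (1 / r)) = (∑ x ∈ S, ‖v x‖ₑ ^ r) ^ (1 / r) := by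
  rw [← ENNReal.ofReal_rpow_of_nonneg (Finset.sum_nonneg fun _ _ => by positivity) (by positivity),
    ENNReal.ofReal_sum_of_nonneg (fun _ _ => by positivity)]
  congr 1
  refine Finset.sum_congr rfl fun x _ => ?_
  rw [← ENNReal.ofReal_rpow_of_nonneg (norm_nonneg _) hr.le, ofReal_norm]

lemma sum_rpow_le_lpN {α : Type*} {r : ℝ} (hr : 0 < r) (S : Finset α) (f : α → ℝ≥0∞) :
    (∑ x ∈ S, f x ^ r) ^ (1 / r) ≤ lpN r f :=
  ENNReal.rpow_le_rpow (ENNReal.sum_le_tsum S) (by positivity)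

lemma lpN_le_of_finset {α : Type*} {r : ℝ} (hr : 0 < r) {f : α → ℝ≥0∞} {B : ℝ≥0∞}
    (h : ∀ S : Finset α, (∑ x ∈ S, f x ^ r) ^ (1 / r) ≤ B) : lpN r f ≤ B := by
  rw [lpN_le_iff hr]
  intro S
  rw [← ENNReal.rpow_inv_le_iff hr, inv_eq_one_div]
  exact h S

/-- Homogeneous Strichartz estimate from a bound on the kernels of `m t * m s`. -/
lemma lintegral_lpN_matAct_sq_le {m : ℝ → (Fin 4 → ℝ) → ℝ} (hm : Continuous (Function.uncurry m))
    (hm1 : ∀ t ξ, |m t ξ| ≤ 1) {κ : ℝ → ℝ → ℝ}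
    (hκc : Continuous (Function.uncurry κ)) (hκ0 : ∀ t s, 0 ≤ κ t s) {K : ℝ}
    (hκK : ∀ t s, κ t s ≤ K) (hκs : ∀ t s, κ t s = κ s t) {C : ℝ} (hC : 0 ≤ C)
    (hκi : ∀ R t, ∫ s in Set.Icc (-R) R, κ t s ≤ C) {p r : ℝ} (hpr : p.HolderConjugate r)
    (hform : ∀ t s, FormBound (mKer fun ξ => m t ξ * m s ξ) p (κ t s))
    {f : (Fin 4 → ℤ) → ℂ} (hf : lpN 2 (fun x => ‖f x‖ₑ) ≠ ∞) :
    ∫⁻ t, lpN r (fun x => ‖matAct (mKer (m t)) f x‖ₑ) ^ 2 ≤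
      ENNReal.ofReal C * lpN 2 (fun x => ‖f x‖ₑ) ^ 2 := by
  have hr := hpr.symm.pos
  obtain ⟨S, -, hS⟩ := Filter.exists_seq_monotone_tendsto_atTop_atTop (Finset (Fin 4 → ℤ))
  set V : ℕ → ℝ → (Fin 4 → ℤ) → ℂ := fun n t x => ∑ y ∈ S n, mKer (m t) x y * f y with hV
  have hVm : ∀ n x, Measurable fun t => V n t x := fun n x => by
    have := continuous_mKer hm hm1
    have : Continuous fun t => V n t x := by simp only [hV]; fun_prop
    exact this.measurable
  set g : ℕ → ℝ → ℝ≥0∞ := fun n t => ((∑ x ∈ S n, ‖V n t x‖ₑ ^ r) ^ (1 / r)) ^ 2 with hg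
  have hgm : ∀ n, Measurable (g n) := fun n => by
    have := fun x => (hVm n x).enorm.pow_const r
    exact ((Finset.measurable_fun_sum (S n) fun x _ => this x).pow_const _).pow_const 2
  set G : ℕ → ℝ → ℝ≥0∞ := fun n => (Set.Icc (-(n : ℝ)) n).indicator (g n) with hG
  have hGi : ∀ n, ∫⁻ t, G n t ≤ ENNReal.ofReal C * lpN 2 (fun x => ‖f x‖ₑ) ^ 2 := fun n => by
    have h := tt_star_finite hm hm1 hκc hκ0 hκK hκs (hκi n) hpr hform (S n) f
    have hgr : ∀ t, g n t =
        ENNReal.ofReal (((∑ x ∈ S n, ‖V n t x‖ ^ r) ^ (1 / r)) ^ 2) := fun t => by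
      rw [ENNReal.ofReal_pow (Real.rpow_nonneg (Finset.sum_nonneg fun _ _ => by positivity) _),
        ofReal_sum_norm_rpow hr]
    rw [hG, lintegral_indicator measurableSet_Icc]
    simp_rw [hgr]
    rw [← ofReal_integral_eq_lintegral_ofReal]
    · refine (ENNReal.ofReal_le_ofReal h).trans ?_
      rw [ENNReal.ofReal_mul hC]
      gcongr
      have := sum_rpow_le_lpN two_pos (S n) fun x => ‖f x‖ₑ
      rw [← ofReal_sum_norm_rpow two_pos] at this
      have h2 := pow_le_pow_left₀ zero_le this 2
      rw [← ENNReal.ofReal_pow (Real.rpow_nonneg (Finset.sum_nonneg fun _ _ => by positivity) _),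
        ← Real.sqrt_eq_rpow, Real.sq_sqrt (Finset.sum_nonneg fun _ _ => by positivity)] at h2
      simpa using h2
    · have hVc : ∀ x, Continuous fun t => V n t x := fun x => by
        have := continuous_mKer hm hm1
        simp only [hV]; fun_prop
      have : Continuous fun t => ((∑ x ∈ S n, ‖V n t x‖ ^ r) ^ (1 / r)) ^ 2 := by
        refine Continuous.pow (Continuous.rpow_const ?_ fun t => Or.inr (by positivity)) 2
        exact continuous_finsetSum _ fun x _ =>
          (hVc x).norm.rpow_const fun t => Or.inr hr.le
      exact this.continuousOn.integrableOn_compact isCompact_Icc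
    · exact Filter.Eventually.of_forall fun t => by positivity
  have hlim : ∀ t, lpN r (fun x => ‖matAct (mKer (m t)) f x‖ₑ) ^ 2 ≤
      Filter.liminf (fun n => G n t) Filter.atTop := fun t => by
    set L := Filter.liminf (fun n => G n t) Filter.atTop with hL
    have hrow : ∀ x, Summable fun y => mKer (m t) x y * f y := fun x => by
      have hk := formBound_two (m := m t) (hm.comp (by fun_prop : Continuous fun ξ => (t, ξ)))
        (hm1 t)
      exact summable_mul_of_lpN Real.HolderConjugate.two_two
        (ne_top_of_le_ne_top ENNReal.ofReal_ne_top (hk.lpN_row_le zero_le_one x)) hf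
    have hVlim : ∀ x, Filter.Tendsto (fun n => V n t x) Filter.atTop
        (nhds (matAct (mKer (m t)) f x)) := fun x => (hrow x).hasSum.comp hS
    have h1 : lpN r (fun x => ‖matAct (mKer (m t)) f x‖ₑ) ≤ L ^ (1 / 2 : ℝ) := by
      refine lpN_le_of_finset hr fun T => ?_
      rw [one_div (2 : ℝ), ENNReal.le_rpow_inv_iff two_pos, ENNReal.rpow_two]
      have hT : Filter.Tendsto (fun n => ((∑ x ∈ T, ‖V n t x‖ₑ ^ r) ^ (1 / r)) ^ 2) Filter.atTop
          (nhds (((∑ x ∈ T, ‖matAct (mKer (m t)) f x‖ₑ ^ r) ^ (1 / r)) ^ 2)) := by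
        have hc : ∀ a : ℝ, Continuous fun u : ℝ≥0∞ => u ^ a := fun a =>
          ENNReal.continuous_rpow_const
        refine ((ENNReal.continuous_pow 2).tendsto _).comp (((hc _).tendsto _).comp ?_)
        exact tendsto_finsetSum _ fun x _ => ((hc r).tendsto _).comp (hVlim x).enorm
      rw [← hT.liminf_eq]
      refine Filter.liminf_le_liminf ?_
      filter_upwards [hS.eventually_ge_atTop T, Filter.eventually_ge_atTop ⌈|t|⌉₊] with n hn ht
      have : t ∈ Set.Icc (-(n : ℝ)) n := abs_le.1 (Nat.ceil_le.1 ht)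
      rw [hG]
      simp only [Set.indicator_of_mem this, hg]
      gcongr
    calc _ ≤ (L ^ (1 / 2 : ℝ)) ^ 2 := by gcongr
      _ = L := by rw [← ENNReal.rpow_natCast, ← ENNReal.rpow_mul]; norm_num
  calc _ ≤ ∫⁻ t, Filter.liminf (fun n => G n t) Filter.atTop := lintegral_mono hlim
    _ ≤ Filter.liminf (fun n => ∫⁻ t, G n t) Filter.atTop :=
        lintegral_liminf_le fun n => (hgm n).indicator measurableSet_Icc
    _ ≤ _ := by
        refine Filter.liminf_le_of_frequently_le' (Filter.Frequently.of_forall hGi)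

/-- The symbol of `cos(t√(1−Δ))`. -/
def symC (t : ℝ) (ξ : Fin 4 → ℝ) : ℝ := Real.cos (t * omegaKG 4 ξ)

/-- The symbol of `sin(t√(1−Δ))/√(1−Δ)`. -/
def symS (t : ℝ) (ξ : Fin 4 → ℝ) : ℝ := Real.sin (t * omegaKG 4 ξ) / omegaKG 4 ξ

lemma continuous_symC : Continuous (Function.uncurry symC) := by
  have : Continuous fun z : ℝ × (Fin 4 → ℝ) => Real.cos (z.1 * omegaKG 4 z.2) := by fun_prop
  exact this

lemma continuous_symS : Continuous (Function.uncurry symS) := by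
  have : Continuous fun z : ℝ × (Fin 4 → ℝ) => Real.sin (z.1 * omegaKG 4 z.2) / omegaKG 4 z.2 :=
    Continuous.div (by fun_prop) (by fun_prop) fun z => by linarith [one_le_omegaKG 4 z.2]
  exact this

lemma continuous_symC_right (t : ℝ) : Continuous (symC t) :=
  Continuous.uncurry_left t continuous_symC

lemma abs_symC_le (t : ℝ) (ξ : Fin 4 → ℝ) : |symC t ξ| ≤ 1 := Real.abs_cos_le_one _

lemma continuous_symS_right (t : ℝ) : Continuous (symS t) :=
  Continuous.uncurry_left t continuous_symS

lemma abs_symS_le (t : ℝ) (ξ : Fin 4 → ℝ) : |symS t ξ| ≤ 1 := by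
  have h := one_le_omegaKG 4 ξ
  rw [symS, abs_div, abs_of_pos (by linarith : 0 < omegaKG 4 ξ)]
  exact div_le_one_of_le₀ ((Real.abs_sin_le_one _).trans h) (by linarith)

lemma multKernel_smul_add {m m' : (Fin 4 → ℝ) → ℝ} (hm : Continuous m) (hm' : Continuous m')
    (a b : ℝ) (x : Fin 4 → ℤ) : multKernel 4 (fun ξ => a * m ξ + b * m' ξ) x =
      a * multKernel 4 m x + b * multKernel 4 m' x := by
  simp_rw [multKernel_eq_integral]
  rw [← integral_const_mul, ← integral_const_mul, ← integral_add]
  · refine integral_congr_ae (Filter.Eventually.of_forall fun ξ => ?_)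
    push_cast; ring
  · exact integrable_torusM_of_continuous (by fun_prop)
  · exact integrable_torusM_of_continuous (by fun_prop)

lemma integral_Icc_comp_le {k : ℝ → ℝ} (hk : Integrable k) (hk0 : ∀ s, 0 ≤ k s) (R t : ℝ) :
    ∫ s in Set.Icc (-R) R, (k (t - s) + k (t + s)) ≤ 2 * ∫ s, k s := by
  have h1 : Integrable fun s => k (t - s) := hk.comp_sub_left t
  have h2 : Integrable fun s => k (t + s) := hk.comp_add_left t
  calc _ ≤ ∫ s, (k (t - s) + k (t + s)) :=
        setIntegral_le_integral (h1.add h2) (Filter.Eventually.of_forall fun s =>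
          add_nonneg (hk0 _) (hk0 _))
    _ = 2 * ∫ s, k s := by
        rw [integral_add h1 h2, integral_sub_left_eq_self k volume t,
          integral_add_left_eq_self k t]
        ring

lemma formBound_of_add_kernel {m m₁ m₂ : (Fin 4 → ℝ) → ℝ} (hm : Continuous m)
    (hm₁ : Continuous m₁) (hm₂ : Continuous m₂) (hb : ∀ ξ, |m ξ| ≤ 1) {a b D₁ D₂ p : ℝ}
    (ha : |a| ≤ 1) (hb' : |b| ≤ 1)
    (h : ∀ ξ, m ξ = a * m₁ ξ + b * m₂ ξ) (h₁ : ∀ x, ‖multKernel 4 m₁ x‖ ≤ D₁)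
    (h₂ : ∀ x, ‖multKernel 4 m₂ x‖ ≤ D₂) (hp1 : 1 ≤ p) (hp2 : p ≤ 2) :
    FormBound (mKer m) p (D₁ ^ (2 / p - 1) + D₂ ^ (2 / p - 1)) := by
  have hD₁ : 0 ≤ D₁ := (norm_nonneg _).trans (h₁ 0)
  have hD₂ : 0 ≤ D₂ := (norm_nonneg _).trans (h₂ 0)
  have hp : 0 < p := by linarith
  have hθ0 : 0 ≤ 2 / p - 1 := by
    have : 1 ≤ 2 / p := by rw [le_div_iff₀ hp]; linarith
    linarith
  have hθ1 : 2 / p - 1 ≤ 1 := by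
    have : 2 / p ≤ 2 := by rw [div_le_iff₀ hp]; linarith
    linarith
  have hD : ∀ x y, ‖mKer m x y‖ ≤ D₁ + D₂ := fun x y => by
    rw [mKer, show m = fun ξ => a * m₁ ξ + b * m₂ ξ from funext h, multKernel_smul_add hm₁ hm₂]
    refine (norm_add_le _ _).trans (add_le_add ?_ ?_)
    · rw [norm_mul, Complex.norm_real]
      exact (mul_le_of_le_one_left (norm_nonneg _) ha).trans (h₁ _)
    · rw [norm_mul, Complex.norm_real]
      exact (mul_le_of_le_one_left (norm_nonneg _) hb').trans (h₂ _)
  refine (formBound_interp hD (by positivity) zero_le_one (formBound_two hm hb) hp1 hp2).mono ?_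
  rw [Real.one_rpow, mul_one]
  exact Real.rpow_add_le_add_rpow hD₁ hD₂ hθ0 hθ1

/-- The polynomially decaying majorant `c (1 + |t|)^(-γ)`. -/
def decayK (c γ t : ℝ) : ℝ := c * (1 + |t|) ^ (-γ)

lemma decayK_nonneg {c : ℝ} (hc : 0 ≤ c) (γ t : ℝ) : 0 ≤ decayK c γ t := by
  unfold decayK; positivity

lemma continuous_decayK (c γ : ℝ) : Continuous (decayK c γ) := by
  have hpos : ∀ t : ℝ, 0 < 1 + |t| := fun t => by positivity
  exact continuous_const.mul (Continuous.rpow_const (by fun_prop) fun t => Or.inl (hpos t).ne')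

lemma integrable_decayK (c : ℝ) {γ : ℝ} (hγ : 1 < γ) : Integrable (decayK c γ) := by
  have := integrable_one_add_norm (E := ℝ) (μ := volume) (r := γ) (by simpa using hγ)
  exact this.const_mul c

lemma decayK_le {c γ : ℝ} (hc : 0 ≤ c) (hγ : 0 ≤ γ) (t : ℝ) : decayK c γ t ≤ c := by
  refine mul_le_of_le_one_right hc ?_
  exact Real.rpow_le_one_of_one_le_of_nonpos (by linarith [abs_nonneg t]) (by linarith)

lemma decayK_neg (c γ t : ℝ) : decayK c γ (-t) = decayK c γ t := by simp [decayK]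

lemma decay_rpow_le {D C θ ε γ : ℝ} (hD : 0 ≤ D) (hDC : D ≤ C) (hθ : 0 ≤ θ)
    (hγ : γ = (3 / 2 - ε) * θ) (t : ℝ) :
    (D * (1 + |t|) ^ (-(3 / 2) + ε)) ^ θ ≤ decayK (C ^ θ) γ t := by
  have hpos : 0 < 1 + |t| := by positivity
  rw [Real.mul_rpow hD (by positivity), ← Real.rpow_mul hpos.le, decayK,
    show (-(3 / 2) + ε) * θ = -γ by rw [hγ]; ring]
  exact mul_le_mul_of_nonneg_right (Real.rpow_le_rpow hD hDC hθ) (by positivity)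

lemma formBound_symS {p ε C₁ : ℝ} (hC₁ : 0 ≤ C₁)
    (h₁ : ∀ t x, ‖multKernel 4 (fun ξ => omegaKG 4 ξ ^ (-(2 * (1 / 2 : ℝ))) *
      Real.sin (t * omegaKG 4 ξ)) x‖ ≤ C₁ * (1 + |t|) ^ (-(3 / 2) + ε))
    (hp1 : 1 ≤ p) (hp2 : p ≤ 2) (t : ℝ) :
    FormBound (mKer (symS t)) p ((C₁ * (1 + |t|) ^ (-(3 / 2) + ε)) ^ (2 / p - 1)) := by
  have hS : symS t = fun ξ => omegaKG 4 ξ ^ (-(2 * (1 / 2 : ℝ))) *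
      Real.sin (t * omegaKG 4 ξ) := by
    funext ξ
    rw [symS, show -(2 * (1 / 2 : ℝ)) = -1 by norm_num, Real.rpow_neg_one, div_eq_inv_mul]
  have hD : ∀ x y, ‖mKer (symS t) x y‖ ≤ C₁ * (1 + |t|) ^ (-(3 / 2) + ε) := fun x y => by
    have := h₁ t (x - y)
    rw [← hS] at this
    exact this
  have := formBound_interp hD (by positivity) zero_le_one (formBound_two (continuous_symS_right t) (abs_symS_le t)) hp1 hp2
  rwa [Real.one_rpow, mul_one] at this

lemma formBound_symC_mul {p ε C₀ : ℝ}
    (h₀ : ∀ t x, ‖multKernel 4 (fun ξ => omegaKG 4 ξ ^ (-(2 * (0 : ℝ))) *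
      Real.cos (t * omegaKG 4 ξ)) x‖ ≤ C₀ * (1 + |t|) ^ (-(3 / 2) + ε))
    (hp1 : 1 ≤ p) (hp2 : p ≤ 2) (t s : ℝ) :
    FormBound (mKer fun ξ => symC t ξ * symC s ξ) p
      ((C₀ * (1 + |t - s|) ^ (-(3 / 2) + ε)) ^ (2 / p - 1) +
        (C₀ * (1 + |t + s|) ^ (-(3 / 2) + ε)) ^ (2 / p - 1)) := by
  have hc := continuous_symC_right
  have hω := continuous_omegaKG_rpow 4 (-(2 * (0 : ℝ)))
  have hb : ∀ ξ, |symC t ξ * symC s ξ| ≤ 1 := fun ξ => by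
    rw [abs_mul]
    exact mul_le_one₀ (abs_symC_le _ _) (abs_nonneg _) (abs_symC_le _ _)
  have he : ∀ ξ, symC t ξ * symC s ξ =
      1 / 2 * (omegaKG 4 ξ ^ (-(2 * (0 : ℝ))) * Real.cos ((t - s) * omegaKG 4 ξ)) +
      1 / 2 * (omegaKG 4 ξ ^ (-(2 * (0 : ℝ))) * Real.cos ((t + s) * omegaKG 4 ξ)) := fun ξ => by
    simp only [symC, sub_mul, add_mul, Real.cos_add, Real.cos_sub, mul_zero, neg_zero,
      Real.rpow_zero]
    ring
  exact formBound_of_add_kernel ((hc t).mul (hc s)) (hω.mul (by fun_prop)) (hω.mul (by fun_prop))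
    hb (by norm_num [abs_of_pos]) (by norm_num [abs_of_pos]) he (h₀ (t - s)) (h₀ (t + s)) hp1 hp2

lemma formBound_symS_mul {p ε C₂ : ℝ}
    (h₂ : ∀ t x, ‖multKernel 4 (fun ξ => omegaKG 4 ξ ^ (-(2 * (1 : ℝ))) *
      Real.cos (t * omegaKG 4 ξ)) x‖ ≤ C₂ * (1 + |t|) ^ (-(3 / 2) + ε))
    (hp1 : 1 ≤ p) (hp2 : p ≤ 2) (t s : ℝ) :
    FormBound (mKer fun ξ => symS t ξ * symS s ξ) p
      ((C₂ * (1 + |t - s|) ^ (-(3 / 2) + ε)) ^ (2 / p - 1) +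
        (C₂ * (1 + |t + s|) ^ (-(3 / 2) + ε)) ^ (2 / p - 1)) := by
  have hc := continuous_symS_right
  have hω := continuous_omegaKG_rpow 4 (-(2 * (1 : ℝ)))
  have hb : ∀ ξ, |symS t ξ * symS s ξ| ≤ 1 := fun ξ => by
    rw [abs_mul]
    exact mul_le_one₀ (abs_symS_le _ _) (abs_nonneg _) (abs_symS_le _ _)
  have he : ∀ ξ, symS t ξ * symS s ξ =
      1 / 2 * (omegaKG 4 ξ ^ (-(2 * (1 : ℝ))) * Real.cos ((t - s) * omegaKG 4 ξ)) +
      -(1 / 2) * (omegaKG 4 ξ ^ (-(2 * (1 : ℝ))) * Real.cos ((t + s) * omegaKG 4 ξ)) := fun ξ => by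
    have h0 : (0 : ℝ) < omegaKG 4 ξ := by linarith [one_le_omegaKG 4 ξ]
    have e : omegaKG 4 ξ ^ (-(2 * (1 : ℝ))) = (omegaKG 4 ξ ^ 2)⁻¹ := by
      rw [mul_one, Real.rpow_neg h0.le, Real.rpow_two]
    simp only [symS, sub_mul, add_mul, Real.cos_add, Real.cos_sub, e]
    have := h0.ne'
    field_simp
    ring
  exact formBound_of_add_kernel ((hc t).mul (hc s)) (hω.mul (by fun_prop)) (hω.mul (by fun_prop))
    hb (by norm_num [abs_of_pos]) (by norm_num [abs_of_pos]) he (h₂ (t - s)) (h₂ (t + s)) hp1 hp2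

lemma lintegral_lpN_matAct_sq_le_of_decay {m : ℝ → (Fin 4 → ℝ) → ℝ}
    (hm : Continuous (Function.uncurry m)) (hm1 : ∀ t ξ, |m t ξ| ≤ 1) {p r c γ : ℝ}
    (hpr : p.HolderConjugate r) (hc : 0 ≤ c) (hγ : 1 < γ)
    (h : ∀ t s, FormBound (mKer fun ξ => m t ξ * m s ξ) p
      (decayK c γ (t - s) + decayK c γ (t + s)))
    (f : (Fin 4 → ℤ) → ℂ) (hf : lpN 2 (fun x => ‖f x‖ₑ) ≠ ∞) :
    ∫⁻ t, lpN r (fun x => ‖matAct (mKer (m t)) f x‖ₑ) ^ 2 ≤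
      ENNReal.ofReal (2 * ∫ s, decayK c γ s) * lpN 2 (fun x => ‖f x‖ₑ) ^ 2 := by
  have hk0 := decayK_nonneg hc γ
  have hkc := continuous_decayK c γ
  have hle := decayK_le hc (by linarith : 0 ≤ γ)
  refine lintegral_lpN_matAct_sq_le hm hm1 (κ := fun t s => decayK c γ (t - s) + decayK c γ (t + s))
    ?_ (fun t s => add_nonneg (hk0 _) (hk0 _)) (K := c + c)
    (fun t s => add_le_add (hle _) (hle _)) (fun t s => ?_)
    (mul_nonneg zero_le_two (integral_nonneg hk0))
    (fun R t => integral_Icc_comp_le (integrable_decayK c hγ) hk0 R t) hpr h hf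
  · have : Continuous fun z : ℝ × ℝ => decayK c γ (z.1 - z.2) + decayK c γ (z.1 + z.2) := by
      fun_prop
    exact this
  · show _ = _
    rw [← decayK_neg c γ (t - s), neg_sub, add_comm t s]

lemma exists_propagator_bounds {p r ε : ℝ} (hpr : p.HolderConjugate r) (hp2 : p ≤ 2)
    (hε : 0 < ε) (hε' : ε ≤ 1 / 2) {γ : ℝ} (hγ : γ = (3 / 2 - ε) * (2 / p - 1)) (hγ1 : 1 < γ) :
    ∃ c B : ℝ, 0 < c ∧ 0 ≤ B ∧ (∀ t, FormBound (mKer (symS t)) p (decayK c γ t)) ∧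
      (∀ f : (Fin 4 → ℤ) → ℂ, lpN 2 (fun x => ‖f x‖ₑ) ≠ ∞ →
        ∫⁻ t, lpN r (fun x => ‖matAct (mKer (symC t)) f x‖ₑ) ^ 2 ≤
          ENNReal.ofReal B * lpN 2 (fun x => ‖f x‖ₑ) ^ 2) ∧
      (∀ f : (Fin 4 → ℤ) → ℂ, lpN 2 (fun x => ‖f x‖ₑ) ≠ ∞ →
        ∫⁻ t, lpN r (fun x => ‖matAct (mKer (symS t)) f x‖ₑ) ^ 2 ≤
          ENNReal.ofReal B * lpN 2 (fun x => ‖f x‖ₑ) ^ 2) := by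
  obtain ⟨C₀, hC₀, h₀⟩ := exists_norm_multKernel_le le_rfl hε hε'
  obtain ⟨C₁, hC₁, h₁⟩ := exists_norm_multKernel_le (by norm_num : (0 : ℝ) ≤ 1 / 2) hε hε'
  obtain ⟨C₂, hC₂, h₂⟩ := exists_norm_multKernel_le zero_le_one hε hε'
  have hp1 : 1 ≤ p := hpr.lt.le
  have hθ : 0 ≤ 2 / p - 1 := by
    have : 1 ≤ 2 / p := by rw [le_div_iff₀ (by linarith)]; linarith
    linarith
  obtain ⟨C, h0C, h1C, h2C⟩ : ∃ C, C₀ ≤ C ∧ C₁ ≤ C ∧ C₂ ≤ C :=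
    ⟨max C₀ (max C₁ C₂), by simp, by simp, by simp⟩
  have hc : 0 < C ^ (2 / p - 1) := Real.rpow_pos_of_pos (hC₀.trans_le h0C) _
  refine ⟨C ^ (2 / p - 1), 2 * ∫ s, decayK (C ^ (2 / p - 1)) γ s, hc,
    mul_nonneg zero_le_two (integral_nonneg (decayK_nonneg hc.le γ)), fun t => ?_,
    lintegral_lpN_matAct_sq_le_of_decay continuous_symC abs_symC_le hpr hc.le hγ1 fun t s => ?_,
    lintegral_lpN_matAct_sq_le_of_decay continuous_symS abs_symS_le hpr hc.le hγ1 fun t s => ?_⟩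
  · exact (formBound_symS hC₁.le (fun t x => (h₁ t x).2) hp1 hp2 t).mono
      (decay_rpow_le hC₁.le h1C hθ hγ t)
  · exact (formBound_symC_mul (fun t x => (h₀ t x).1) hp1 hp2 t s).mono
      (add_le_add (decay_rpow_le hC₀.le h0C hθ hγ _) (decay_rpow_le hC₀.le h0C hθ hγ _))
  · exact (formBound_symS_mul (fun t x => (h₂ t x).1) hp1 hp2 t s).mono
      (add_le_add (decay_rpow_le hC₂.le h2C hθ hγ _) (decay_rpow_le hC₂.le h2C hθ hγ _))

lemma sq_lintegral_mul_le {β : Type*} [MeasurableSpace β] {μ : Measure β} {f g : β → ℝ≥0∞}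
    (hf : AEMeasurable f μ) (hg : AEMeasurable g μ) :
    (∫⁻ s, f s * g s ∂μ) ^ 2 ≤ (∫⁻ s, f s ^ 2 ∂μ) * ∫⁻ s, g s ^ 2 ∂μ := by
  have h := ENNReal.lintegral_mul_le_Lp_mul_Lq μ Real.HolderConjugate.two_two hf hg
  have h2 := pow_le_pow_left' h 2
  simp only [ENNReal.rpow_two, Pi.mul_apply] at h2
  refine h2.trans_eq ?_
  rw [mul_pow, ← ENNReal.rpow_two, ← ENNReal.rpow_two, ← ENNReal.rpow_mul, ← ENNReal.rpow_mul]
  norm_num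

lemma lintegral_sq_lintegral_le {H : ℝ → ℝ → ℝ≥0∞} (hH : Measurable (Function.uncurry H))
    {h : ℝ → ℝ≥0∞} (hm : Measurable h) (hh : ∀ s, ∫⁻ t, H t s ^ 2 ≤ h s ^ 2) :
    ∫⁻ t, (∫⁻ s, H t s) ^ 2 ≤ (∫⁻ s, h s) ^ 2 := by
  have hH1 : ∀ t, Measurable (H t) := fun t => hH.comp (by fun_prop : Measurable fun s => (t, s))
  have hH2 : ∀ s, Measurable fun t => H t s := fun s =>
    hH.comp (by fun_prop : Measurable fun t : ℝ => (t, s))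
  have h3 : Measurable fun z : (ℝ × ℝ) × ℝ => H z.2 z.1.1 * H z.2 z.1.2 :=
    (hH.comp (by fun_prop : Measurable fun z : (ℝ × ℝ) × ℝ => (z.2, z.1.1))).mul
      (hH.comp (by fun_prop : Measurable fun z : (ℝ × ℝ) × ℝ => (z.2, z.1.2)))
  have e1 : ∀ t, (∫⁻ s, H t s) ^ 2 = ∫⁻ z : ℝ × ℝ, H t z.1 * H t z.2 := fun t => by
    rw [Measure.volume_eq_prod, lintegral_prod_mul (hH1 t).aemeasurable (hH1 t).aemeasurable, sq]
  have e2 : ∀ z : ℝ × ℝ, ∫⁻ t, H t z.1 * H t z.2 ≤ h z.1 * h z.2 := fun z => by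
    have h1 := sq_lintegral_mul_le (μ := volume) (hH2 z.1).aemeasurable (hH2 z.2).aemeasurable
    have h2 := h1.trans (mul_le_mul' (hh z.1) (hh z.2))
    rw [← mul_pow] at h2
    exact (ENNReal.pow_le_pow_left_iff two_ne_zero).1 h2
  simp_rw [e1]
  rw [lintegral_lintegral_swap]
  · calc _ ≤ ∫⁻ z : ℝ × ℝ, h z.1 * h z.2 := lintegral_mono e2
      _ = _ := by
        rw [Measure.volume_eq_prod, lintegral_prod_mul hm.aemeasurable hm.aemeasurable, sq]
  · exact (h3.comp measurable_swap).aemeasurable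

lemma lpN_lintegral_le {α β : Type*} [Countable α] [MeasurableSpace β] {μ : Measure β} {p r : ℝ}
    (hpr : p.HolderConjugate r) {G : β → α → ℝ≥0∞} (hG : ∀ x, Measurable fun s => G s x) :
    lpN r (fun x => ∫⁻ s, G s x ∂μ) ≤ ∫⁻ s, lpN r (G s) ∂μ := by
  have hr := hpr.symm.pos
  by_cases htop : ∃ x, ∫⁻ s, G s x ∂μ = ∞
  · obtain ⟨x, hx⟩ := htop
    have : ∞ ≤ ∫⁻ s, lpN r (G s) ∂μ := hx ▸ lintegral_mono fun s => le_lpN hr (G s) x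
    rw [top_le_iff.1 this]
    exact le_top
  push Not at htop
  refine lpN_le_of_finset hr fun S => ?_
  set A := fun x => ∫⁻ s, G s x ∂μ with hA
  set T := ∑ x ∈ S, A x ^ r with hT
  have hTtop : T ≠ ∞ := by
    refine ENNReal.sum_ne_top.2 fun x _ => ENNReal.rpow_ne_top_of_nonneg hr.le (htop x)
  have h1 : T ≤ T ^ (1 / p) * ∫⁻ s, lpN r (G s) ∂μ := by
    calc T = ∑ x ∈ S, A x ^ (r - 1) * ∫⁻ s, G s x ∂μ := by
          refine Finset.sum_congr rfl fun x _ => ?_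
          show A x ^ r = A x ^ (r - 1) * A x
          conv_rhs => rw [← ENNReal.rpow_one (A x), ← ENNReal.rpow_mul]
          rw [← ENNReal.rpow_add_of_nonneg _ _ (by linarith [hpr.symm.lt]) zero_le_one]
          congr 1; ring
      _ = ∫⁻ s, ∑ x ∈ S, A x ^ (r - 1) * G s x ∂μ := by
          rw [lintegral_finsetSum _ fun x _ => (hG x).const_mul _]
          exact Finset.sum_congr rfl fun x _ => (lintegral_const_mul _ (hG x)).symm
      _ ≤ ∫⁻ s, T ^ (1 / p) * lpN r (G s) ∂μ := by
          refine lintegral_mono fun s => ?_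
          refine (ENNReal.inner_le_Lp_mul_Lq S _ _ hpr).trans ?_
          refine mul_le_mul' (le_of_eq ?_) ?_
          · congr 1
            refine Finset.sum_congr rfl fun x _ => ?_
            rw [← ENNReal.rpow_mul, hpr.symm.sub_one_mul_conj]
          · exact sum_rpow_le_lpN hr S _
      _ = _ := lintegral_const_mul _ (measurable_lpN hG r)
  rcases eq_or_ne T 0 with h0 | h0
  · rw [h0, ENNReal.zero_rpow_of_pos (by positivity)]; exact zero_le
  have hTp0 : T ^ (1 / p) ≠ 0 := by simp [ENNReal.rpow_eq_zero_iff, h0, hTtop]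
  have hTpt : T ^ (1 / p) ≠ ∞ := ENNReal.rpow_ne_top_of_nonneg (by simp [hpr.pos.le]) hTtop
  rw [← ENNReal.mul_le_mul_iff_right hTp0 hTpt]
  refine le_trans (le_of_eq ?_) h1
  rw [← ENNReal.rpow_add _ _ h0 hTtop, one_div, one_div, hpr.inv_add_inv_eq_one, ENNReal.rpow_one]

lemma lintegral_sq_conv_le {k n : ℝ → ℝ≥0∞} (hk : Measurable k) (hn : Measurable n) :
    ∫⁻ t, (∫⁻ s, k (t - s) * n s) ^ 2 ≤ (∫⁻ s, k s) ^ 2 * ∫⁻ s, n s ^ 2 := by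
  have e : ∀ t, ∫⁻ s, k (t - s) * n s = ∫⁻ s, k s * n (t - s) := fun t => by
    rw [← lintegral_sub_left_eq_self _ t]
    simp
  simp_rw [e]
  refine (lintegral_sq_lintegral_le (H := fun t s => k s * n (t - s))
    (h := fun s => k s * (∫⁻ u, n u ^ 2) ^ (1 / 2 : ℝ)) (by fun_prop) (by fun_prop) fun s => le_of_eq ?_).trans_eq ?_
  · simp_rw [mul_pow]
    rw [lintegral_const_mul _ (by fun_prop), lintegral_sub_right_eq_self (fun u => n u ^ 2) s,
      ← ENNReal.rpow_two (_ ^ _), ← ENNReal.rpow_mul]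
    norm_num
  · rw [lintegral_mul_const _ hk, mul_pow, ← ENNReal.rpow_two (_ ^ (1 / 2 : ℝ)), ← ENNReal.rpow_mul]
    norm_num

/-- The inhomogeneous part of Duhamel's formula. -/
def duhInt (F : ℝ → (Fin 4 → ℤ) → ℂ) (t : ℝ) (x : Fin 4 → ℤ) : ℂ :=
  ∫ s in (0 : ℝ)..t, matAct (mKer (symS (t - s))) (F s) x

/-- The whole-line absolute majorant of `duhInt`. -/
def duhAbs (F : ℝ → (Fin 4 → ℤ) → ℂ) (t : ℝ) (x : Fin 4 → ℤ) : ℝ≥0∞ :=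
  ∫⁻ s, ‖matAct (mKer (symS (t - s))) (F s) x‖ₑ

lemma formBound_symS_two (t : ℝ) : FormBound (mKer (symS t)) 2 1 :=
  formBound_two (continuous_symS_right t) (abs_symS_le t)

lemma formBound_symC_two (t : ℝ) : FormBound (mKer (symC t)) 2 1 :=
  formBound_two (continuous_symC_right t) (abs_symC_le t)

lemma summable_mKer_mul {m : (Fin 4 → ℝ) → ℝ} (hm : FormBound (mKer m) 2 1)
    {f : (Fin 4 → ℤ) → ℂ} (hf : lpN 2 (fun x => ‖f x‖ₑ) ≠ ∞) (x : Fin 4 → ℤ) :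
    Summable fun y => mKer m x y * f y :=
  summable_mul_of_lpN Real.HolderConjugate.two_two
    (ne_top_of_le_ne_top ENNReal.ofReal_ne_top (hm.lpN_row_le zero_le_one x)) hf

lemma lpN_two_matAct_le {m : (Fin 4 → ℝ) → ℝ} (hm : FormBound (mKer m) 2 1)
    {f : (Fin 4 → ℤ) → ℂ} (hf : lpN 2 (fun x => ‖f x‖ₑ) ≠ ∞) :
    lpN 2 (fun x => ‖matAct (mKer m) f x‖ₑ) ≤ lpN 2 (fun x => ‖f x‖ₑ) := by
  simpa using hm.lpN_matAct_le zero_le_one hm zero_le_one Real.HolderConjugate.two_two le_rfl hf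

lemma measurable_tsum_of_summable {β α : Type*} [MeasurableSpace β] [Countable α]
    {f : β → α → ℂ} (hf : ∀ y, Measurable fun z => f z y) (hs : ∀ z, Summable (f z)) :
    Measurable fun z => ∑' y, f z y := by
  obtain ⟨S, -, hS⟩ := Filter.exists_seq_monotone_tendsto_atTop_atTop (Finset α)
  refine measurable_of_tendsto_metrizable (f := fun n z => ∑ y ∈ S n, f z y)
    (fun n => Finset.measurable_fun_sum _ fun y _ => hf y) ?_
  rw [tendsto_pi_nhds]
  intro z
  exact (hs z).hasSum.comp hS

lemma measurable_mKer_symS (x y : Fin 4 → ℤ) : Measurable fun t => mKer (symS t) x y :=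
  (continuous_mKer continuous_symS abs_symS_le x y).measurable

section
variable {F : ℝ → (Fin 4 → ℤ) → ℂ}

lemma measurable_matAct_symS (hF : ∀ y, Measurable fun s => F s y)
    (hF2 : ∀ s, lpN 2 (fun x => ‖F s x‖ₑ) ≠ ∞) (x : Fin 4 → ℤ) :
    Measurable fun z : ℝ × ℝ => matAct (mKer (symS (z.1 - z.2))) (F z.2) x := by
  refine measurable_tsum_of_summable (fun y => ?_) fun z =>
    summable_mKer_mul (formBound_symS_two _) (hF2 _) x
  exact ((measurable_mKer_symS x y).comp (by fun_prop : Measurable fun z : ℝ × ℝ => z.1 - z.2)).mul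
    ((hF y).comp measurable_snd)

lemma measurable_duhAbs (hF : ∀ y, Measurable fun s => F s y)
    (hF2 : ∀ s, lpN 2 (fun x => ‖F s x‖ₑ) ≠ ∞) (x : Fin 4 → ℤ) :
    Measurable fun t => duhAbs F t x :=
  Measurable.lintegral_prod_right' (f := fun z : ℝ × ℝ =>
    ‖matAct (mKer (symS (z.1 - z.2))) (F z.2) x‖ₑ) (measurable_matAct_symS hF hF2 x).enorm

lemma enorm_duhInt_le (F : ℝ → (Fin 4 → ℤ) → ℂ) (t : ℝ) (x : Fin 4 → ℤ) :
    ‖duhInt F t x‖ₑ ≤ duhAbs F t x := by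
  rw [duhInt, ← ofReal_norm, intervalIntegral.norm_intervalIntegral_eq, ofReal_norm]
  exact (enorm_integral_le_lintegral_enorm _).trans (setLIntegral_le_lintegral _ _)

lemma integrable_matAct_symS (hF : ∀ y, Measurable fun s => F s y)
    (hF2 : ∀ s, lpN 2 (fun x => ‖F s x‖ₑ) ≠ ∞) {t : ℝ} {x : Fin 4 → ℤ} (h : duhAbs F t x ≠ ∞) :
    Integrable fun s => matAct (mKer (symS (t - s))) (F s) x := by
  refine ⟨((measurable_matAct_symS hF hF2 x).comp
    (by fun_prop : Measurable fun s : ℝ => (t, s))).aestronglyMeasurable, ?_⟩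
  exact lt_top_iff_ne_top.2 h

lemma duhInt_add {G : ℝ → (Fin 4 → ℤ) → ℂ} (hF : ∀ y, Measurable fun s => F s y)
    (hF2 : ∀ s, lpN 2 (fun x => ‖F s x‖ₑ) ≠ ∞) (hG : ∀ y, Measurable fun s => G s y)
    (hG2 : ∀ s, lpN 2 (fun x => ‖G s x‖ₑ) ≠ ∞) {t : ℝ} {x : Fin 4 → ℤ} (h : duhAbs F t x ≠ ∞)
    (h' : duhAbs G t x ≠ ∞) :
    duhInt (fun s y => F s y + G s y) t x = duhInt F t x + duhInt G t x := by
  unfold duhInt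
  rw [← intervalIntegral.integral_add
    (integrable_matAct_symS hF hF2 h).intervalIntegrable
    (integrable_matAct_symS hG hG2 h').intervalIntegrable]
  refine intervalIntegral.integral_congr fun s _ => ?_
  show matAct _ _ _ = matAct _ _ _ + matAct _ _ _
  unfold matAct
  rw [← (summable_mKer_mul (formBound_symS_two _) (hF2 _) x).tsum_add
    (summable_mKer_mul (formBound_symS_two _) (hG2 _) x)]
  simp only [mul_add]

lemma lpN_two_duhAbs_le (hF : ∀ y, Measurable fun s => F s y)
    (hF2 : ∀ s, lpN 2 (fun x => ‖F s x‖ₑ) ≠ ∞) (t : ℝ) :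
    lpN 2 (duhAbs F t) ≤ ∫⁻ s, lpN 2 (fun x => ‖F s x‖ₑ) := by
  refine (lpN_lintegral_le (G := fun s x => ‖matAct (mKer (symS (t - s))) (F s) x‖ₑ)
    Real.HolderConjugate.two_two fun x => ?_).trans
    (lintegral_mono fun s => lpN_two_matAct_le (formBound_symS_two _) (hF2 s))
  exact ((measurable_matAct_symS hF hF2 x).comp (by fun_prop : Measurable fun s : ℝ => (t, s))).enorm

lemma lpN_duhAbs_le {p r : ℝ} (hpr : p.HolderConjugate r) (hF : ∀ y, Measurable fun s => F s y)
    (hF2 : ∀ s, lpN 2 (fun x => ‖F s x‖ₑ) ≠ ∞) (t : ℝ) :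
    lpN r (duhAbs F t) ≤ ∫⁻ s, lpN r (fun x => ‖matAct (mKer (symS (t - s))) (F s) x‖ₑ) :=
  lpN_lintegral_le (G := fun s x => ‖matAct (mKer (symS (t - s))) (F s) x‖ₑ) hpr fun x =>
    ((measurable_matAct_symS hF hF2 x).comp (by fun_prop : Measurable fun s : ℝ => (t, s))).enorm

lemma lintegral_lpN_duhAbs_sq_le_of_L1 {p r : ℝ} (hpr : p.HolderConjugate r) {B : ℝ} 
    (hB : ∀ f : (Fin 4 → ℤ) → ℂ, lpN 2 (fun x => ‖f x‖ₑ) ≠ ∞ →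
        ∫⁻ t, lpN r (fun x => ‖matAct (mKer (symS t)) f x‖ₑ) ^ 2 ≤
          ENNReal.ofReal B * lpN 2 (fun x => ‖f x‖ₑ) ^ 2)
    (hF : ∀ y, Measurable fun s => F s y) (hF2 : ∀ s, lpN 2 (fun x => ‖F s x‖ₑ) ≠ ∞) :
    ∫⁻ t, lpN r (duhAbs F t) ^ 2 ≤
      ENNReal.ofReal B * (∫⁻ s, lpN 2 (fun x => ‖F s x‖ₑ)) ^ 2 := by
  have hFm : Measurable fun s => lpN 2 (fun x => ‖F s x‖ₑ) := measurable_lpN (fun x => (hF x).enorm) 2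
  have hsq : (ENNReal.ofReal B ^ (1 / 2 : ℝ)) ^ 2 = ENNReal.ofReal B := by
    rw [← ENNReal.rpow_two, ← ENNReal.rpow_mul]; norm_num
  calc _ ≤ ∫⁻ t, (∫⁻ s, lpN r (fun x => ‖matAct (mKer (symS (t - s))) (F s) x‖ₑ)) ^ 2 :=
        lintegral_mono fun t => pow_le_pow_left' (lpN_duhAbs_le hpr hF hF2 t) 2
    _ ≤ (∫⁻ s, ENNReal.ofReal B ^ (1 / 2 : ℝ) * lpN 2 (fun x => ‖F s x‖ₑ)) ^ 2 := by
        refine lintegral_sq_lintegral_le ?_ (hFm.const_mul _) fun s => ?_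
        · exact measurable_lpN (F := fun (z : ℝ × ℝ) x =>
            ‖matAct (mKer (symS (z.1 - z.2))) (F z.2) x‖ₑ)
            (fun x => (measurable_matAct_symS hF hF2 x).enorm) r
        · rw [mul_pow, hsq]
          rw [lintegral_sub_right_eq_self
            (fun t => lpN r (fun x => ‖matAct (mKer (symS t)) (F s) x‖ₑ) ^ 2) s]
          exact hB _ (hF2 s)
    _ = _ := by rw [lintegral_const_mul _ hFm, mul_pow, hsq]

lemma lintegral_lpN_duhAbs_sq_le_of_L2 {p r c γ : ℝ} (hpr : p.HolderConjugate r) (hp2 : p ≤ 2)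
    (hc : 0 ≤ c) (hk : ∀ t, FormBound (mKer (symS t)) p (decayK c γ t))
    (hF : ∀ y, Measurable fun s => F s y) (hF2 : ∀ s, lpN p (fun x => ‖F s x‖ₑ) ≠ ∞) :
    ∫⁻ t, lpN r (duhAbs F t) ^ 2 ≤ (∫⁻ s, ENNReal.ofReal (decayK c γ s)) ^ 2 *
      ∫⁻ s, lpN p (fun x => ‖F s x‖ₑ) ^ 2 := by
  have hF2' : ∀ s, lpN 2 (fun x => ‖F s x‖ₑ) ≠ ∞ := fun s =>
    ne_top_of_le_ne_top (hF2 s) (lpN_anti hpr.pos hp2 _)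
  refine le_trans (lintegral_mono fun t => pow_le_pow_left' ((lpN_duhAbs_le hpr hF hF2' t).trans
    (lintegral_mono fun s => ?_)) 2) (lintegral_sq_conv_le
      (k := fun s => ENNReal.ofReal (decayK c γ s)) (n := fun s => lpN p (fun x => ‖F s x‖ₑ))
      (continuous_decayK c γ).measurable.ennreal_ofReal (measurable_lpN (fun x => (hF x).enorm) p))
  exact (formBound_symS_two _).lpN_matAct_le zero_le_one (hk _) (decayK_nonneg hc γ _) hpr hp2 (hF2 s)

end

lemma conj_mKer (m : (Fin 4 → ℝ) → ℝ) (x y : Fin 4 → ℤ) :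
    (starRingEnd ℂ) (mKer m x y) = mKer m y x := by
  rw [mKer, mKer, multKernel_eq_integral, multKernel_eq_integral, ← integral_conj]
  refine integral_congr_ae (Filter.Eventually.of_forall fun ξ => ?_)
  simp only [map_mul, Complex.conj_ofReal, chr_sub, Complex.conj_conj]
  rw [mul_comm (chr y ξ)]

/-- Conjugate truncation of `c` to the finite set `S`. -/
def conjOn (S : Finset (Fin 4 → ℤ)) (c : (Fin 4 → ℤ) → ℂ) (x : Fin 4 → ℤ) : ℂ :=
  if x ∈ S then (starRingEnd ℂ) (c x) else 0

lemma lpN_two_conjOn_sq (S : Finset (Fin 4 → ℤ)) (c : (Fin 4 → ℤ) → ℂ) :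
    lpN 2 (fun x => ‖conjOn S c x‖ₑ) ^ 2 = ∑ x ∈ S, ‖c x‖ₑ ^ 2 := by
  rw [← ENNReal.rpow_two, lpN_rpow two_pos, tsum_eq_sum (s := S)]
  · refine Finset.sum_congr rfl fun x hx => ?_
    simp [conjOn, hx]
  · intro x hx
    simp [conjOn, hx]

lemma lpN_two_conjOn_ne_top (S : Finset (Fin 4 → ℤ)) (c : (Fin 4 → ℤ) → ℂ) :
    lpN 2 (fun x => ‖conjOn S c x‖ₑ) ≠ ∞ := by
  have : lpN 2 (fun x => ‖conjOn S c x‖ₑ) ^ 2 ≠ ∞ := by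
    rw [lpN_two_conjOn_sq]
    exact ENNReal.sum_ne_top.2 fun x _ => by simp
  intro h
  simp [h] at this

lemma enorm_sum_mul_matAct_le {p r : ℝ} (hpr : p.HolderConjugate r) {m : (Fin 4 → ℝ) → ℝ}
    (hm : FormBound (mKer m) 2 1) (S : Finset (Fin 4 → ℤ)) (c : (Fin 4 → ℤ) → ℂ)
    {f : (Fin 4 → ℤ) → ℂ} (hf : lpN 2 (fun x => ‖f x‖ₑ) ≠ ∞) :
    ‖∑ x ∈ S, c x * matAct (mKer m) f x‖ₑ ≤
      lpN p (fun x => ‖f x‖ₑ) * lpN r (fun x => ‖matAct (mKer m) (conjOn S c) x‖ₑ) := by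
  have e : ∀ y, ∑ x ∈ S, c x * (mKer m x y * f y) =
      f y * (starRingEnd ℂ) (matAct (mKer m) (conjOn S c) y) := fun y => by
    have : matAct (mKer m) (conjOn S c) y = ∑ x ∈ S, mKer m y x * (starRingEnd ℂ) (c x) := by
      rw [matAct, tsum_eq_sum (s := S)]
      · exact Finset.sum_congr rfl fun x hx => by simp [conjOn, hx]
      · intro x hx; simp [conjOn, hx]
    rw [this, map_sum, Finset.mul_sum]
    refine Finset.sum_congr rfl fun x _ => ?_
    rw [map_mul, conj_mKer, Complex.conj_conj]
    ring
  have hsum : ∑ x ∈ S, c x * matAct (mKer m) f x =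
      ∑' y, f y * (starRingEnd ℂ) (matAct (mKer m) (conjOn S c) y) := by
    simp_rw [← e]
    rw [Summable.tsum_finsetSum fun x _ => (summable_mKer_mul hm hf x).mul_left (c x)]
    refine Finset.sum_congr rfl fun x _ => ?_
    rw [tsum_mul_left]; rfl
  rw [hsum]
  refine (enorm_tsum_le_tsum_enorm).trans ?_
  simp only [enorm_mul, RCLike.enorm_conj]
  exact tsum_mul_le_lpN hpr _ _

section
variable {F : ℝ → (Fin 4 → ℤ) → ℂ}

lemma measurable_lpN_matAct_symS (r : ℝ) {f : (Fin 4 → ℤ) → ℂ}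
    (hf : lpN 2 (fun x => ‖f x‖ₑ) ≠ ∞) :
    Measurable fun t => lpN r (fun x => ‖matAct (mKer (symS t)) f x‖ₑ) := by
  refine measurable_lpN (fun x => ?_) r
  have := measurable_matAct_symS (F := fun _ => f) (fun _ => measurable_const) (fun _ => hf) x
  simpa using (this.comp (by fun_prop : Measurable fun t : ℝ => (t, (0 : ℝ)))).enorm

lemma sq_lintegral_sum_mul_matAct_le {p r : ℝ} (hpr : p.HolderConjugate r) (hp2 : p ≤ 2) {B : ℝ}
    (hB : ∀ f : (Fin 4 → ℤ) → ℂ, lpN 2 (fun x => ‖f x‖ₑ) ≠ ∞ →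
        ∫⁻ t, lpN r (fun x => ‖matAct (mKer (symS t)) f x‖ₑ) ^ 2 ≤
          ENNReal.ofReal B * lpN 2 (fun x => ‖f x‖ₑ) ^ 2)
    (hF : ∀ y, Measurable fun s => F s y) (hF2 : ∀ s, lpN p (fun x => ‖F s x‖ₑ) ≠ ∞)
    (t : ℝ) (S : Finset (Fin 4 → ℤ)) (c : (Fin 4 → ℤ) → ℂ) :
    (∫⁻ s, ‖∑ x ∈ S, c x * matAct (mKer (symS (t - s))) (F s) x‖ₑ) ^ 2 ≤
      (∫⁻ s, lpN p (fun x => ‖F s x‖ₑ) ^ 2) * (ENNReal.ofReal B * ∑ x ∈ S, ‖c x‖ₑ ^ 2) := by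
  have hF2' : ∀ s, lpN 2 (fun x => ‖F s x‖ₑ) ≠ ∞ := fun s =>
    ne_top_of_le_ne_top (hF2 s) (lpN_anti hpr.pos hp2 _)
  have hc := lpN_two_conjOn_ne_top S c
  have hm := measurable_lpN_matAct_symS r hc
  refine (pow_le_pow_left' (lintegral_mono fun s =>
    enorm_sum_mul_matAct_le hpr (formBound_symS_two _) S c (hF2' s)) 2).trans ?_
  refine (sq_lintegral_mul_le (measurable_lpN (fun x => (hF x).enorm) p).aemeasurable
    (hm.comp (by fun_prop : Measurable fun s : ℝ => t - s)).aemeasurable).trans ?_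
  gcongr
  simp only [Function.comp_apply]
  rw [lintegral_sub_left_eq_self
    (fun t => lpN r (fun x => ‖matAct (mKer (symS t)) (conjOn S c) x‖ₑ) ^ 2) t,
    ← lpN_two_conjOn_sq]
  exact hB _ hc

lemma duhAbs_ne_top_of_L2 {p r : ℝ} (hpr : p.HolderConjugate r) (hp2 : p ≤ 2) {B : ℝ}
    (hB : ∀ f : (Fin 4 → ℤ) → ℂ, lpN 2 (fun x => ‖f x‖ₑ) ≠ ∞ →
        ∫⁻ t, lpN r (fun x => ‖matAct (mKer (symS t)) f x‖ₑ) ^ 2 ≤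
          ENNReal.ofReal B * lpN 2 (fun x => ‖f x‖ₑ) ^ 2)
    (hF : ∀ y, Measurable fun s => F s y) (hF2 : ∀ s, lpN p (fun x => ‖F s x‖ₑ) ≠ ∞)
    (hN : ∫⁻ s, lpN p (fun x => ‖F s x‖ₑ) ^ 2 ≠ ∞) (t : ℝ) (x : Fin 4 → ℤ) :
    duhAbs F t x ≠ ∞ := by
  have h := sq_lintegral_sum_mul_matAct_le hpr hp2 hB hF hF2 t {x} 1
  simp only [Finset.sum_singleton, Pi.one_apply, one_mul] at h
  have : duhAbs F t x ^ 2 ≠ ∞ := ne_top_of_le_ne_top (ENNReal.mul_ne_top hN (by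
    exact ENNReal.mul_ne_top ENNReal.ofReal_ne_top (by simp))) h
  intro h'
  simp [h'] at this

lemma lpN_two_duhInt_sq_le {p r : ℝ} (hpr : p.HolderConjugate r) (hp2 : p ≤ 2) {B : ℝ}
    (hB : ∀ f : (Fin 4 → ℤ) → ℂ, lpN 2 (fun x => ‖f x‖ₑ) ≠ ∞ →
        ∫⁻ t, lpN r (fun x => ‖matAct (mKer (symS t)) f x‖ₑ) ^ 2 ≤
          ENNReal.ofReal B * lpN 2 (fun x => ‖f x‖ₑ) ^ 2)
    (hF : ∀ y, Measurable fun s => F s y) (hF2 : ∀ s, lpN p (fun x => ‖F s x‖ₑ) ≠ ∞)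
    (hN : ∫⁻ s, lpN p (fun x => ‖F s x‖ₑ) ^ 2 ≠ ∞) (t : ℝ) :
    lpN 2 (fun x => ‖duhInt F t x‖ₑ) ^ 2 ≤
      ENNReal.ofReal B * ∫⁻ s, lpN p (fun x => ‖F s x‖ₑ) ^ 2 := by
  have hF2' : ∀ s, lpN 2 (fun x => ‖F s x‖ₑ) ≠ ∞ := fun s =>
    ne_top_of_le_ne_top (hF2 s) (lpN_anti hpr.pos hp2 _)
  have hfin := duhAbs_ne_top_of_L2 hpr hp2 hB hF hF2 hN t
  have hii := fun x => (integrable_matAct_symS hF hF2' (hfin x)).intervalIntegrable (a := 0) (b := t)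
  rw [← ENNReal.rpow_two, lpN_rpow two_pos, ENNReal.tsum_eq_iSup_sum]
  refine iSup_le fun S => ?_
  simp only [ENNReal.rpow_two]
  set w := duhInt F t with hw
  set Q := ∑ x ∈ S, ‖w x‖ₑ ^ 2 with hQ
  have hQtop : Q ≠ ∞ := ENNReal.sum_ne_top.2 fun x _ => by simp
  set c : (Fin 4 → ℤ) → ℂ := fun x => (starRingEnd ℂ) (w x) with hc
  have hcn : ∑ x ∈ S, ‖c x‖ₑ ^ 2 = Q := by simp [hc, hQ]
  have h := sq_lintegral_sum_mul_matAct_le hpr hp2 hB hF hF2 t S c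
  rw [hcn] at h
  have e1 : ‖∑ x ∈ S, c x * w x‖ₑ = Q := by
    have : ∑ x ∈ S, c x * w x = ((∑ x ∈ S, ‖w x‖ ^ 2 : ℝ) : ℂ) := by
      push_cast
      refine Finset.sum_congr rfl fun x _ => ?_
      rw [hc, ← Complex.conj_mul']
    rw [this, ← ofReal_norm, Complex.norm_real, Real.norm_of_nonneg (by positivity),
      ENNReal.ofReal_sum_of_nonneg (fun _ _ => by positivity)]
    refine Finset.sum_congr rfl fun x _ => ?_
    rw [ENNReal.ofReal_pow (norm_nonneg _), ofReal_norm]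
  have e2 : ∑ x ∈ S, c x * w x =
      ∫ s in (0 : ℝ)..t, ∑ x ∈ S, c x * matAct (mKer (symS (t - s))) (F s) x := by
    rw [intervalIntegral.integral_finsetSum fun x _ => (hii x).const_mul (c x)]
    refine Finset.sum_congr rfl fun x _ => ?_
    rw [intervalIntegral.integral_const_mul]; rfl
  have e3 : Q ≤ ∫⁻ s, ‖∑ x ∈ S, c x * matAct (mKer (symS (t - s))) (F s) x‖ₑ := by
    rw [← e1, e2, ← ofReal_norm, intervalIntegral.norm_intervalIntegral_eq, ofReal_norm]
    exact (enorm_integral_le_lintegral_enorm _).trans (setLIntegral_le_lintegral _ _)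
  have e4 := (pow_le_pow_left' e3 2).trans h
  rcases eq_or_ne Q 0 with h0 | h0
  · rw [h0]; exact zero_le
  · rw [sq, ← mul_assoc, mul_comm (lintegral _ _)] at e4
    exact (ENNReal.mul_le_mul_iff_left h0 hQtop).1 e4

end

lemma ENNReal.add_sq_le_two_mul (a b : ℝ≥0∞) : (a + b) ^ 2 ≤ 2 * (a ^ 2 + b ^ 2) := by
  have := ENNReal.rpow_add_le_mul_rpow_add_rpow a b one_le_two
  simp only [ENNReal.rpow_two] at this
  refine this.trans_eq ?_
  norm_num

/-- Pointwise majorant of the solution of the discrete Klein–Gordon equation. -/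
def solAbs (f g : (Fin 4 → ℤ) → ℂ) (F : ℝ → (Fin 4 → ℤ) → ℂ) (t : ℝ) (x : Fin 4 → ℤ) : ℝ≥0∞ :=
  ‖matAct (mKer (symC t)) f x‖ₑ + ‖matAct (mKer (symS t)) g x‖ₑ + ‖duhInt F t x‖ₑ

lemma measurable_lpN_matAct_symC (r : ℝ) {f : (Fin 4 → ℤ) → ℂ}
    (hf : lpN 2 (fun x => ‖f x‖ₑ) ≠ ∞) :
    Measurable fun t => lpN r (fun x => ‖matAct (mKer (symC t)) f x‖ₑ) := by
  refine measurable_lpN (fun x => ?_) r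
  exact (measurable_tsum_of_summable (fun y =>
    ((continuous_mKer continuous_symC abs_symC_le x y).measurable).mul_const _) fun t =>
      summable_mKer_mul (formBound_symC_two t) hf x).enorm

lemma exists_energy_bounds {p r ε : ℝ} (hpr : p.HolderConjugate r) (hp2 : p ≤ 2)
    (hε : 0 < ε) (hε' : ε ≤ 1 / 2) (hγ1 : 1 < (3 / 2 - ε) * (2 / p - 1)) :
    ∃ K : ℝ≥0∞, K ≠ ∞ ∧ ∀ (f g : (Fin 4 → ℤ) → ℂ) (F₀ F₁ : ℝ → (Fin 4 → ℤ) → ℂ) (M : ℝ≥0∞),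
      M ≠ ∞ → lpN 2 (fun x => ‖f x‖ₑ) ≤ M → lpN 2 (fun x => ‖g x‖ₑ) ≤ M →
      (∀ y, Measurable fun s => F₀ s y) → (∀ y, Measurable fun s => F₁ s y) →
      (∀ s, lpN 2 (fun x => ‖F₀ s x‖ₑ) ≠ ∞) → (∀ s, lpN p (fun x => ‖F₁ s x‖ₑ) ≠ ∞) →
      ∫⁻ s, lpN 2 (fun x => ‖F₀ s x‖ₑ) ≤ M → ∫⁻ s, lpN p (fun x => ‖F₁ s x‖ₑ) ^ 2 ≤ M ^ 2 →
      (∀ t, lpN 2 (solAbs f g (fun s y => F₀ s y + F₁ s y) t) ≤ K * M) ∧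
        ∫⁻ t, lpN r (solAbs f g (fun s y => F₀ s y + F₁ s y) t) ^ 2 ≤ K * M ^ 2 := by
  obtain ⟨c, B, hc, hB, hk, hC, hS⟩ := exists_propagator_bounds hpr hp2 hε hε' rfl hγ1
  set γ := (3 / 2 - ε) * (2 / p - 1) with hγ
  set κ := ∫⁻ s, ENNReal.ofReal (decayK c γ s) with hκ
  have hκt : κ ≠ ∞ := by
    have := (integrable_decayK c hγ1).lintegral_lt_top
    exact this.ne
  have hr1 := hpr.symm.lt.le
  have hr0 := hpr.symm.pos
  have hsq : (ENNReal.ofReal B ^ (1 / 2 : ℝ)) ^ 2 = ENNReal.ofReal B := by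
    rw [← ENNReal.rpow_two, ← ENNReal.rpow_mul]; norm_num
  set b := ENNReal.ofReal B with hb
  set β := b ^ (1 / 2 : ℝ) with hβ
  have hβt : β ≠ ∞ := ENNReal.rpow_ne_top_of_nonneg (by norm_num) ENNReal.ofReal_ne_top
  refine ⟨max (1 + 1 + (1 + β)) (2 * (2 * (b + b) + 2 * (b + κ ^ 2))), ?_, ?_⟩
  · have : b ≠ ∞ := ENNReal.ofReal_ne_top
    have : 2 * (2 * (b + b) + 2 * (b + κ ^ 2)) ≠ ∞ := by finiteness
    exact (max_lt (by finiteness) (by finiteness)).ne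
  intro f g F₀ F₁ M hM hf hg hF₀ hF₁ hF₀2 hF₁p hN₀ hN₁
  have hf' := ne_top_of_le_ne_top hM hf
  have hg' := ne_top_of_le_ne_top hM hg
  have hF₁2 : ∀ s, lpN 2 (fun x => ‖F₁ s x‖ₑ) ≠ ∞ := fun s =>
    ne_top_of_le_ne_top (hF₁p s) (lpN_anti hpr.pos hp2 _)
  have hN₁' : ∫⁻ s, lpN p (fun x => ‖F₁ s x‖ₑ) ^ 2 ≠ ∞ :=
    ne_top_of_le_ne_top (by finiteness) hN₁
  have hfin₁ := duhAbs_ne_top_of_L2 hpr hp2 hS hF₁ hF₁p hN₁'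
  have hA₀ : ∀ t, lpN 2 (duhAbs F₀ t) ≤ M := fun t => (lpN_two_duhAbs_le hF₀ hF₀2 t).trans hN₀
  have hfin₀ : ∀ t x, duhAbs F₀ t x ≠ ∞ := fun t x =>
    ne_top_of_le_ne_top hM ((le_lpN two_pos _ x).trans (hA₀ t))
  have hadd : ∀ t x, ‖duhInt (fun s y => F₀ s y + F₁ s y) t x‖ₑ ≤
      ‖duhInt F₀ t x‖ₑ + ‖duhInt F₁ t x‖ₑ := fun t x => by
    rw [duhInt_add hF₀ hF₀2 hF₁ hF₁2 (hfin₀ t x) (hfin₁ t x)]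
    exact enorm_add_le _ _
  have hlp : ∀ {z : ℝ}, 1 ≤ z → ∀ t, lpN z (solAbs f g (fun s y => F₀ s y + F₁ s y) t) ≤
      lpN z (fun x => ‖matAct (mKer (symC t)) f x‖ₑ) +
      lpN z (fun x => ‖matAct (mKer (symS t)) g x‖ₑ) +
      (lpN z (fun x => ‖duhInt F₀ t x‖ₑ) + lpN z (fun x => ‖duhInt F₁ t x‖ₑ)) := fun {z} hz t =>
    (lpN_mono (by linarith) fun x => add_le_add le_rfl (hadd t x)).trans
      ((lpN_add_le hz _ _).trans (add_le_add (lpN_add_le hz _ _) (lpN_add_le hz _ _)))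
  constructor
  · intro t
    refine le_trans ?_ (mul_le_mul_left (le_max_left _ _) M)
    refine (hlp one_le_two t).trans ?_
    rw [add_mul, add_mul, add_mul, one_mul]
    refine add_le_add (add_le_add ?_ ?_) (add_le_add ?_ ?_)
    · exact (lpN_two_matAct_le (formBound_symC_two t) hf').trans hf
    · exact (lpN_two_matAct_le (formBound_symS_two t) hg').trans hg
    · exact (lpN_mono two_pos fun x => enorm_duhInt_le F₀ t x).trans (hA₀ t)
    · rw [← ENNReal.pow_le_pow_left_iff two_ne_zero, mul_pow, hsq]
      refine (lpN_two_duhInt_sq_le hpr hp2 hS hF₁ hF₁p hN₁' t).trans ?_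
      gcongr
  · refine le_trans ?_ (mul_le_mul_left (le_max_right _ _) (M ^ 2))
    have hm1 := measurable_lpN_matAct_symC r hf'
    have hm2 := measurable_lpN_matAct_symS r hg'
    have hm3 : Measurable fun t => lpN r (duhAbs F₀ t) :=
      measurable_lpN (fun x => measurable_duhAbs hF₀ hF₀2 x) r
    have hm4 : Measurable fun t => lpN r (duhAbs F₁ t) :=
      measurable_lpN (fun x => measurable_duhAbs hF₁ hF₁2 x) r
    have hpt : ∀ t, lpN r (solAbs f g (fun s y => F₀ s y + F₁ s y) t) ^ 2 ≤
        2 * (2 * (lpN r (fun x => ‖matAct (mKer (symC t)) f x‖ₑ) ^ 2 +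
          lpN r (fun x => ‖matAct (mKer (symS t)) g x‖ₑ) ^ 2) +
        2 * (lpN r (duhAbs F₀ t) ^ 2 + lpN r (duhAbs F₁ t) ^ 2)) := fun t => by
      refine (pow_le_pow_left' ((hlp hr1 t).trans (add_le_add le_rfl (add_le_add
        (lpN_mono hr0 fun x => enorm_duhInt_le F₀ t x)
        (lpN_mono hr0 fun x => enorm_duhInt_le F₁ t x)))) 2).trans ?_
      refine (ENNReal.add_sq_le_two_mul _ _).trans ?_
      gcongr <;> exact ENNReal.add_sq_le_two_mul _ _
    refine (lintegral_mono hpt).trans ?_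
    rw [lintegral_const_mul _ (by fun_prop), lintegral_add_left (by fun_prop),
      lintegral_const_mul _ (by fun_prop), lintegral_const_mul _ (by fun_prop),
      lintegral_add_left (by fun_prop), lintegral_add_left (by fun_prop)]
    rw [mul_assoc, add_mul, mul_assoc, mul_assoc, add_mul, add_mul]
    gcongr
    · exact (hC f hf').trans (by gcongr)
    · exact (hS g hg').trans (by gcongr)
    · exact (lintegral_lpN_duhAbs_sq_le_of_L1 hpr hS hF₀ hF₀2).trans (by gcongr)
    · exact (lintegral_lpN_duhAbs_sq_le_of_L2 hpr hp2 hc.le hk hF₁ hF₁p).trans (by gcongr)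

lemma lpN_interp {α : Type*} {p₀ p₁ ρ θ : ℝ} (hp₀ : 0 < p₀) (hp₁ : 0 < p₁) (hρ : 0 < ρ)
    (hθ0 : 0 ≤ θ) (hθ1 : θ ≤ 1) (h : 1 / ρ = (1 - θ) / p₀ + θ / p₁) (f : α → ℝ≥0∞) :
    lpN ρ f ≤ lpN p₀ f ^ (1 - θ) * lpN p₁ f ^ θ := by
  let _ : MeasurableSpace α := ⊤
  have hθ' : 0 ≤ 1 - θ := by linarith
  have hs : (1 - θ) * ρ / p₀ + θ * ρ / p₁ = 1 := by
    have : ρ * (1 / ρ) = 1 := by field_simp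
    rw [h] at this
    linear_combination this
  have key := ENNReal.lintegral_mul_norm_pow_le (μ := Measure.count) (f := fun x => f x ^ p₀)
    (g := fun x => f x ^ p₁) (p := (1 - θ) * ρ / p₀) (q := θ * ρ / p₁)
    measurable_from_top.aemeasurable measurable_from_top.aemeasurable (by positivity)
    (by positivity) hs
  simp only [lintegral_count] at key
  have e : ∀ x, (f x ^ p₀) ^ ((1 - θ) * ρ / p₀) * (f x ^ p₁) ^ (θ * ρ / p₁) = f x ^ ρ := fun x => by
    rw [← ENNReal.rpow_mul, ← ENNReal.rpow_mul, mul_div_cancel₀ _ hp₀.ne',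
      mul_div_cancel₀ _ hp₁.ne', ← ENNReal.rpow_add_of_nonneg _ _ (by positivity) (by positivity)]
    congr 1; ring
  simp only [e] at key
  have h2 := ENNReal.rpow_le_rpow key (by positivity : 0 ≤ 1 / ρ)
  refine h2.trans_eq ?_
  rw [ENNReal.mul_rpow_of_nonneg _ _ (by positivity)]
  unfold lpN
  simp only [← ENNReal.rpow_mul]
  congr 2 <;> field_simp

lemma eLpNorm_count_le_lpN {α : Type*} [MeasurableSpace α] [MeasurableSingletonClass α]
    {ρ : ℝ} (hρ : 0 < ρ) {r : ℝ≥0∞} (h : ENNReal.ofReal ρ ≤ r) (f : α → ℂ) :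
    eLpNorm f r Measure.count ≤ lpN ρ (fun x => ‖f x‖ₑ) := by
  rcases eq_or_ne r ∞ with hr | hr
  · rw [hr, eLpNorm_exponent_top]
    exact eLpNormEssSup_le_of_ae_enorm_bound
      (Filter.Eventually.of_forall fun x => le_lpN hρ (fun x => ‖f x‖ₑ) x)
  · have h' : ρ ≤ r.toReal := by rwa [ENNReal.ofReal_le_iff_le_toReal hr] at h
    have : r = ENNReal.ofReal r.toReal := (ENNReal.ofReal_toReal hr).symm
    rw [this, eLpNorm_count_eq_lpN (hρ.trans_le h')]
    exact lpN_anti hρ h' _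

lemma lqNorm_eLpNorm_le {α : Type*} [MeasurableSpace α] [MeasurableSingletonClass α]
    {q r : ℝ≥0∞} (hq : 2 ≤ q) (hr : 2 ≤ r) {r₀ : ℝ} (hr₀ : 2 ≤ r₀)
    (h : 2 * (1 / q).toReal * (1 / 2 - 1 / r₀) ≤ 1 / 2 - (1 / r).toReal)
    {U : ℝ → α → ℝ≥0∞} {A : ℝ≥0∞} (hA : A ≠ ∞)
    (hU : ∀ t, lpN 2 (U t) ≤ A)
    (hU' : ∫⁻ t, lpN r₀ (U t) ^ 2 ≤ A ^ 2) {u : ℝ → α → ℂ} (hu : ∀ t x, ‖u t x‖ₑ ≤ U t x) :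
    lqNorm q (fun t => eLpNorm (u t) r Measure.count) ≤ A := by
  have hr2 : ENNReal.ofReal 2 ≤ r := by simpa using hr
  rcases eq_or_ne q ∞ with hqt | hqt
  · rw [lqNorm, if_pos hqt]
    refine essSup_le_of_ae_le _ (Filter.Eventually.of_forall fun t => ?_)
    exact (eLpNorm_count_le_lpN two_pos hr2 _).trans
      ((lpN_mono two_pos (hu t)).trans (hU t))
  rw [lqNorm, if_neg hqt]
  set Q := q.toReal with hQ
  have hQ2 : 2 ≤ Q := by simpa using ENNReal.toReal_mono hqt hq
  have hQ0 : 0 < Q := by linarith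
  have hr₀0 : 0 < r₀ := by linarith
  have hq1 : (1 / q).toReal = 1 / Q := by simp [hQ]
  rw [hq1] at h
  set θ := 2 / Q with hθ
  have hθ0 : 0 ≤ θ := by positivity
  have hθ1 : θ ≤ 1 := by rw [hθ, div_le_one hQ0]; exact hQ2
  have hbpos : 0 < (1 - θ) / 2 + θ / r₀ := by
    rcases hθ1.lt_or_eq with h1 | h1
    · have : 0 < 1 - θ := by linarith
      positivity
    · rw [h1]; positivity
  set ρ := 1 / ((1 - θ) / 2 + θ / r₀) with hρ
  have hρ0 : 0 < ρ := by positivity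
  have hρi : 1 / ρ = (1 - θ) / 2 + θ / r₀ := by rw [hρ, one_div_one_div]
  have hρr : ENNReal.ofReal ρ ≤ r := by
    rcases eq_or_ne r ∞ with hrt | hrt
    · simp [hrt]
    rw [ENNReal.ofReal_le_iff_le_toReal hrt]
    have hR : 2 ≤ r.toReal := by simpa using ENNReal.toReal_mono hrt hr
    have h1 : (1 / r).toReal = 1 / r.toReal := by simp
    rw [h1] at h
    rw [← one_div_le_one_div (by linarith) hρ0, hρi]
    have : 2 * (1 / Q) = θ := by rw [hθ]; ring
    rw [this] at h
    calc 1 / r.toReal ≤ 1 / 2 - θ * (1 / 2 - 1 / r₀) := by linarith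
      _ = _ := by ring
  have hpt : ∀ t, eLpNorm (u t) r Measure.count ^ Q ≤ A ^ (Q - 2) * lpN r₀ (U t) ^ 2 := fun t => by
    calc eLpNorm (u t) r Measure.count ^ Q
        ≤ (lpN 2 (U t) ^ (1 - θ) * lpN r₀ (U t) ^ θ) ^ Q := by
          refine ENNReal.rpow_le_rpow ?_ hQ0.le
          exact (eLpNorm_count_le_lpN hρ0 hρr _).trans ((lpN_mono hρ0 (hu t)).trans
            (lpN_interp two_pos hr₀0 hρ0 hθ0 hθ1 hρi _))
      _ = lpN 2 (U t) ^ (Q - 2) * lpN r₀ (U t) ^ 2 := by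
          rw [ENNReal.mul_rpow_of_nonneg _ _ hQ0.le, ← ENNReal.rpow_mul, ← ENNReal.rpow_mul,
            show (1 - θ) * Q = Q - 2 by rw [hθ]; field_simp,
            show θ * Q = 2 by rw [hθ]; field_simp, ENNReal.rpow_two]
      _ ≤ _ := by
          gcongr
          exact hU t
  rw [one_div, ENNReal.rpow_inv_le_iff hQ0]
  refine (lintegral_mono hpt).trans ?_
  rw [lintegral_const_mul' _ _ (ENNReal.rpow_ne_top_of_nonneg (by linarith) hA)]
  refine (mul_le_mul_right hU' _).trans_eq ?_
  rw [← ENNReal.rpow_two A, ← ENNReal.rpow_add_of_nonneg _ _ (by linarith) zero_le_two]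
  congr 1; ring

lemma lpN_le_of_rpow_le {α : Type*} {p z : ℝ} (hp : 0 < p) (hz : 0 < z) {f g : α → ℝ≥0∞}
    {A N : ℝ≥0∞} (h : ∀ x, f x ^ z ≤ A * g x ^ p) (hN : lpN p g ≤ N) :
    lpN z f ≤ (A * N ^ p) ^ (1 / z) := by
  rw [one_div, ENNReal.le_rpow_inv_iff hz, lpN_rpow hz]
  refine (ENNReal.tsum_le_tsum h).trans ?_
  rw [ENNReal.tsum_mul_left, ← lpN_rpow hp]
  gcongr

lemma splitting_height_identity {N Λ : ℝ≥0∞} (hN0 : N ≠ 0) (hN : N ≠ ∞) (hΛ0 : Λ ≠ 0)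
    (hΛ : Λ ≠ ∞) {η p z κ : ℝ} (hz : 0 < z) (hκ : η * (z - p) / z = κ) :
    ((N ^ (1 + η) * Λ ^ (-η)) ^ (z - p) * N ^ p) ^ (1 / z) = N ^ (1 + κ) * Λ ^ (-κ) := by
  have h1 : N ^ (1 + η) ≠ 0 := by simp [ENNReal.rpow_eq_zero_iff, hN0, hN]
  have h2 : N ^ (1 + η) ≠ ∞ := by simp [ENNReal.rpow_eq_top_iff, hN0, hN]
  have h3 : Λ ^ (-η) ≠ 0 := by simp [ENNReal.rpow_eq_zero_iff, hΛ0, hΛ]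
  have h4 : Λ ^ (-η) ≠ ∞ := by simp [ENNReal.rpow_eq_top_iff, hΛ0, hΛ]
  rw [ENNReal.mul_rpow_of_ne_top h2 h4, ← ENNReal.rpow_mul, ← ENNReal.rpow_mul, mul_right_comm,
    ← ENNReal.rpow_add _ _ hN0 hN, ENNReal.mul_rpow_of_nonneg _ _ (by positivity),
    ← ENNReal.rpow_mul, ← ENNReal.rpow_mul, ← hκ]
  congr 2 <;> field_simp
  ring

lemma exists_splitting {α : Type*} {p p₀ σ θ : ℝ} (hp : 0 < p) (hp₀ : 0 < p₀) (hp₀p : p₀ ≤ p)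
    (hp2 : p ≤ 2) (hp₀2 : p₀ < 2) (hσ : 0 < σ) (hσθ : 1 / σ = 1 - θ / 2)
    (hpθ : 1 / p = (1 - θ) / 2 + θ / p₀) {F : ℝ → α → ℂ} (hF : ∀ y, Measurable fun s => F s y)
    {N : ℝ → ℝ≥0∞} (hNm : Measurable N) (hN0 : ∀ s, N s ≠ 0) (hNt : ∀ s, N s ≠ ∞)
    (hFN : ∀ s, lpN p (fun y => ‖F s y‖ₑ) ≤ N s) {Λ : ℝ≥0∞} (hΛ0 : Λ ≠ 0) (hΛ : Λ ≠ ∞)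
    (hNΛ : ∫⁻ s, N s ^ σ ≤ Λ ^ σ) :
    ∃ F₀ F₁ : ℝ → α → ℂ, (∀ y, Measurable fun s => F₀ s y) ∧ (∀ y, Measurable fun s => F₁ s y) ∧
      F = (fun s y => F₀ s y + F₁ s y) ∧ (∀ s, lpN 2 (fun y => ‖F₀ s y‖ₑ) ≠ ∞) ∧
      (∀ s, lpN p₀ (fun y => ‖F₁ s y‖ₑ) ≠ ∞) ∧ ∫⁻ s, lpN 2 (fun y => ‖F₀ s y‖ₑ) ≤ Λ ∧
      ∫⁻ s, lpN p₀ (fun y => ‖F₁ s y‖ₑ) ^ 2 ≤ Λ ^ 2 := by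
  set δ := 1 / p₀ - 1 / 2 with hδ
  have hδ0 : 0 < δ := by
    have := one_div_lt_one_div_of_lt hp₀ hp₀2
    rw [hδ]; linarith
  set η := σ * (1 / p) / (2 * δ) with hη
  have hηδ : η * p * δ = σ / 2 := by rw [hη]; field_simp
  have hPθ : 1 / p - 1 / 2 = θ * δ := by rw [hpθ, hδ]; ring
  have hσθ' : σ * θ / 2 = σ - 1 := by
    have : σ * (1 / σ) = 1 := by field_simp
    rw [hσθ] at this; linarith
  have hpp : p * (1 / p) = 1 := by field_simp
  have hκ2 : η * (2 - p) / 2 = σ - 1 := by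
    rw [← hσθ']
    linear_combination (-η) * hpp + (η * p) * hPθ + θ * hηδ
  have hκp : η * (p₀ - p) / p₀ = σ / 2 - 1 := by
    have e : η * (p₀ - p) / p₀ = η * (1 - p * (1 / p₀)) := by field_simp
    have e2 : 1 / p₀ = δ + 1 / 2 := by rw [hδ]; ring
    rw [e, e2]
    linear_combination (-η) * hpp + (η * p) * hPθ + (θ - 1) * hηδ + hσθ'
  set a : ℝ → ℝ≥0∞ := fun s => N s ^ (1 + η) * Λ ^ (-η) with ha
  have ham : Measurable a := by fun_prop
  have ha0 : ∀ s, a s ≠ 0 := fun s => by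
    simp [ha, ENNReal.rpow_eq_zero_iff, hN0, hNt, hΛ0, hΛ]
  have hset : ∀ y, MeasurableSet {s | ‖F s y‖ₑ ≤ a s} := fun y =>
    measurableSet_le (hF y).enorm ham
  set F₀ : ℝ → α → ℂ := fun s y => if ‖F s y‖ₑ ≤ a s then F s y else 0 with hF₀
  set F₁ : ℝ → α → ℂ := fun s y => if ‖F s y‖ₑ ≤ a s then 0 else F s y with hF₁
  have h0 : ∀ s, lpN 2 (fun y => ‖F₀ s y‖ₑ) ≤ N s ^ σ * Λ ^ (1 - σ) := fun s => by
    have := lpN_le_of_rpow_le (f := fun y => ‖F₀ s y‖ₑ) (A := a s ^ (2 - p)) hp two_pos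
      (fun y => ?_) (hFN s)
    · refine this.trans_eq ?_
      rw [splitting_height_identity (hN0 s) (hNt s) hΛ0 hΛ two_pos hκ2]
      congr 2 <;> ring
    · simp only [hF₀]
      split_ifs with h
      · calc ‖F s y‖ₑ ^ (2 : ℝ) = ‖F s y‖ₑ ^ (2 - p) * ‖F s y‖ₑ ^ p := by
              rw [← ENNReal.rpow_add_of_nonneg _ _ (by linarith) hp.le]; congr 1; ring
          _ ≤ _ := by
              gcongr
      · simp
  have h1 : ∀ s, lpN p₀ (fun y => ‖F₁ s y‖ₑ) ≤ N s ^ (σ / 2) * Λ ^ (1 - σ / 2) := fun s => by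
    have := lpN_le_of_rpow_le (f := fun y => ‖F₁ s y‖ₑ) (A := a s ^ (p₀ - p)) hp hp₀
      (fun y => ?_) (hFN s)
    · refine this.trans_eq ?_
      rw [splitting_height_identity (hN0 s) (hNt s) hΛ0 hΛ hp₀ hκp]
      congr 2 <;> ring
    · simp only [hF₁]
      split_ifs with h
      · simp [hp₀]
      · push Not at h
        have hv0 : ‖F s y‖ₑ ≠ 0 := (pos_of_gt h).ne'
        calc ‖F s y‖ₑ ^ p₀ = ‖F s y‖ₑ ^ (p₀ - p) * ‖F s y‖ₑ ^ p := by
              rw [← ENNReal.rpow_add _ _ hv0 enorm_ne_top]; congr 1; ring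
          _ ≤ _ := by
              refine mul_le_mul_left ?_ _
              rw [← neg_sub p p₀, ENNReal.rpow_neg, ENNReal.rpow_neg, ENNReal.inv_le_inv]
              exact ENNReal.rpow_le_rpow h.le (by linarith)
  refine ⟨F₀, F₁, fun y => Measurable.ite (hset y) (hF y) measurable_const,
    fun y => Measurable.ite (hset y) measurable_const (hF y), ?_, fun s => ?_, fun s => ?_, ?_, ?_⟩
  · funext s y
    simp only [hF₀, hF₁]
    split_ifs <;> simp
  · refine ne_top_of_le_ne_top ?_ (h0 s)
    simp [ENNReal.mul_eq_top, ENNReal.rpow_eq_top_iff, hN0, hNt, hΛ0, hΛ]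
  · refine ne_top_of_le_ne_top ?_ (h1 s)
    simp [ENNReal.mul_eq_top, ENNReal.rpow_eq_top_iff, hN0, hNt, hΛ0, hΛ]
  · refine (lintegral_mono h0).trans ?_
    rw [lintegral_mul_const _ (by fun_prop)]
    refine (mul_le_mul_left hNΛ _).trans_eq ?_
    rw [← ENNReal.rpow_add _ _ hΛ0 hΛ]
    simp
  · refine (lintegral_mono fun s => pow_le_pow_left' (h1 s) 2).trans ?_
    have e : ∀ s, (N s ^ (σ / 2) * Λ ^ (1 - σ / 2)) ^ 2 = N s ^ σ * Λ ^ (2 - σ) := fun s => by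
      rw [mul_pow, ← ENNReal.rpow_two, ← ENNReal.rpow_two, ← ENNReal.rpow_mul, ← ENNReal.rpow_mul]
      congr 2 <;> ring
    simp_rw [e]
    rw [lintegral_mul_const _ (by fun_prop)]
    refine (mul_le_mul_left hNΛ _).trans_eq ?_
    rw [← ENNReal.rpow_add _ _ hΛ0 hΛ, ← ENNReal.rpow_two]
    congr 1; ring

/-- Real functions with an integrable majorant. -/
def dominatedSubmodule {Ω : Type*} [MeasurableSpace Ω] (ν : Measure Ω) :
    Submodule ℝ (Ω → ℝ) where
  carrier := {h | ∃ g : Ω → ℝ, Integrable g ν ∧ ∀ s, |h s| ≤ g s}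
  zero_mem' := ⟨0, integrable_zero _ _ _, fun s => by simp⟩
  add_mem' := by
    rintro h₁ h₂ ⟨g₁, hg₁, hh₁⟩ ⟨g₂, hg₂, hh₂⟩
    exact ⟨g₁ + g₂, hg₁.add hg₂, fun s => (abs_add_le _ _).trans (add_le_add (hh₁ s) (hh₂ s))⟩
  smul_mem' := by
    rintro c h ⟨g, hg, hh⟩
    refine ⟨fun s => |c| * g s, hg.const_mul _, fun s => ?_⟩
    simp only [Pi.smul_apply, smul_eq_mul, abs_mul]
    exact mul_le_mul_of_nonneg_left (hh s) (abs_nonneg c)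

lemma ae_nonneg_of_nonneg_on {Ω : Type*} [MeasurableSpace Ω] {ν : Measure Ω} {Y : Set Ω}
    (hY : ∀ Z, MeasurableSet Z → Disjoint Z Y → ν Z = 0) {h : Ω → ℝ} (hm : AEMeasurable h ν)
    (hh : ∀ s ∈ Y, 0 ≤ h s) : ∀ᵐ s ∂ν, 0 ≤ h s := by
  obtain ⟨h', hh'm, hh'⟩ := hm
  obtain ⟨Z, hZ, hZm, hZ0⟩ := exists_measurable_superset_of_null (ae_iff.1 hh')
  have h0 : ν ({t | h' t < 0} \ Z) = 0 := by
    refine hY _ ((measurableSet_lt hh'm measurable_const).diff hZm) ?_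
    rw [Set.disjoint_left]
    rintro t ⟨ht, htZ⟩ htY
    have e : h t = h' t := by
      by_contra hne
      exact htZ (hZ hne)
    have := hh t htY
    rw [e] at this
    exact absurd this (not_le.2 ht)
  have h1 : ∀ᵐ t ∂ν, t ∉ {t | h' t < 0} \ Z := measure_eq_zero_iff_ae_notMem.1 h0
  have h2 : ∀ᵐ t ∂ν, t ∉ Z := measure_eq_zero_iff_ae_notMem.1 hZ0
  filter_upwards [h1, h2, hh'] with t ht1 ht2 ht3
  rw [ht3]
  by_contra hlt
  exact ht1 ⟨not_le.1 hlt, ht2⟩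

lemma exists_positive_extension {Ω : Type*} [MeasurableSpace Ω] (ν : Measure Ω) {Y : Set Ω}
    (hY : ∀ Z, MeasurableSet Z → Disjoint Z Y → ν Z = 0) :
    ∃ M : (Ω → ℝ) →ₗ[ℝ] ℝ, (∀ h, Integrable h ν → M h = ∫ s, h s ∂ν) ∧
      ∀ h ∈ dominatedSubmodule ν, (∀ s ∈ Y, 0 ≤ h s) → 0 ≤ M h := by
  set E := dominatedSubmodule ν with hE
  have hii : ∀ h, Integrable h ν → h ∈ E := fun h hh => ⟨fun s => |h s|, hh.abs, fun s => le_rfl⟩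
  let D : Submodule ℝ E :=
    { carrier := {h | Integrable h.1 ν}
      zero_mem' := integrable_zero _ _ _
      add_mem' := fun h₁ h₂ => Integrable.add h₁ h₂
      smul_mem' := fun c h hh => Integrable.smul c hh }
  let f : E →ₗ.[ℝ] ℝ := ⟨D,
    { toFun := fun h => ∫ s, h.1.1 s ∂ν
      map_add' := fun h₁ h₂ => integral_add h₁.2 h₂.2
      map_smul' := fun c h => integral_const_mul c _ }⟩
  let s : PointedCone ℝ E :=
    { carrier := {h | ∀ t ∈ Y, 0 ≤ h.1 t}
      zero_mem' := fun t _ => le_rfl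
      smul_mem' := fun c h hh t ht => mul_nonneg c.2 (hh t ht)
      add_mem' := fun hh₁ hh₂ t ht => add_nonneg (hh₁ t ht) (hh₂ t ht) }
  obtain ⟨g, hg, hgs⟩ := riesz_extension s f (fun h hh => by
      have hm : Integrable h.1.1 ν := h.2
      exact integral_nonneg_of_ae (ae_nonneg_of_nonneg_on hY hm.aestronglyMeasurable.aemeasurable hh))
    (fun y => by
      obtain ⟨g, hg, hy⟩ := y.2
      refine ⟨⟨⟨g, hii g hg⟩, hg⟩, fun t _ => ?_⟩
      have := neg_abs_le (y.1 t)
      have := hy t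
      change 0 ≤ g t + y.1 t
      linarith)
  obtain ⟨M, hM⟩ := LinearMap.exists_extend g
  have hM' : ∀ h (hh : h ∈ E), M h = g ⟨h, hh⟩ := fun h hh => by
    rw [← hM]; rfl
  refine ⟨M, fun h hh => ?_, fun h hh hpos => ?_⟩
  · rw [hM' h (hii h hh)]
    exact hg ⟨⟨h, hii h hh⟩, hh⟩
  · rw [hM' h hh]
    exact hgs _ hpos

lemma exists_riesz_representative {Ω : Type*} [MeasurableSpace Ω] {ν : Measure Ω}
    [IsFiniteMeasure ν] {M : (Ω → ℝ) →ₗ[ℝ] ℝ} (hM : ∀ h, Integrable h ν → M h = ∫ s, h s ∂ν)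
    (hM0 : ∀ h ∈ dominatedSubmodule ν, (∀ s, 0 ≤ h s) → 0 ≤ M h) {v : Ω → ℝ}
    (hv : ∀ s, |v s| ≤ 1) :
    ∃ w : Ω → ℝ, Measurable w ∧ Integrable w ν ∧ ∀ φ : Ω → ℝ, MemLp φ 2 ν →
      M (fun s => φ s * v s) = ∫ s, φ s * w s ∂ν := by
  have hdom : ∀ φ : Ω → ℝ, Integrable φ ν → (fun s => φ s * v s) ∈ dominatedSubmodule ν :=
    fun φ hφ => ⟨fun s => |φ s|, hφ.abs, fun s => by
      rw [abs_mul]; exact mul_le_of_le_one_right (abs_nonneg _) (hv s)⟩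
  have hdom' : ∀ φ : Ω → ℝ, Integrable φ ν → φ ∈ dominatedSubmodule ν :=
    fun φ hφ => ⟨fun s => |φ s|, hφ.abs, fun s => le_rfl⟩
  have hbd : ∀ φ : Ω → ℝ, Integrable φ ν → |M (fun s => φ s * v s)| ≤ ∫ s, |φ s| ∂ν := by
    intro φ hφ
    rw [← hM _ hφ.abs]
    have key : ∀ s, |φ s * v s| ≤ |φ s| := fun s => by
      rw [abs_mul]; exact mul_le_of_le_one_right (abs_nonneg _) (hv s)
    have h1 := hM0 ((fun s => |φ s|) - fun s => φ s * v s)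
      (Submodule.sub_mem _ (hdom' _ hφ.abs) (hdom _ hφ)) fun s => by
        simpa using (le_abs_self _).trans (key s)
    have h2 := hM0 ((fun s => |φ s|) + fun s => φ s * v s)
      (Submodule.add_mem _ (hdom' _ hφ.abs) (hdom _ hφ)) fun s => by
        have := (neg_le_abs _).trans (key s)
        simp only [Pi.add_apply]; linarith
    rw [map_sub] at h1
    rw [map_add] at h2
    exact abs_le.2 ⟨by linarith, by linarith⟩
  have hcongr : ∀ φ ψ : Ω → ℝ, Integrable φ ν → Integrable ψ ν → φ =ᵐ[ν] ψ →
      M (fun s => φ s * v s) = M (fun s => ψ s * v s) := by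
    intro φ ψ hφ hψ h
    have h1 := hbd _ (hφ.sub hψ)
    have h2 : ∫ s, |(φ - ψ) s| ∂ν = 0 := by
      refine integral_eq_zero_of_ae ?_
      filter_upwards [h] with s hs
      simp [hs]
    rw [h2] at h1
    have h3 : (fun s => (φ - ψ) s * v s) = (fun s => φ s * v s) - fun s => ψ s * v s := by
      funext s; simp [sub_mul]
    rw [h3, map_sub] at h1
    have := abs_nonpos_iff.1 h1
    linarith
  have hL : ∀ φ : Lp ℝ 2 ν, Integrable φ ν := fun φ =>
    (Lp.memLp φ).integrable (by norm_num)
  let T : Lp ℝ 2 ν →ₗ[ℝ] ℝ :=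
    { toFun := fun φ => M (fun s => φ s * v s)
      map_add' := fun φ ψ => by
        rw [hcongr _ _ (hL _) ((hL φ).add (hL ψ)) (Lp.coeFn_add φ ψ), ← map_add]
        congr 1; funext s; simp [add_mul]
      map_smul' := fun c φ => by
        rw [hcongr _ _ (hL _) ((hL φ).smul c) (Lp.coeFn_smul c φ), RingHom.id_apply, ← map_smul]
        congr 1; funext s; simp [mul_assoc] }
  have hT : ∃ C, ∀ φ, ‖T φ‖ ≤ C * ‖φ‖ := by
    refine ⟨(ν Set.univ ^ (1 / 2 : ℝ)).toReal, fun φ => ?_⟩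
    refine (hbd _ (hL φ)).trans ?_
    have h1 : ∫ s, |φ s| ∂ν = (eLpNorm φ 1 ν).toReal := by
      rw [eLpNorm_one_eq_lintegral_enorm, ← integral_norm_eq_lintegral_enorm (hL φ).1]; rfl
    have h2 := eLpNorm_le_eLpNorm_mul_rpow_measure_univ (μ := ν) (p := 1) (q := 2) (by norm_num)
      (hL φ).1
    have h3 : (1 / (1 : ℝ≥0∞).toReal - 1 / (2 : ℝ≥0∞).toReal) = 1 / 2 := by norm_num
    rw [h3] at h2
    rw [h1, Lp.norm_def, mul_comm, ← ENNReal.toReal_mul]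
    refine ENNReal.toReal_mono (ENNReal.mul_ne_top (Lp.eLpNorm_ne_top φ) ?_) h2
    exact (ENNReal.rpow_lt_top_of_nonneg (by norm_num) (measure_ne_top _ _)).ne
  obtain ⟨C, hC⟩ := hT
  set W := (InnerProductSpace.toDual ℝ (Lp ℝ 2 ν)).symm (T.mkContinuous C hC) with hW
  have hWT : ∀ φ : Lp ℝ 2 ν, ∫ s, W s * φ s ∂ν = M (fun s => φ s * v s) := fun φ => by
    have h : inner ℝ W φ = M (fun s => φ s * v s) := by
      rw [hW, InnerProductSpace.toDual_symm_apply]; rfl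
    rw [← h, L2.inner_def]
    simp [mul_comm]
  have hWm := (Lp.aestronglyMeasurable W)
  refine ⟨hWm.mk W, hWm.stronglyMeasurable_mk.measurable, (hL W).congr hWm.ae_eq_mk,
    fun φ hφ => ?_⟩
  rw [hcongr φ (hφ.toLp φ) (hφ.integrable (by norm_num)) (hL _) hφ.coeFn_toLp.symm, ← hWT]
  refine integral_congr_ae ?_
  filter_upwards [hWm.ae_eq_mk, hφ.coeFn_toLp] with s h1 h2
  rw [h1, h2, mul_comm]

lemma exists_complex_representative {Ω : Type*} [MeasurableSpace Ω] {ν : Measure Ω}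
    [IsFiniteMeasure ν] {M : (Ω → ℝ) →ₗ[ℝ] ℝ} (hM : ∀ h, Integrable h ν → M h = ∫ s, h s ∂ν)
    (hM0 : ∀ h ∈ dominatedSubmodule ν, (∀ s, 0 ≤ h s) → 0 ≤ M h) {v : Ω → ℂ}
    (hv : ∀ s, ‖v s‖ ≤ 1) :
    ∃ w : Ω → ℂ, Measurable w ∧ Integrable w ν ∧ ∀ (φ : Ω → ℂ) (C : ℝ), Measurable φ →
      (∀ s, ‖φ s‖ ≤ C) → M (fun s => (φ s * v s).re) = ∫ s, (φ s * w s).re ∂ν := by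
  obtain ⟨w₁, hm₁, hi₁, h₁⟩ := exists_riesz_representative hM hM0 (v := fun s => (v s).re)
    fun s => (Complex.abs_re_le_norm _).trans (hv s)
  obtain ⟨w₂, hm₂, hi₂, h₂⟩ := exists_riesz_representative hM hM0 (v := fun s => (v s).im)
    fun s => (Complex.abs_im_le_norm _).trans (hv s)
  refine ⟨fun s => w₁ s + w₂ s * Complex.I, by fun_prop, ?_, fun φ C hφ hC => ?_⟩
  · exact hi₁.ofReal.add (hi₂.ofReal.mul_const _)
  · have hre : ∀ s, ‖(φ s).re‖ ≤ C := fun s => (Complex.abs_re_le_norm _).trans (hC s)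
    have him : ∀ s, ‖(φ s).im‖ ≤ C := fun s => (Complex.abs_im_le_norm _).trans (hC s)
    have hrm : Measurable fun s => (φ s).re := by fun_prop
    have himm : Measurable fun s => (φ s).im := by fun_prop
    have l1 : MemLp (fun s => (φ s).re) 2 ν :=
      MemLp.of_bound hrm.aestronglyMeasurable C (Filter.Eventually.of_forall hre)
    have l2 : MemLp (fun s => (φ s).im) 2 ν :=
      MemLp.of_bound himm.aestronglyMeasurable C (Filter.Eventually.of_forall him)
    have e1 : (fun s => (φ s * v s).re) =
        (fun s => (φ s).re * (v s).re) - fun s => (φ s).im * (v s).im := by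
      funext s; simp
    have i1 : Integrable (fun s => (φ s).re * w₁ s) ν :=
      hi₁.bdd_mul hrm.aestronglyMeasurable (Filter.Eventually.of_forall hre)
    have i2 : Integrable (fun s => (φ s).im * w₂ s) ν :=
      hi₂.bdd_mul himm.aestronglyMeasurable (Filter.Eventually.of_forall him)
    rw [e1, map_sub, h₁ _ l1, h₂ _ l2, ← integral_sub i1 i2]
    congr 1; funext s
    simp

lemma norm_tsum_sub_sum_le {α : Type*} {k v : α → ℂ} (hk : lpN 2 (fun y => ‖k y‖ₑ) ≠ ∞)
    (hv : lpN 2 (fun y => ‖v y‖ₑ) ≤ 1) (S : Finset α) [DecidableEq α] :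
    ‖∑' y, k y * v y - ∑ y ∈ S, k y * v y‖ ≤
      (lpN 2 fun y => if y ∈ S then 0 else ‖k y‖ₑ).toReal := by
  have h22 : (2 : ℝ).HolderConjugate 2 := Real.HolderConjugate.two_two
  have hs : Summable fun y => k y * v y :=
    summable_mul_of_lpN h22 hk (ne_top_of_le_ne_top ENNReal.one_ne_top hv)
  set k' : α → ℂ := fun y => if y ∈ S then 0 else k y with hk'
  have hke : (fun y => ‖k' y‖ₑ) = fun y => if y ∈ S then 0 else ‖k y‖ₑ := by
    funext y; simp only [hk']; split_ifs <;> simp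
  have hle : lpN 2 (fun y => ‖k' y‖ₑ) ≤ lpN 2 fun y => ‖k y‖ₑ := by
    refine lpN_mono two_pos fun y => ?_
    simp only [hk']; split_ifs <;> simp
  have hs2 : ∑' y, k y * v y - ∑ y ∈ S, k y * v y = ∑' y, k' y * v y := by
    have e : ∑ y ∈ S, k y * v y = ∑' y, if y ∈ S then k y * v y else 0 := by
      rw [tsum_eq_sum (s := S) (fun y hy => by simp [hy])]
      exact Finset.sum_congr rfl fun y hy => by simp [hy]
    have hs3 : Summable fun y => if y ∈ S then k y * v y else 0 :=
      summable_of_ne_finset_zero (s := S) fun y hy => by simp [hy]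
    rw [e, ← hs.tsum_sub hs3]
    congr 1; funext y; simp only [hk']; split_ifs <;> simp
  rw [hs2, ← hke]
  have hfin : lpN 2 (fun y => ‖k' y‖ₑ) ≠ ∞ := ne_top_of_le_ne_top hk hle
  rw [← toReal_enorm]
  refine ENNReal.toReal_mono hfin ?_
  refine (enorm_tsum_le_tsum_enorm (f := fun y => k' y * v y)).trans ?_
  simp_rw [enorm_mul]
  refine (tsum_mul_le_lpN h22 _ _).trans ?_
  exact (mul_le_mul_right hv _).trans_eq (mul_one _)

lemma tendsto_lpN_tail {α : Type*} [DecidableEq α] {f : α → ℝ≥0∞} (hf : lpN 2 f ≠ ∞) :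
    Filter.Tendsto (fun S : Finset α => lpN 2 fun y => if y ∈ S then 0 else f y) Filter.atTop
      (nhds 0) := by
  have h0 : ∑' y, f y ^ (2 : ℝ) ≠ ∞ := by
    rw [← lpN_rpow two_pos]
    exact ENNReal.rpow_ne_top_of_nonneg two_pos.le hf
  have h := ENNReal.tendsto_tsum_compl_atTop_zero h0
  have h2 := (ENNReal.continuous_rpow_const (y := 1 / (2 : ℝ))).tendsto 0 |>.comp h
  rw [ENNReal.zero_rpow_of_pos (by norm_num)] at h2
  refine h2.congr fun S => ?_
  simp only [Function.comp, lpN]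
  congr 1
  refine (tsum_subtype ((S : Set α)ᶜ) fun y => f y ^ (2 : ℝ)).trans ?_
  congr 1; funext y
  by_cases hy : y ∈ S <;> simp [hy]

section
variable {Ω α : Type*} [MeasurableSpace Ω] {ν : Measure Ω}
  {M : (Ω → ℝ) →ₗ[ℝ] ℝ} {V W : Ω → α → ℂ}

lemma extension_sum_eq_integral (hWi : ∀ y, Integrable (fun s => W s y) ν)
    (hMW : ∀ (y : α) (φ : Ω → ℂ) (C : ℝ), Measurable φ → (∀ s, ‖φ s‖ ≤ C) →
      M (fun s => (φ s * V s y).re) = ∫ s, (φ s * W s y).re ∂ν)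
    (S : Finset α) (φ : Ω → α → ℂ) (C : ℝ) (hφ : ∀ y, Measurable fun s => φ s y)
    (hC : ∀ s y, ‖φ s y‖ ≤ C) :
    Integrable (fun s => (∑ y ∈ S, φ s y * W s y).re) ν ∧
    M (fun s => (∑ y ∈ S, φ s y * V s y).re) = ∫ s, (∑ y ∈ S, φ s y * W s y).re ∂ν := by
  have hi : ∀ y, Integrable (fun s => φ s y * W s y) ν := fun y =>
    (hWi y).bdd_mul (hφ y).aestronglyMeasurable (Filter.Eventually.of_forall fun s => hC s y)
  refine ⟨(integrable_finsetSum S fun y _ => hi y).re, ?_⟩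
  simp only [Complex.re_sum]
  rw [integral_finsetSum (f := fun y s => (φ s y * W s y).re) S fun y _ => (hi y).re]
  have e : (fun s => ∑ y ∈ S, (φ s y * V s y).re) = ∑ y ∈ S, fun s => (φ s y * V s y).re := by
    funext s; simp
  rw [e, map_sum]
  exact Finset.sum_congr rfl fun y _ => hMW y _ C (hφ y) fun s => hC s y

lemma norm_le_of_lpN_le {p : ℝ} (hp : 0 < p) (f : α → ℂ) {B : ℝ} (hB : 0 ≤ B)
    (hf : lpN p (fun y => ‖f y‖ₑ) ≤ ENNReal.ofReal B) (y : α) : ‖f y‖ ≤ B := by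
  have h := (le_lpN hp (fun y => ‖f y‖ₑ) y).trans hf
  rwa [← ofReal_norm, ENNReal.ofReal_le_ofReal_iff hB] at h

lemma ae_lpN_representative_le [IsFiniteMeasure ν] (hM : ∀ h, Integrable h ν → M h = ∫ s, h s ∂ν)
    (hM0 : ∀ h ∈ dominatedSubmodule ν, (∀ s, 0 ≤ h s) → 0 ≤ M h) [Countable α] {p r : ℝ}
    (hpr : p.HolderConjugate r) (hV : ∀ s, lpN p (fun y => ‖V s y‖ₑ) ≤ 1)
    (hWm : ∀ y, Measurable fun s => W s y) (hWi : ∀ y, Integrable (fun s => W s y) ν)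
    (hMW : ∀ (y : α) (φ : Ω → ℂ) (C : ℝ), Measurable φ → (∀ s, ‖φ s‖ ≤ C) →
      M (fun s => (φ s * V s y).re) = ∫ s, (φ s * W s y).re ∂ν) :
    ∀ᵐ s ∂ν, lpN p (fun y => ‖W s y‖ₑ) ≤ 1 := by
  classical
  have hp := hpr.pos
  have key : ∀ S : Finset α, ∀ᵐ s ∂ν, (∑ y ∈ S, ‖W s y‖ ^ p) ^ (1 / p) ≤ 1 := by
    intro S
    set Q : Ω → ℝ := fun s => (∑ y ∈ S, ‖W s y‖ ^ p) ^ (1 / p) with hQ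
    have hQ0 : ∀ s, 0 ≤ Q s := fun s => by positivity
    have hQm : Measurable Q := by
      have : Measurable fun s => ∑ y ∈ S, ‖W s y‖ ^ p :=
        Finset.measurable_fun_sum _ fun y _ => ((hWm y).norm.pow_const p)
      exact this.pow_const _
    set φ : Ω → α → ℂ := fun s y => if y ∈ S then dualF p S (W s) y * (((Q s)⁻¹ : ℝ) : ℂ) else 0
      with hφ
    have hφm : ∀ y, Measurable fun s => φ s y := fun y => by
      simp only [hφ]
      split_ifs with hy
      · have h1 : Measurable fun s => dualW p (W s y) := (measurable_dualW p).comp (hWm y)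
        have h2 : Measurable fun s => (((Q s) ^ (2 - p) : ℝ) : ℂ) :=
          Complex.measurable_ofReal.comp (hQm.pow_const _)
        exact (h1.mul h2).mul (Complex.measurable_ofReal.comp hQm.inv)
      · exact measurable_const
    have hφr : ∀ s, lpN r (fun y => ‖φ s y‖ₑ) ≤ 1 := fun s => by
      have h1 : (∑ y ∈ S, ‖φ s y‖ ^ r) ^ (1 / r) ≤ 1 := by
        have e : ∑ y ∈ S, ‖φ s y‖ ^ r = (∑ y ∈ S, ‖dualF p S (W s) y‖ ^ r) * ((Q s)⁻¹) ^ r := by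
          rw [Finset.sum_mul]
          refine Finset.sum_congr rfl fun y hy => ?_
          simp only [hφ, hy, if_true]
          rw [norm_mul, Complex.norm_real, Real.norm_of_nonneg (inv_nonneg.2 (hQ0 s)),
            Real.mul_rpow (norm_nonneg _) (inv_nonneg.2 (hQ0 s))]
        rw [e, Real.mul_rpow (Finset.sum_nonneg fun _ _ => by positivity)
          (Real.rpow_nonneg (inv_nonneg.2 (hQ0 s)) _), sum_norm_dualF hpr.symm,
          ← Real.rpow_mul (inv_nonneg.2 (hQ0 s)), mul_one_div_cancel hpr.symm.pos.ne',
          Real.rpow_one]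
        exact mul_inv_le_one
      rw [← ENNReal.ofReal_one]
      refine lpN_le_of_sum_norm_rpow_le hpr.symm.pos zero_le_one fun T => le_trans ?_ h1
      refine Real.rpow_le_rpow (Finset.sum_nonneg fun _ _ => by positivity) ?_
        (one_div_nonneg.2 hpr.symm.pos.le)
      calc ∑ y ∈ T, ‖φ s y‖ ^ r = ∑ y ∈ T with y ∈ S, ‖φ s y‖ ^ r := by
            rw [Finset.sum_filter]
            refine Finset.sum_congr rfl fun y _ => ?_
            by_cases hy : y ∈ S <;> simp [hφ, hy, hpr.symm.pos.ne']
        _ ≤ _ := Finset.sum_le_sum_of_subset_of_nonneg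
            (fun y hy => (Finset.mem_filter.1 hy).2) fun _ _ _ => by positivity
    have hφ1 : ∀ s y, ‖φ s y‖ ≤ 1 := fun s y =>
      norm_le_of_lpN_le hpr.symm.pos _ zero_le_one (by simpa using hφr s) y
    have hφW : ∀ s, ∑ y ∈ S, φ s y * W s y = ((Q s : ℝ) : ℂ) := fun s => by
      have e : ∑ y ∈ S, φ s y * W s y =
          (∑ y ∈ S, dualF p S (W s) y * W s y) * (((Q s)⁻¹ : ℝ) : ℂ) := by
        rw [Finset.sum_mul]
        refine Finset.sum_congr rfl fun y hy => ?_
        simp only [hφ, hy, if_true]; ring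
      have hS0 : 0 ≤ ∑ y ∈ S, ‖W s y‖ ^ p := Finset.sum_nonneg fun _ _ => by positivity
      have e2 : (∑ y ∈ S, ‖W s y‖ ^ p) ^ (2 / p) = Q s * Q s := by
        simp only [hQ]
        rw [← Real.rpow_add_of_nonneg hS0 (by positivity) (by positivity)]
        congr 1; ring
      rw [e, sum_dualF_mul hpr.lt, e2, ← Complex.ofReal_mul]
      congr 1
      rcases eq_or_ne (Q s) 0 with h | h
      · simp [h]
      · field_simp
    have hφV : ∀ s, |(∑ y ∈ S, φ s y * V s y).re| ≤ 1 := fun s => by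
      refine (Complex.abs_re_le_norm _).trans ?_
      rw [← toReal_enorm, ← ENNReal.toReal_one]
      refine ENNReal.toReal_mono ENNReal.one_ne_top ?_
      calc ‖∑ y ∈ S, φ s y * V s y‖ₑ ≤ ∑ y ∈ S, ‖φ s y‖ₑ * ‖V s y‖ₑ :=
            (enorm_sum_le _ _).trans_eq (by simp_rw [enorm_mul])
        _ ≤ ∑' y, ‖φ s y‖ₑ * ‖V s y‖ₑ := ENNReal.sum_le_tsum S
        _ ≤ _ := tsum_mul_le_lpN hpr.symm _ _
        _ ≤ 1 * 1 := mul_le_mul' (hφr s) (hV s)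
        _ = 1 := one_mul 1
    have hQi : Integrable Q ν := by
      refine (extension_sum_eq_integral hWi hMW S φ 1 hφm hφ1).1.congr ?_
      exact Filter.Eventually.of_forall fun s => by simp [hφW]
    refine ae_le_of_forall_setIntegral_le hQi (integrable_const 1) fun A hA _ => ?_
    have hψ := extension_sum_eq_integral hWi hMW S (fun s y => A.indicator (fun s => φ s y) s) 1
      (fun y => (hφm y).indicator hA) (fun s y => (norm_indicator_le_norm_self _ _).trans (hφ1 s y))
    have e1 : (fun s => (∑ y ∈ S, A.indicator (fun s => φ s y) s * W s y).re) = A.indicator Q := by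
      funext s
      by_cases hs : s ∈ A <;> simp [hs, hφW]
    rw [e1, integral_indicator hA] at hψ
    rw [← hψ.2, ← integral_indicator hA, ← hM _ ((integrable_const 1).indicator hA)]
    have hdom1 : A.indicator (fun _ => (1 : ℝ)) ∈ dominatedSubmodule ν :=
      ⟨fun _ => 1, integrable_const 1, fun s => by by_cases hs : s ∈ A <;> simp [hs]⟩
    have hdom2 : (fun s => (∑ y ∈ S, A.indicator (fun s => φ s y) s * V s y).re) ∈
        dominatedSubmodule ν :=
      ⟨fun _ => 1, integrable_const 1, fun s => by
        by_cases hs : s ∈ A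
        · simpa only [Set.indicator_of_mem hs] using hφV s
        · simp [hs]⟩
    have := hM0 _ (Submodule.sub_mem _ hdom1 hdom2) fun s => by
      by_cases hs : s ∈ A
      · have := (le_abs_self _).trans (hφV s)
        simpa [hs] using this
      · simp [hs]
    rw [map_sub] at this
    linarith
  rw [← ae_all_iff] at key
  filter_upwards [key] with s hs
  rw [← ENNReal.ofReal_one]
  exact lpN_le_of_sum_norm_rpow_le hp zero_le_one hs

end

section
variable {Ω α : Type*} [MeasurableSpace Ω] {ν : Measure Ω} {Y : Set Ω}
  {M : (Ω → ℝ) →ₗ[ℝ] ℝ} {V W : Ω → α → ℂ}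

lemma setIntegral_re_eq_of_representative [IsFiniteMeasure ν] [Countable α]
    (hM : ∀ h, Integrable h ν → M h = ∫ s, h s ∂ν)
    (hM0 : ∀ h ∈ dominatedSubmodule ν, (∀ s ∈ Y, 0 ≤ h s) → 0 ≤ M h)
    (hV : ∀ s, lpN 2 (fun y => ‖V s y‖ₑ) ≤ 1) (hW : ∀ s, lpN 2 (fun y => ‖W s y‖ₑ) ≤ 1)
    (hWm : ∀ y, Measurable fun s => W s y) (hWi : ∀ y, Integrable (fun s => W s y) ν)
    (hMW : ∀ (y : α) (φ : Ω → ℂ) (C : ℝ), Measurable φ → (∀ s, ‖φ s‖ ≤ C) →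
      M (fun s => (φ s * V s y).re) = ∫ s, (φ s * W s y).re ∂ν)
    {k : Ω → α → ℂ} {B : ℝ} (hB : 0 ≤ B) (hk : ∀ y, Measurable fun s => k s y)
    (hkB : ∀ s, lpN 2 (fun y => ‖k s y‖ₑ) ≤ ENNReal.ofReal B) {m : Ω → ℂ} (hm : Integrable m ν)
    (hmV : ∀ s ∈ Y, m s = ∑' y, k s y * V s y) {A : Set Ω} (hA : MeasurableSet A) :
    ∫ s in A, (m s).re ∂ν = ∫ s in A, (∑' y, k s y * W s y).re ∂ν := by
  classical
  obtain ⟨T, -, hT⟩ := Filter.exists_seq_monotone_tendsto_atTop_atTop (Finset α)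
  have hkfin : ∀ s, lpN 2 (fun y => ‖k s y‖ₑ) ≠ ∞ := fun s =>
    ne_top_of_le_ne_top ENNReal.ofReal_ne_top (hkB s)
  have hknorm : ∀ s y, ‖k s y‖ ≤ B := fun s y => norm_le_of_lpN_le two_pos _ hB (hkB s) y
  set τ : ℕ → Ω → ℝ := fun n s => (lpN 2 fun y => if y ∈ T n then 0 else ‖k s y‖ₑ).toReal with hτ
  have hτB' : ∀ n s, (lpN 2 fun y => if y ∈ T n then 0 else ‖k s y‖ₑ) ≤ ENNReal.ofReal B :=
    fun n s => (lpN_mono two_pos fun y => by split_ifs <;> simp).trans (hkB s)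
  have hτ0 : ∀ n s, 0 ≤ τ n s := fun n s => ENNReal.toReal_nonneg
  have hτB : ∀ n s, τ n s ≤ B := fun n s => ENNReal.toReal_le_of_le_ofReal hB (hτB' n s)
  have hτm : ∀ n, Measurable (τ n) := fun n => by
    refine Measurable.ennreal_toReal (measurable_lpN (F := fun s y =>
      if y ∈ T n then 0 else ‖k s y‖ₑ) (fun y => ?_) 2)
    split_ifs
    · exact measurable_const
    · exact (hk y).enorm
  have hτi : ∀ n, Integrable (τ n) ν := fun n =>
    Integrable.of_bound (hτm n).aestronglyMeasurable B (Filter.Eventually.of_forall fun s => by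
      rw [Real.norm_of_nonneg (hτ0 n s)]; exact hτB n s)
  have hτlim : Filter.Tendsto (fun n => ∫ s, τ n s ∂ν) Filter.atTop (nhds 0) := by
    rw [← integral_zero Ω ℝ (μ := ν)]
    refine tendsto_integral_of_dominated_convergence (fun _ => B)
      (fun n => (hτm n).aestronglyMeasurable) (integrable_const B)
      (fun n => Filter.Eventually.of_forall fun s => by
        rw [Real.norm_of_nonneg (hτ0 n s)]; exact hτB n s)
      (Filter.Eventually.of_forall fun s => ?_)
    have := (ENNReal.tendsto_toReal ENNReal.zero_ne_top).comp
      ((tendsto_lpN_tail (hkfin s)).comp hT)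
    rw [ENNReal.toReal_zero] at this
    exact this
  set mW : Ω → ℂ := fun s => ∑' y, k s y * W s y with hmW
  have hsum : ∀ s, Summable fun y => k s y * W s y := fun s =>
    summable_mul_of_lpN Real.HolderConjugate.two_two (hkfin s)
      (ne_top_of_le_ne_top ENNReal.one_ne_top (hW s))
  have hmWm : Measurable mW := measurable_tsum_of_summable (fun y => (hk y).mul (hWm y)) hsum
  have hmWi : Integrable mW ν := by
    refine Integrable.of_bound hmWm.aestronglyMeasurable B (Filter.Eventually.of_forall fun s => ?_)
    have := norm_tsum_sub_sum_le (hkfin s) (hW s) ∅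
    simp only [Finset.sum_empty, sub_zero, Finset.notMem_empty, if_false] at this
    exact this.trans (ENNReal.toReal_le_of_le_ofReal hB (hkB s))
  have hbound : ∀ n, |∫ s in A, (m s).re ∂ν - ∫ s in A, (mW s).re ∂ν| ≤ 2 * ∫ s, τ n s ∂ν := by
    intro n
    set φ : Ω → α → ℂ := fun s y => A.indicator (fun s => k s y) s with hφ
    have hφk : ∀ s (U : Ω → α → ℂ), (∑ y ∈ T n, φ s y * U s y).re =
        A.indicator (fun s => (∑ y ∈ T n, k s y * U s y).re) s := fun s U => by
      by_cases hs : s ∈ A <;> simp [hφ, hs]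
    have hφB : ∀ s y, ‖φ s y‖ ≤ B := fun s y =>
      (norm_indicator_le_norm_self _ _).trans (hknorm s y)
    obtain ⟨hi, he⟩ := extension_sum_eq_integral hWi hMW (T n) φ B
      (fun y => (hk y).indicator hA) hφB
    have hmA : Integrable (A.indicator fun s => (m s).re) ν := hm.re.indicator hA
    have hmWA : Integrable (A.indicator fun s => (mW s).re) ν := hmWi.re.indicator hA
    have h1 : |∫ s in A, (mW s).re ∂ν - ∫ s, (∑ y ∈ T n, φ s y * W s y).re ∂ν| ≤
        ∫ s, τ n s ∂ν := by
      rw [← integral_indicator hA, ← integral_sub hmWA hi]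
      rw [← Real.norm_eq_abs]
      refine (norm_integral_le_of_norm_le (hτi n) (Filter.Eventually.of_forall fun s => ?_))
      rw [hφk s W, Real.norm_eq_abs]
      by_cases hs : s ∈ A
      · simp only [hs, Set.indicator_of_mem]
        rw [← Complex.sub_re]
        exact (Complex.abs_re_le_norm _).trans (norm_tsum_sub_sum_le (hkfin s) (hW s) (T n))
      · simp [hs, hτ0 n s]
    have hd1 : (A.indicator fun s => (m s).re) ∈ dominatedSubmodule ν :=
      ⟨_, hmA.abs, fun s => le_rfl⟩
    have hd2 : (fun s => (∑ y ∈ T n, φ s y * V s y).re) ∈ dominatedSubmodule ν := by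
      refine ⟨fun _ => ∑ _y ∈ T n, B, integrable_const _, fun s => ?_⟩
      refine (Complex.abs_re_le_norm _).trans ((norm_sum_le _ _).trans ?_)
      refine Finset.sum_le_sum fun y _ => ?_
      rw [norm_mul]
      have := norm_le_of_lpN_le two_pos (V s) zero_le_one (by simpa using hV s) y
      exact (mul_le_of_le_one_right (norm_nonneg _) this).trans (hφB s y)
    have hd3 : τ n ∈ dominatedSubmodule ν := ⟨τ n, hτi n, fun s => (abs_of_nonneg (hτ0 n s)).le⟩
    have hY : ∀ s ∈ Y, |A.indicator (fun s => (m s).re) s -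
        (∑ y ∈ T n, φ s y * V s y).re| ≤ τ n s := fun s hsY => by
      rw [hφk s V]
      by_cases hs : s ∈ A
      · simp only [hs, Set.indicator_of_mem]
        rw [← Complex.sub_re, hmV s hsY]
        exact (Complex.abs_re_le_norm _).trans (norm_tsum_sub_sum_le (hkfin s) (hV s) (T n))
      · simp [hs, hτ0 n s]
    have h2 := hM0 _ (Submodule.sub_mem _ hd3 (Submodule.sub_mem _ hd1 hd2)) fun s hs => by
      have := (abs_le.1 (hY s hs)).2
      simp only [Pi.sub_apply]; linarith
    have h3 := hM0 _ (Submodule.add_mem _ hd3 (Submodule.sub_mem _ hd1 hd2)) fun s hs => by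
      have := (abs_le.1 (hY s hs)).1
      simp only [Pi.sub_apply, Pi.add_apply]; linarith
    rw [map_sub, map_sub, hM _ hmA, hM _ (hτi n), he, integral_indicator hA] at h2
    rw [map_add, map_sub, hM _ hmA, hM _ (hτi n), he, integral_indicator hA] at h3
    rw [abs_le] at h1 ⊢
    constructor <;> linarith [h1.1, h1.2]
  have h0 := ge_of_tendsto (hτlim.const_mul 2) (Filter.Eventually.of_forall hbound)
  rw [mul_zero] at h0
  linarith [abs_nonpos_iff.1 h0]

end

/-- A pointwise `ℓ^p`-bounded family of possibly non-measurable functions has a measurable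
replacement which represents all its measurable pairings with `ℓ²` kernels. -/
lemma exists_measurable_replacement {Ω α : Type*} [MeasurableSpace Ω] [Countable α]
    {ν : Measure Ω} [IsFiniteMeasure ν] {Y : Set Ω}
    (hY : ∀ Z, MeasurableSet Z → Disjoint Z Y → ν Z = 0) {p r : ℝ} (hpr : p.HolderConjugate r)
    (hp2 : p ≤ 2) {V : Ω → α → ℂ} (hV : ∀ s, lpN p (fun y => ‖V s y‖ₑ) ≤ 1) :
    ∃ W : Ω → α → ℂ, (∀ y, Measurable fun s => W s y) ∧
      (∀ s, lpN p (fun y => ‖W s y‖ₑ) ≤ 1) ∧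
      ∀ (k : Ω → α → ℂ) (B : ℝ), 0 ≤ B → (∀ y, Measurable fun s => k s y) →
        (∀ s, lpN 2 (fun y => ‖k s y‖ₑ) ≤ ENNReal.ofReal B) →
        ∀ m : Ω → ℂ, AEStronglyMeasurable m ν → (∀ s ∈ Y, m s = ∑' y, k s y * V s y) →
          m =ᵐ[ν] fun s => ∑' y, k s y * W s y := by
  obtain ⟨M, hM, hM0⟩ := exists_positive_extension ν hY
  have hM0' : ∀ h ∈ dominatedSubmodule ν, (∀ s, 0 ≤ h s) → 0 ≤ M h := fun h hh hs =>
    hM0 h hh fun s _ => hs s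
  have hp := hpr.pos
  choose W₀ hWm hWi hMW using fun y => exists_complex_representative hM hM0' (v := fun s => V s y)
    fun s => norm_le_of_lpN_le hp (V s) zero_le_one (by simpa using hV s) y
  have hae := ae_lpN_representative_le (W := fun s y => W₀ y s) hM hM0' hpr hV hWm hWi hMW
  set G : Set Ω := {s | lpN p (fun y => ‖W₀ y s‖ₑ) ≤ 1} with hG
  have hGm : MeasurableSet G := measurableSet_le
    (measurable_lpN (F := fun s y => ‖W₀ y s‖ₑ) (fun y => (hWm y).enorm) p) measurable_const
  set W : Ω → α → ℂ := fun s y => G.indicator (W₀ y) s with hW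
  have hWae : ∀ y, W₀ y =ᵐ[ν] fun s => W s y := fun y => by
    filter_upwards [hae] with s hs
    rw [hW]; simp only
    rw [Set.indicator_of_mem (show s ∈ G from hs)]
  have hWm' : ∀ y, Measurable fun s => W s y := fun y => (hWm y).indicator hGm
  have hWi' : ∀ y, Integrable (fun s => W s y) ν := fun y => (hWi y).congr (hWae y)
  have hW1 : ∀ s, lpN p (fun y => ‖W s y‖ₑ) ≤ 1 := fun s => by
    by_cases hs : s ∈ G
    · simp only [hW, Set.indicator_of_mem hs]; exact hs
    · simp [hW, hs, lpN, hp]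
  have hMW' : ∀ (y : α) (φ : Ω → ℂ) (C : ℝ), Measurable φ → (∀ s, ‖φ s‖ ≤ C) →
      M (fun s => (φ s * V s y).re) = ∫ s, (φ s * W s y).re ∂ν := fun y φ C hφ hC => by
    rw [hMW y φ C hφ hC]
    refine integral_congr_ae ?_
    filter_upwards [hWae y] with s hs
    rw [hs]
  have hV2 : ∀ s, lpN 2 (fun y => ‖V s y‖ₑ) ≤ 1 := fun s => (lpN_anti hp hp2 _).trans (hV s)
  have hW2 : ∀ s, lpN 2 (fun y => ‖W s y‖ₑ) ≤ 1 := fun s => (lpN_anti hp hp2 _).trans (hW1 s)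
  refine ⟨W, hWm', hW1, fun k B hB hk hkB m hm hmV => ?_⟩
  have hkfin : ∀ s, lpN 2 (fun y => ‖k s y‖ₑ) ≠ ∞ := fun s =>
    ne_top_of_le_ne_top ENNReal.ofReal_ne_top (hkB s)
  classical
  have hbdd : ∀ s (U : α → ℂ), lpN 2 (fun y => ‖U y‖ₑ) ≤ 1 → ‖∑' y, k s y * U y‖ ≤ B :=
    fun s U hU => by
      have := norm_tsum_sub_sum_le (hkfin s) hU ∅
      simp only [Finset.sum_empty, sub_zero, Finset.notMem_empty, if_false] at this
      exact this.trans (ENNReal.toReal_le_of_le_ofReal hB (hkB s))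
  have hmi : Integrable m ν := by
    refine Integrable.of_bound hm B ?_
    have := ae_nonneg_of_nonneg_on hY (h := fun s => B - ‖m s‖)
      (hm.norm.aemeasurable.const_sub B) fun s hs => by
        rw [hmV s hs]; linarith [hbdd s (V s) (hV2 s)]
    filter_upwards [this] with s hs
    linarith
  have hWi2 : Integrable (fun s => ∑' y, k s y * W s y) ν := by
    refine Integrable.of_bound (measurable_tsum_of_summable (fun y => (hk y).mul (hWm' y)) fun s =>
      summable_mul_of_lpN Real.HolderConjugate.two_two (hkfin s)
        (ne_top_of_le_ne_top ENNReal.one_ne_top (hW2 s))).aestronglyMeasurable B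
      (Filter.Eventually.of_forall fun s => hbdd s (W s) (hW2 s))
  have hre : ∀ᵐ s ∂ν, (m s).re = (∑' y, k s y * W s y).re :=
    hmi.re.ae_eq_of_forall_setIntegral_eq _ _ hWi2.re fun A hA _ =>
      setIntegral_re_eq_of_representative hM hM0 hV2 hW2 hWm' hWi' hMW' hB hk hkB hmi hmV hA
  have him : ∀ᵐ s ∂ν, (m s).im = (∑' y, k s y * W s y).im := by
    refine hmi.im.ae_eq_of_forall_setIntegral_eq _ _ hWi2.im fun A hA _ => ?_
    have e : ∀ z : ℂ, z.im = (-Complex.I * z).re := fun z => by simp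
    have := setIntegral_re_eq_of_representative hM hM0 hV2 hW2 hWm' hWi' hMW' hB
      (k := fun s y => -Complex.I * k s y) (m := fun s => -Complex.I * m s)
      (fun y => (hk y).const_mul _) (fun s => by simpa [enorm_mul, ← ofReal_norm] using hkB s)
      (hmi.const_mul _) (fun s hs => by simp_rw [hmV s hs, mul_assoc, tsum_mul_left]) hA
    simp_rw [mul_assoc, tsum_mul_left] at this
    simpa [← e] using this
  filter_upwards [hre, him] with s h1 h2
  exact Complex.ext h1 h2

/-- A measurable majorant, up to sets of inner measure zero, of a possibly non-measurable
function with finite (lower) integral. -/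
lemma exists_measurable_majorant (n : ℝ → ℝ≥0∞) {σ : ℝ} (hσ : 0 < σ)
    (hn : ∫⁻ s, n s ^ σ ≠ ∞) {ε : ℝ≥0∞} (hε : ε ≠ 0) :
    ∃ N : ℝ → ℝ≥0∞, Measurable N ∧ (∀ s, N s ≠ 0) ∧ (∀ s, N s ≠ ∞) ∧
      ∫⁻ s, N s ^ σ ≤ (∫⁻ s, n s ^ σ) + ε ∧
      ∀ Z, MeasurableSet Z → (∀ s ∈ Z, N s < n s) → volume Z = 0 := by
  obtain ⟨g, hgm, hgn, hgi⟩ := exists_measurable_le_lintegral_eq volume fun s => n s ^ σ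
  obtain ⟨e, he0, hem, hei⟩ := exists_pos_lintegral_lt_of_sigmaFinite (volume : Measure ℝ) hε
  have hgfin : ∀ᵐ s, g s < ∞ := ae_lt_top hgm (by rwa [← hgi])
  set h : ℝ → ℝ≥0∞ := fun s => if g s = ∞ then 1 else g s + e s with hh
  have hhm : Measurable h := Measurable.ite (hgm (measurableSet_singleton ∞)) measurable_const
    (hgm.add hem.coe_nnreal_ennreal)
  have hh0 : ∀ s, h s ≠ 0 := fun s => by
    simp only [hh]
    split_ifs
    · simp
    · simp [(he0 s).ne']
  have hht : ∀ s, h s ≠ ∞ := fun s => by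
    simp only [hh]
    split_ifs with hs
    · simp
    · simp [hs]
  have hpow : ∀ s, (h s ^ (1 / σ)) ^ σ = h s := fun s => by
    rw [← ENNReal.rpow_mul, one_div_mul_cancel hσ.ne', ENNReal.rpow_one]
  refine ⟨fun s => h s ^ (1 / σ), hhm.pow_const _, fun s => ?_, fun s => ?_, ?_, fun Z hZ hZn => ?_⟩
  · simp [ENNReal.rpow_eq_zero_iff, hh0, hht]
  · simp [ENNReal.rpow_eq_top_iff, hh0, hht]
  · simp_rw [hpow]
    rw [hgi]
    calc ∫⁻ s, h s = ∫⁻ s, g s + e s := by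
          refine lintegral_congr_ae ?_
          filter_upwards [hgfin] with s hs
          simp [hh, hs.ne]
      _ = (∫⁻ s, g s) + ∫⁻ s, (e s : ℝ≥0∞) := lintegral_add_left hgm _
      _ ≤ _ := by gcongr
  · have hZn' : ∀ s ∈ Z, h s ≤ n s ^ σ := fun s hs => by
      rw [← hpow s]
      exact ENNReal.rpow_le_rpow (hZn s hs).le hσ.le
    set g₁ : ℝ → ℝ≥0∞ := fun s => max (g s) (Z.indicator h s) with hg₁
    have hg₁m : Measurable g₁ := hgm.max (hhm.indicator hZ)
    have hg₁n : ∀ s, g₁ s ≤ n s ^ σ := fun s => by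
      refine max_le (hgn s) ?_
      by_cases hs : s ∈ Z
      · simpa [hs] using hZn' s hs
      · simp [hs]
    have hae : g =ᵐ[volume] g₁ := ae_eq_of_ae_le_of_lintegral_le
      (Filter.Eventually.of_forall fun s => le_max_left _ _) (by rwa [← hgi]) hg₁m.aemeasurable
      (by rw [← hgi]; exact lintegral_mono hg₁n)
    rw [measure_eq_zero_iff_ae_notMem]
    filter_upwards [hae, hgfin] with s h1 h2 hs
    have h3 : h s ≤ g s := by
      rw [h1]
      refine le_trans ?_ (le_max_right _ _)
      simp [hs]
    simp only [hh, h2.ne, if_false] at h3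
    exact absurd h3 (not_le.2 (ENNReal.lt_add_right h2.ne (by simpa using (he0 s).ne')))

lemma exists_measurable_forcing {p r : ℝ} (hpr : p.HolderConjugate r) (hp2 : p ≤ 2)
    (F : ℝ → (Fin 4 → ℤ) → ℂ) {N : ℝ → ℝ≥0∞} (hNm : Measurable N) (hN0 : ∀ s, N s ≠ 0)
    (hNt : ∀ s, N s ≠ ∞)
    (hN : ∀ Z, MeasurableSet Z → (∀ s ∈ Z, N s < lpN p fun y => ‖F s y‖ₑ) → volume Z = 0) :
    ∃ F' : ℝ → (Fin 4 → ℤ) → ℂ, (∀ y, Measurable fun s => F' s y) ∧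
      (∀ s, lpN p (fun y => ‖F' s y‖ₑ) ≤ N s) ∧
      ∀ t x, ‖duhInt F t x‖ₑ ≤ ‖duhInt F' t x‖ₑ := by
  classical
  have hp := hpr.pos
  set ν : Measure ℝ := (volume : Measure ℝ).toFinite with hν
  have hνac : ν ≪ volume := toFinite_absolutelyContinuous _
  have hacν : (volume : Measure ℝ) ≪ ν := absolutelyContinuous_toFinite _
  set Y : Set ℝ := {s | lpN p (fun y => ‖F s y‖ₑ) ≤ N s} with hYdef
  have hY : ∀ Z, MeasurableSet Z → Disjoint Z Y → ν Z = 0 := fun Z hZ hd =>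
    hνac (hN Z hZ fun s hs => not_le.1 fun h => Set.disjoint_left.1 hd hs h)
  have hNr : ∀ s, (N s).toReal ≠ 0 := fun s => (ENNReal.toReal_pos (hN0 s) (hNt s)).ne'
  have hNe : ∀ s, ‖(((N s).toReal : ℝ) : ℂ)‖ₑ = N s := fun s => by
    rw [← ofReal_norm, Complex.norm_real, Real.norm_of_nonneg ENNReal.toReal_nonneg,
      ENNReal.ofReal_toReal (hNt s)]
  set V : ℝ → (Fin 4 → ℤ) → ℂ := fun s y =>
    if s ∈ Y then (((N s).toReal : ℝ) : ℂ)⁻¹ * F s y else 0 with hVdef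
  have hV : ∀ s, lpN p (fun y => ‖V s y‖ₑ) ≤ 1 := fun s => by
    by_cases hs : s ∈ Y
    · simp only [hVdef, hs, if_true, enorm_mul]
      rw [lpN_const_mul hp, enorm_inv (by simpa using hNr s), hNe]
      calc (N s)⁻¹ * _ ≤ (N s)⁻¹ * N s := mul_le_mul_right hs _
        _ = 1 := ENNReal.inv_mul_cancel (hN0 s) (hNt s)
    · simp [hVdef, hs, lpN, hp]
  obtain ⟨W, hWm, hW1, hW⟩ := exists_measurable_replacement hY hpr hp2 hV
  refine ⟨fun s y => (((N s).toReal : ℝ) : ℂ) * W s y, fun y => ?_, fun s => ?_, fun t x => ?_⟩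
  · exact (Complex.measurable_ofReal.comp hNm.ennreal_toReal).mul (hWm y)
  · simp only [enorm_mul]
    rw [lpN_const_mul hp, hNe]
    exact (mul_le_mul_right (hW1 s) _).trans_eq (mul_one _)
  · by_cases hi : IntervalIntegrable (fun s => matAct (mKer (symS (t - s))) (F s) x) volume 0 t
    swap
    · rw [duhInt, intervalIntegral.integral_undef hi]; simp
    refine le_of_eq ?_
    congr 1
    rw [duhInt, duhInt]
    set J := Set.uIoc 0 t with hJ
    have hJm : MeasurableSet J := measurableSet_uIoc
    have hfm := (intervalIntegrable_iff.1 hi).aestronglyMeasurable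
    set m : ℝ → ℂ := fun s => (((N s).toReal : ℝ) : ℂ)⁻¹ *
      J.indicator (fun s => matAct (mKer (symS (t - s))) (F s) x) s with hm
    have hmm : AEStronglyMeasurable m ν := by
      refine AEStronglyMeasurable.mono_ac hνac ?_
      refine AEStronglyMeasurable.mul ?_ ((aestronglyMeasurable_indicator_iff hJm).2 hfm)
      exact (Complex.measurable_ofReal.comp hNm.ennreal_toReal).inv.aestronglyMeasurable
    set k : ℝ → (Fin 4 → ℤ) → ℂ := fun s y => J.indicator (fun s => mKer (symS (t - s)) x y) s
      with hk
    have h := hW k 1 zero_le_one (fun y => ?_) (fun s => ?_) m hmm fun s hs => ?_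
    · refine intervalIntegral.integral_congr_ae ?_
      filter_upwards [hacν h] with s hs hsJ
      have hsJ' : s ∈ J := hsJ
      simp only [hm, hk, Set.indicator_of_mem hsJ'] at hs
      rw [inv_mul_eq_iff_eq_mul₀ (by simpa using hNr s)] at hs
      rw [hs, ← tsum_mul_left, matAct]
      congr 1; funext y; ring
    · exact ((measurable_mKer_symS x y).comp (measurable_const.sub measurable_id)).indicator hJm
    · by_cases hs : s ∈ J
      · simp only [hk, Set.indicator_of_mem hs]
        exact (formBound_symS_two _).lpN_row_le zero_le_one x
      · simp [hk, hs, lpN]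
    · by_cases hsJ : s ∈ J
      · simp only [hm, hk, hVdef, Set.indicator_of_mem hsJ, hs, if_true]
        rw [matAct, ← tsum_mul_left]
        congr 1; funext y; ring
      · simp [hm, hk, hsJ]

lemma exists_strichartz_exponents {a b a' b' : ℝ} (ha0 : 0 ≤ a) (ha0' : 0 ≤ a')
    (ha : a ≤ 1 / 2) (ha' : a' ≤ 1 / 2) (h : a < 3 / 2 * (1 / 2 - b))
    (h' : a' < 3 / 2 * (1 / 2 - b')) :
    ∃ δ ε : ℝ, 0 < δ ∧ δ ≤ 5 / 12 ∧ 0 < ε ∧ ε ≤ 1 / 2 ∧ 1 < (3 / 2 - ε) * (2 * δ) ∧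
      2 * a * δ ≤ 1 / 2 - b ∧ 2 * a' * δ ≤ 1 / 2 - b' := by
  obtain ⟨τ, hτ0, hτ1, hτ2, hτ3⟩ : ∃ τ : ℝ, 0 < τ ∧ τ ≤ 1 / 12 ∧ τ ≤ 1 / 2 - b - 2 * a / 3 ∧
      τ ≤ 1 / 2 - b' - 2 * a' / 3 :=
    ⟨min (1 / 12) (min (1 / 2 - b - 2 * a / 3) (1 / 2 - b' - 2 * a' / 3)),
      lt_min (by norm_num) (lt_min (by linarith) (by linarith)), min_le_left _ _,
      (min_le_right _ _).trans (min_le_left _ _), (min_le_right _ _).trans (min_le_right _ _)⟩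
  refine ⟨1 / 3 + τ, τ, by linarith, by linarith, hτ0, by linarith, by nlinarith, by nlinarith,
    by nlinarith⟩

lemma toReal_lt_of_admissible {q r : ℝ≥0∞} (hr : 2 ≤ r) (h : 1 / q < 3 / 2 * (1 / 2 - 1 / r)) :
    (1 / q).toReal < 3 / 2 * (1 / 2 - (1 / r).toReal) := by
  have hr' : 1 / r ≤ 1 / 2 := ENNReal.div_le_div_left hr 1
  have h2 : (1 / 2 : ℝ≥0∞) ≠ ∞ := by simp
  have h3 : (3 / 2 : ℝ≥0∞) * (1 / 2 - 1 / r) ≠ ∞ :=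
    ENNReal.mul_ne_top (ENNReal.div_ne_top (by simp) (by simp)) (by simp)
  have := ENNReal.toReal_strict_mono h3 h
  rw [ENNReal.toReal_mul, ENNReal.toReal_sub_of_le hr' h2] at this
  simpa using this

lemma toReal_one_div_le_half {q : ℝ≥0∞} (hq : 2 ≤ q) : (1 / q).toReal ≤ 1 / 2 := by
  have h := ENNReal.toReal_mono (by simp) (ENNReal.div_le_div_left hq 1)
  simpa using h

lemma conjugate_toReal {q q' : ℝ≥0∞} (hq : 2 ≤ q) (h : 1 / q + 1 / q' = 1) :
    q' ≠ ∞ ∧ 0 < q'.toReal ∧ 1 / q'.toReal = 1 - (1 / q).toReal := by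
  have h1 : 1 / q ≤ 1 / 2 := ENNReal.div_le_div_left hq 1
  have hq't : q' ≠ ∞ := by
    rintro rfl
    rw [ENNReal.div_top, add_zero] at h
    rw [h] at h1
    have := ENNReal.toReal_mono (by simp) h1
    norm_num at this
  have hq'0 : q' ≠ 0 := by
    rintro rfl
    simp at h
  have h2 : 1 / q ≠ ∞ := ne_top_of_le_ne_top (by simp) h1
  have h3 : 1 / q' ≠ ∞ := by simp [hq'0]
  have h4 := congrArg ENNReal.toReal h
  rw [ENNReal.toReal_add h2 h3] at h4
  refine ⟨hq't, ENNReal.toReal_pos hq'0 hq't, ?_⟩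
  simp only [one_div, ENNReal.toReal_inv, ENNReal.toReal_one] at h4 ⊢
  linarith

lemma eLpNorm_two_count_eq_lpN (f : (Fin 4 → ℤ) → ℂ) :
    eLpNorm f 2 Measure.count = lpN 2 fun x => ‖f x‖ₑ := by
  have := eLpNorm_count_eq_lpN two_pos f
  simpa using this

lemma enorm_duhamel_le (f g : (Fin 4 → ℤ) → ℂ) {F F' : ℝ → (Fin 4 → ℤ) → ℂ}
    (h : ∀ t x, ‖duhInt F t x‖ₑ ≤ ‖duhInt F' t x‖ₑ) (t : ℝ) (x : Fin 4 → ℤ) :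
    ‖duhamel 4 t f g F x‖ₑ ≤ solAbs f g F' t x := by
  have e : duhamel 4 t f g F x =
      matAct (mKer (symC t)) f x + matAct (mKer (symS t)) g x + duhInt F t x := rfl
  rw [e, solAbs]
  exact (enorm_add_le _ _).trans (add_le_add (enorm_add_le _ _) (h t x))

lemma exists_forcing_bound {q r qb rb qb' rb' : ℝ≥0∞}
    (hq : 2 ≤ q) (hr : 2 ≤ r) (hqb : 2 ≤ qb) (hrb : 2 ≤ rb)
    (hadm : 1/q < 3/2 * (1/2 - 1/r)) (hadmb : 1/qb < 3/2 * (1/2 - 1/rb))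
    (hqb' : 1/qb + 1/qb' = 1) (hrb' : 1/rb + 1/rb' = 1) :
    ∃ K : ℝ≥0∞, K ≠ ∞ ∧ 1 ≤ K ∧
      ∀ (f g : (Fin 4 → ℤ) → ℂ) (F : ℝ → (Fin 4 → ℤ) → ℂ) (Λ : ℝ≥0∞), Λ ≠ ∞ →
        mixedNorm 4 qb' rb' F < Λ →
        mixedNorm 4 q r (fun t => duhamel 4 t f g F) ≤
          K * (eLpNorm f 2 Measure.count + eLpNorm g 2 Measure.count + Λ) := by
  obtain ⟨δ, ε, hδ0, hδ, hε, hε', hεδ, hδq, hδqb⟩ := exists_strichartz_exponents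
    (a := (1 / q).toReal) (b := (1 / r).toReal) (a' := (1 / qb).toReal) (b' := (1 / rb).toReal)
    ENNReal.toReal_nonneg ENNReal.toReal_nonneg
    (toReal_one_div_le_half hq) (toReal_one_div_le_half hqb) (toReal_lt_of_admissible hr hadm)
    (toReal_lt_of_admissible hrb hadmb)
  set a := (1 / qb).toReal with ha
  have ha0 : 0 ≤ a := ENNReal.toReal_nonneg
  have ha2 : a ≤ 1 / 2 := toReal_one_div_le_half hqb
  obtain ⟨hqt, hσ, hσa⟩ := conjugate_toReal hqb hqb'
  obtain ⟨hrt, hρ, hρb⟩ := conjugate_toReal hrb hrb'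
  set σ := qb'.toReal with hσdef
  set ρ := rb'.toReal with hρdef
  set p₀ : ℝ := (1 / 2 + δ)⁻¹ with hp₀
  set r₀ : ℝ := (1 / 2 - δ)⁻¹ with hr₀
  set p : ℝ := (1 / 2 + 2 * a * δ)⁻¹ with hp
  have haδ : 0 ≤ 2 * a * δ := by positivity
  have haδ' : 2 * a * δ ≤ δ := by nlinarith
  have hp₀0 : 0 < p₀ := by positivity
  have hp0 : 0 < p := by positivity
  have hpr₀ : p₀.HolderConjugate r₀ := by
    rw [Real.holderConjugate_iff]
    refine ⟨?_, by rw [hp₀, hr₀, inv_inv, inv_inv]; ring⟩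
    rw [hp₀, one_lt_inv₀ (by positivity)]; linarith
  have hpr : p.HolderConjugate (1 / 2 - 2 * a * δ)⁻¹ := by
    rw [Real.holderConjugate_iff]
    refine ⟨?_, by rw [hp, inv_inv, inv_inv]; ring⟩
    rw [hp, one_lt_inv₀ (by positivity)]; linarith
  have hp₀2 : p₀ < 2 := by rw [hp₀, inv_lt_comm₀ (by positivity) two_pos]; linarith
  have hp2 : p ≤ 2 := by rw [hp, inv_le_comm₀ (by positivity) two_pos]; linarith
  have hp₀p : p₀ ≤ p := by
    rw [hp₀, hp]; exact inv_anti₀ (by positivity) (by linarith)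
  have hρp : ρ ≤ p := by
    have : ρ = (1 / ρ)⁻¹ := by simp
    rw [this, hp, hρb]
    exact inv_anti₀ (by positivity) (by linarith)
  have hr₀2 : 2 ≤ r₀ := by
    rw [hr₀, le_inv_comm₀ two_pos (by linarith)]; linarith
  have hr₀' : 1 / 2 - 1 / r₀ = δ := by rw [hr₀, one_div, one_div, inv_inv]; ring
  have hp₀' : 2 / p₀ - 1 = 2 * δ := by rw [hp₀, div_inv_eq_mul]; ring
  obtain ⟨K, hK, hKE⟩ := exists_energy_bounds hpr₀ hp₀2.le hε hε' (by rw [hp₀']; exact hεδ)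
  refine ⟨max K 1, by simp [hK], le_max_right _ _, fun f g F Λ hΛ hFΛ => ?_⟩
  rw [eLpNorm_two_count_eq_lpN, eLpNorm_two_count_eq_lpN]
  set M := lpN 2 (fun x => ‖f x‖ₑ) + lpN 2 (fun x => ‖g x‖ₑ) + Λ with hM
  rcases eq_or_ne M ∞ with hMt | hMt
  · rw [hMt, ENNReal.mul_top (by simp)]; exact le_top
  have hΛM : Λ ≤ M := le_add_self
  have hΛ0 : Λ ≠ 0 := (pos_of_gt hFΛ).ne'
  set Φ := mixedNorm 4 qb' rb' F with hΦ
  have hΦt : Φ ≠ ∞ := hFΛ.ne_top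
  have hΦσ : ∫⁻ s, lpN p (fun y => ‖F s y‖ₑ) ^ σ ≤ Φ ^ σ := by
    have e : Φ ^ σ = ∫⁻ s, eLpNorm (F s) rb' Measure.count ^ σ := by
      rw [hΦ, mixedNorm, lqNorm, if_neg hqt, ← ENNReal.rpow_mul, one_div_mul_cancel hσ.ne',
        ENNReal.rpow_one]
    rw [e]
    refine lintegral_mono fun s => ENNReal.rpow_le_rpow ?_ hσ.le
    rw [← ENNReal.ofReal_toReal hrt, eLpNorm_count_eq_lpN hρ]
    exact lpN_anti hρ hρp _
  have hΦσt : Φ ^ σ ≠ ∞ := ENNReal.rpow_ne_top_of_nonneg hσ.le hΦt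
  have hlt : Φ ^ σ < Λ ^ σ := ENNReal.rpow_lt_rpow hFΛ hσ
  obtain ⟨N, hNm, hN0, hNt, hNi, hNn⟩ := exists_measurable_majorant
    (fun s => lpN p fun y => ‖F s y‖ₑ) hσ (ne_top_of_le_ne_top hΦσt hΦσ)
    (ε := Λ ^ σ - Φ ^ σ) (tsub_pos_of_lt hlt).ne'
  have hNΛ : ∫⁻ s, N s ^ σ ≤ Λ ^ σ := by
    refine hNi.trans ((add_le_add_left hΦσ _).trans_eq ?_)
    exact add_tsub_cancel_of_le hlt.le
  obtain ⟨F', hF'm, hF'N, hF'⟩ := exists_measurable_forcing hpr hp2 F hNm hN0 hNt hNn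
  obtain ⟨F₀, F₁, hm₀, hm₁, hsplit, ht₀, ht₁, hi₀, hi₁⟩ := exists_splitting (θ := 2 * a) hp0 hp₀0
    hp₀p hp2 hp₀2 hσ (by rw [hσa]; ring) (by rw [hp, hp₀, one_div, inv_inv, div_inv_eq_mul]; ring)
    hF'm hNm hN0 hNt hF'N hΛ0 hΛ hNΛ
  obtain ⟨hE₁, hE₂⟩ := hKE f g F₀ F₁ M hMt (le_add_right le_self_add)
    (le_add_right le_add_self) hm₀ hm₁ ht₀ ht₁ (hi₀.trans hΛM)
    (hi₁.trans (pow_le_pow_left' hΛM 2))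
  rw [← hsplit] at hE₁ hE₂
  have hK1 : K ≤ max K 1 ^ 2 := by
    refine (le_max_left K 1).trans ?_
    rw [sq]
    exact le_mul_of_one_le_right' (le_max_right K 1)
  refine lqNorm_eLpNorm_le hq hr hr₀2 (by rw [hr₀']; exact hδq)
    (ENNReal.mul_ne_top (by simp [hK]) hMt) (fun t => (hE₁ t).trans ?_) (hE₂.trans ?_)
    (enorm_duhamel_le f g hF')
  · exact mul_le_mul_left (le_max_left _ _) _
  · rw [mul_pow]
    exact mul_le_mul_left hK1 _

/-- Strichartz estimates for the discrete Klein--Gordon equation in dimension `d = 4`: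
for `q, r, q̄, r̄ ≥ 2` with `1/q < (3/2)(1/2 − 1/r)` and `1/q̄ < (3/2)(1/2 − 1/r̄)`,
the solution given by Duhamel's formula satisfies
`‖u‖_{L^q_t ℓ^r_x} ≤ C(‖f‖_{ℓ²} + ‖g‖_{ℓ²} + ‖F‖_{L^{q̄'}_t ℓ^{r̄'}_x})`. -/
theorem strichartz_d4 (q r qb rb qb' rb' : ℝ≥0∞)
    (hq : 2 ≤ q) (hr : 2 ≤ r) (hqb : 2 ≤ qb) (hrb : 2 ≤ rb)
    (hadm : 1/q < 3/2 * (1/2 - 1/r))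
    (hadmb : 1/qb < 3/2 * (1/2 - 1/rb))
    (hqb' : 1/qb + 1/qb' = 1) (hrb' : 1/rb + 1/rb' = 1) :
    ∃ C : ℝ, 0 < C ∧
      ∀ (f g : (Fin 4 → ℤ) → ℂ) (F : ℝ → (Fin 4 → ℤ) → ℂ),
        Memℓp f 2 → Memℓp g 2 → mixedNorm 4 qb' rb' F ≠ ∞ →
        mixedNorm 4 q r (fun t => duhamel 4 t f g F) ≤
          ENNReal.ofReal C *
            (eLpNorm f 2 Measure.count + eLpNorm g 2 Measure.count
              + mixedNorm 4 qb' rb' F) := by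
  obtain ⟨K, hK, hK1, h⟩ := exists_forcing_bound hq hr hqb hrb hadm hadmb hqb' hrb'
  refine ⟨K.toReal, ENNReal.toReal_pos (zero_lt_one.trans_le hK1).ne' hK, fun f g F _ _ hF => ?_⟩
  rw [ENNReal.ofReal_toReal hK]
  have hlim : Filter.Tendsto (fun n : ℕ => K * (eLpNorm f 2 Measure.count +
      eLpNorm g 2 Measure.count + (mixedNorm 4 qb' rb' F + (n : ℝ≥0∞)⁻¹))) Filter.atTop
      (nhds (K * (eLpNorm f 2 Measure.count + eLpNorm g 2 Measure.count +
        (mixedNorm 4 qb' rb' F + 0)))) :=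
    ENNReal.Tendsto.const_mul ((ENNReal.tendsto_inv_nat_nhds_zero.const_add _).const_add _)
      (Or.inr hK)
  rw [add_zero] at hlim
  refine ge_of_tendsto hlim (Filter.eventually_atTop.2 ⟨1, fun n hn => ?_⟩)
  have hn0 : (n : ℝ≥0∞)⁻¹ ≠ ∞ := by simp; omega
  exact h f g F _ (ENNReal.add_ne_top.2 ⟨hF, hn0⟩) (ENNReal.lt_add_right hF (by simp))
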